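/- Let $K$ be an algebraic number field of degree $n \geq 6$ over $\mathbb{Q}$. Then for every $\varepsilon \in (0, 1/2)$ there exists a constant $C > 0$ (depending on $K$ and $\varepsilon$) such that for all real $x \geq d_K^{1/2}$ sufficiently large, $\left| \frac{1}{x} \int_1^x \left( \sum_{m \leq t} r_K(m) - \kappa_K t \right) \mathrm{d}t \right| \leq C\, x^{1 - 3/n + \varepsilon}$. -/

import Mathlib

open NumberField Filter Asymptotics Set MeasureTheory

/-- `rK K m` is the number of nonzero integral ideals of the ring of integers of `K`
with absolute norm equal to `m` (for `m ≥ 1` the nonzero condition is automatic). -/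
noncomputable def rK (K : Type*) [Field K] [NumberField K] (m : ℕ) : ℕ :=
  Nat.card {I : Ideal (𝓞 K) // Ideal.absNorm I = m}

/-- The exponential integral `E₁(X) = ∫_X^∞ e^{-t}/t dt`. -/
noncomputable def E1 (X : ℝ) : ℝ := ∫ t in Set.Ioi X, Real.exp (-t) / t

theorem summable_pi_prod_of_nonneg {ι κ : Type*} [Fintype ι] {f : ι → κ → ℝ}
    (hf : ∀ i k, 0 ≤ f i k) (hs : ∀ i, Summable (f i)) :
    Summable fun m : ι → κ => ∏ i, f i (m i) := by
  classical
  refine summable_of_sum_le (c := ∏ i, ∑' k, f i k)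
    (fun m => Finset.prod_nonneg fun i _ => hf i _) fun s => ?_
  calc ∑ m ∈ s, ∏ i, f i (m i)
      ≤ ∑ m ∈ Fintype.piFinset fun i => s.image fun m => m i, ∏ i, f i (m i) := by
        refine Finset.sum_le_sum_of_subset_of_nonneg (fun m hm => ?_)
          fun m _ _ => Finset.prod_nonneg fun i _ => hf i _
        exact Fintype.mem_piFinset.mpr fun i => Finset.mem_image_of_mem _ hm
    _ = ∏ i, ∑ k ∈ s.image fun m => m i, f i k := by rw [Finset.prod_univ_sum]
    _ ≤ ∏ i, ∑' k, f i k := by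
        refine Finset.prod_le_prod (fun i _ => Finset.sum_nonneg fun k _ => hf i k) fun i _ => ?_
        exact (hs i).sum_le_tsum _ fun k _ => hf i k

theorem summable_int_exp_neg_mul_sq {c : ℝ} (hc : 0 < c) :
    Summable fun k : ℤ => Real.exp (-c * (k : ℝ) ^ 2) := by
  have key : Summable fun k : ℕ => Real.exp (-c * (k : ℝ)) := by
    have := Real.summable_exp_neg_nat.comp_injective (Function.injective_id)
    simpa [mul_comm] using (Real.summable_exp_nat_mul_iff (a := -c)).mpr (by linarith)
  have h2 : Summable fun k : ℕ => Real.exp (-c * (k : ℝ) ^ 2) := by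
    refine key.of_nonneg_of_le (fun _ => (Real.exp_pos _).le) fun k => Real.exp_le_exp.mpr ?_
    have : (k : ℝ) ≤ (k : ℝ) ^ 2 := by exact_mod_cast Nat.le_self_pow (by norm_num) k
    nlinarith
  refine Summable.of_nat_of_neg ?_ ?_ <;> simpa using h2

theorem summable_exp_neg_mul_sum_sq {ι : Type*} [Fintype ι] {c : ℝ} (hc : 0 < c) :
    Summable fun m : ι → ℤ => Real.exp (-c * ∑ i, (m i : ℝ) ^ 2) := by
  refine (summable_pi_prod_of_nonneg (ι := ι) (f := fun _ (k : ℤ) => Real.exp (-c * (k : ℝ) ^ 2))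
    (fun _ _ => (Real.exp_pos _).le) fun _ => summable_int_exp_neg_mul_sq hc).congr fun m => ?_
  rw [← Real.exp_sum, Finset.mul_sum]

/-- The half-open unit box, a fundamental domain for the integer translations. -/
def unitBox (ι : Type*) : Set (ι → ℝ) := Set.pi univ fun _ => Ioc (0 : ℝ) 1

theorem measurableSet_unitBox (ι : Type*) [Fintype ι] : MeasurableSet (unitBox ι) :=
  MeasurableSet.univ_pi fun _ => measurableSet_Ioc

theorem volume_unitBox (ι : Type*) [Fintype ι] : volume (unitBox ι) = 1 := by
  simp [unitBox, Real.volume_pi_Ioc]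

theorem iUnion_translate_unitBox (ι : Type*) :
    (⋃ k : ι → ℤ, (fun x : ι → ℝ => fun i => x i + k i) ⁻¹' unitBox ι) = univ := by
  refine eq_univ_of_forall fun x => mem_iUnion.mpr ⟨fun i => 1 - ⌈x i⌉, fun i _ => ?_⟩
  have h1 := Int.le_ceil (x i)
  have h2 := Int.ceil_lt_add_one (x i)
  push_cast
  constructor <;> linarith

theorem pairwise_disjoint_translate_unitBox (ι : Type*) :
    Pairwise (Function.onFun Disjoint
      fun k : ι → ℤ => (fun x : ι → ℝ => fun i => x i + k i) ⁻¹' unitBox ι) := by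
  intro k l hkl
  refine Set.disjoint_left.mpr fun x hk hl => hkl (funext fun i => ?_)
  have h1 := hk i trivial
  have h2 := hl i trivial
  simp only [mem_Ioc] at h1 h2
  have a : (k i : ℝ) < l i + 1 := by linarith
  have b : (l i : ℝ) < k i + 1 := by linarith
  have a' : k i < l i + 1 := by exact_mod_cast a
  have b' : l i < k i + 1 := by exact_mod_cast b
  omega

theorem hasSum_setIntegral_unitBox_translate {ι E : Type*} [Fintype ι] [NormedAddCommGroup E]
    [NormedSpace ℝ E] {h : (ι → ℝ) → E} (hh : Integrable h) :
    HasSum (fun k : ι → ℤ => ∫ x in unitBox ι, h fun i => x i + k i) (∫ x, h x) := by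
  have key := hasSum_integral_iUnion (f := h) (μ := volume)
    (s := fun k : ι → ℤ => (fun x : ι → ℝ => fun i => x i + k i) ⁻¹' unitBox ι)
    (fun k => (measurableSet_unitBox ι).preimage (by fun_prop))
    (pairwise_disjoint_translate_unitBox ι) hh.integrableOn
  rw [iUnion_translate_unitBox, Measure.restrict_univ] at key
  rw [← (Equiv.neg (ι → ℤ)).hasSum_iff] at key
  refine key.congr_fun fun k => ?_ 
  have mp : MeasurePreserving (fun x : ι → ℝ => x + (fun i => (k i : ℝ))) volume volume :=
    measurePreserving_add_right _ _
  have me : MeasurableEmbedding (fun x : ι → ℝ => x + (fun i => (k i : ℝ))) :=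
    measurableEmbedding_addRight _
  simp only [Function.comp, Equiv.neg_apply]
  rw [← mp.setIntegral_preimage_emb me h]
  have hset : (fun x : ι → ℝ => x + fun i => (k i : ℝ)) ⁻¹'
      ((fun x : ι → ℝ => fun i => x i + ((-k) i : ℤ)) ⁻¹' unitBox ι) = unitBox ι := by
    ext x
    simp [unitBox]
  rw [hset]
  rfl

/-- Poisson summation over `ℤ^ι` for continuous functions with locally uniformly summable
translates and summable Fourier coefficients. -/
theorem tsum_int_pi_eq_tsum_fourier {ι : Type*} [Fintype ι] {F : (ι → ℝ) → ℂ} (hF : Continuous F)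
    (hint : Integrable F)
    (hdom : ∀ R : ℝ, ∃ u : (ι → ℤ) → ℝ, Summable u ∧ ∀ m, ∀ x : ι → ℝ, ‖x‖ ≤ R →
      ‖F fun i => x i + m i‖ ≤ u m)
    (hsum : Summable fun k : ι → ℤ =>
      ∫ x : ι → ℝ, Complex.exp (-2 * Real.pi * Complex.I * ∑ i, (k i : ℂ) * x i) * F x) :
    ∑' m : ι → ℤ, F (fun i => m i) = ∑' k : ι → ℤ,
      ∫ x : ι → ℝ, Complex.exp (-2 * Real.pi * Complex.I * ∑ i, (k i : ℂ) * x i) * F x := by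
  have hsx : ∀ x : ι → ℝ, Summable fun m : ι → ℤ => F fun i => x i + m i := fun x => by
    obtain ⟨u, hu, hb⟩ := hdom ‖x‖
    exact hu.of_norm_bounded fun m => hb m x le_rfl
  have hcont : Continuous fun x : ι → ℝ => ∑' m : ι → ℤ, F fun i => x i + m i := by
    rw [continuous_iff_continuousAt]
    intro x
    obtain ⟨u, hu, hb⟩ := hdom (‖x‖ + 1)
    have : ContinuousOn (fun x : ι → ℝ => ∑' m : ι → ℤ, F fun i => x i + m i)
        (Metric.ball 0 (‖x‖ + 1)) := by
      refine continuousOn_tsum (fun m => ?_) hu fun m y hy => hb m y ?_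
      · exact (hF.comp (by fun_prop)).continuousOn
      · simpa using (mem_ball_zero_iff.mp hy).le
    exact this.continuousAt (Metric.isOpen_ball.mem_nhds (by simp))
  have hq : IsOpenQuotientMap (fun (x : ι → ℝ) => (fun i => (x i : UnitAddCircle))) :=
    IsOpenQuotientMap.piMap (f := fun (_ : ι) (y : ℝ) => (y : UnitAddCircle))
      fun _ => QuotientAddGroup.isOpenQuotientMap_mk
  have hfac : Function.FactorsThrough (fun x : ι → ℝ => ∑' m : ι → ℤ, F fun i => x i + m i)
      (fun (x : ι → ℝ) => (fun i => (x i : UnitAddCircle))) := by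
    intro x y hxy
    have : ∀ i, ∃ n : ℤ, x i = y i + n := fun i => by
      have := congrFun hxy i
      simp only at this
      rw [QuotientAddGroup.eq, AddSubgroup.mem_zmultiples_iff] at this
      obtain ⟨n, hn⟩ := this
      refine ⟨-n, ?_⟩
      simp at hn ⊢
      linarith
    choose n hn using this
    simp only
    rw [← (Equiv.addLeft n).tsum_eq (fun m : ι → ℤ => F fun i => y i + m i)]
    refine tsum_congr fun m => congrArg F (funext fun i => ?_)
    simp [hn]; ring
  let f : C(UnitAddTorus ι, ℂ) :=
    ((hq.isQuotientMap).lift (f := ⟨_, hq.continuous⟩) ⟨_, hcont⟩ hfac)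
  have hf : ∀ x : ι → ℝ, f (fun i => (x i : UnitAddCircle)) = ∑' m : ι → ℤ, F fun i => x i + m i := by
    intro x
    exact DFunLike.congr_fun (Topology.IsQuotientMap.lift_comp (hq.isQuotientMap)
      (f := ⟨_, hq.continuous⟩) ⟨_, hcont⟩ hfac) x
  have hexp : ∀ (k : ι → ℤ) (x : ι → ℝ), UnitAddTorus.mFourier (-k) (fun i => (x i : UnitAddCircle))
      = Complex.exp (-2 * Real.pi * Complex.I * ∑ i, (k i : ℂ) * x i) := by
    intro k x
    simp only [UnitAddTorus.mFourier, ContinuousMap.coe_mk, fourier_coe_apply]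
    rw [← Complex.exp_sum, Finset.mul_sum]
    congr 1
    refine Finset.sum_congr rfl fun i _ => ?_
    simp; ring
  have hexpn : ∀ (k : ι → ℤ) (x : ι → ℝ),
      ‖Complex.exp (-2 * Real.pi * Complex.I * ∑ i, (k i : ℂ) * x i)‖ = 1 := by
    intro k x
    rw [← hexp]
    simp only [UnitAddTorus.mFourier, ContinuousMap.coe_mk, norm_prod, fourier_apply,
      Circle.norm_coe, Finset.prod_const_one]
  have hcoeff : ∀ k : ι → ℤ, UnitAddTorus.mFourierCoeff f k =
      ∫ x : ι → ℝ, Complex.exp (-2 * Real.pi * Complex.I * ∑ i, (k i : ℂ) * x i) * F x := by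
    intro k
    have hi : Integrable fun x : ι → ℝ =>
        Complex.exp (-2 * Real.pi * Complex.I * ∑ i, (k i : ℂ) * x i) * F x := by
      refine hint.bdd_mul (c := 1) (Continuous.aestronglyMeasurable (by fun_prop)) ?_
      exact .of_forall fun x => (hexpn k x).le
    have hper : ∀ (m : ι → ℤ) (x : ι → ℝ),
        Complex.exp (-2 * Real.pi * Complex.I * ∑ i, (k i : ℂ) * ((x i + m i : ℝ) : ℂ)) =
        Complex.exp (-2 * Real.pi * Complex.I * ∑ i, (k i : ℂ) * x i) := by
      intro m x
      rw [← hexp, ← hexp]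
      congr 1
      funext i
      simp
    rw [UnitAddTorus.mFourierCoeff_eq_integral f k 0,
      ← (hasSum_setIntegral_unitBox_translate hi).tsum_eq]
    have hset : {x : ι → ℝ | ∀ i, x i ∈ Ioc ((0 : ι → ℝ) i) ((0 : ι → ℝ) i + 1)} = unitBox ι := by
      ext x; simp [unitBox]
    rw [hset]
    simp_rw [hf, hexp, smul_eq_mul, hper, ← tsum_mul_left]
    obtain ⟨u, hu, hb⟩ := hdom 1
    have hbox : ∀ x ∈ unitBox ι, ‖x‖ ≤ 1 := by
      intro x hx
      refine (pi_norm_le_iff_of_nonneg zero_le_one).mpr fun i => ?_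
      have := hx i trivial
      rw [Real.norm_eq_abs, abs_le]
      constructor <;> linarith [this.1, this.2]
    have hfin : IsFiniteMeasure (volume.restrict (unitBox ι)) :=
      ⟨by simp [volume_unitBox]⟩
    have hbd : ∀ m : ι → ℤ, ∀ᵐ x ∂(volume.restrict (unitBox ι)),
        ‖Complex.exp (-2 * Real.pi * Complex.I * ∑ i, (k i : ℂ) * x i) * F fun i => x i + m i‖
          ≤ u m := by
      intro m
      filter_upwards [ae_restrict_mem (measurableSet_unitBox ι)] with x hx
      rw [norm_mul, hexpn, one_mul]
      exact hb m x (hbox x hx)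
    have hint' : ∀ m : ι → ℤ, Integrable (fun x : ι → ℝ =>
        Complex.exp (-2 * Real.pi * Complex.I * ∑ i, (k i : ℂ) * x i) * F fun i => x i + m i)
        (volume.restrict (unitBox ι)) := by
      intro m
      refine Integrable.of_bound (C := u m) ?_ (hbd m)
      exact ((Continuous.mul (by fun_prop) (hF.comp (by fun_prop)))).aestronglyMeasurable
    refine (hasSum_integral_of_summable_integral_norm hint' ?_).tsum_eq.symm
    refine hu.of_nonneg_of_le (fun m => integral_nonneg fun _ => norm_nonneg _) fun m => ?_
    calc _ ≤ ∫ x in unitBox ι, u m := integral_mono_ae (hint' m).norm (integrable_const _) (hbd m)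
      _ = u m := by simp [Measure.real, volume_unitBox]
  have hS : Summable (UnitAddTorus.mFourierCoeff f) := hsum.congr fun k => (hcoeff k).symm
  have h0 := UnitAddTorus.hasSum_mFourier_series_apply_of_summable hS 0
  have e0 : f 0 = ∑' m : ι → ℤ, F (fun i => m i) := by
    have := hf 0
    simpa [Pi.zero_def] using this
  rw [← e0, ← h0.tsum_eq]
  refine tsum_congr fun k => ?_
  rw [← hcoeff]
  simp [UnitAddTorus.mFourier]

theorem exists_mul_sum_sq_le_sum_mulVec_sq {ι : Type*} [Fintype ι] [DecidableEq ι]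
    {B N : Matrix ι ι ℝ} (h : N * B = 1) :
    ∃ c > 0, ∀ x : ι → ℝ, c * ∑ i, x i ^ 2 ≤ ∑ i, (B.mulVec x) i ^ 2 := by
  set D : ℝ := ∑ i, ∑ j, N i j ^ 2
  have hD : 0 ≤ D := Finset.sum_nonneg fun i _ => Finset.sum_nonneg fun j _ => sq_nonneg _
  refine ⟨(D + 1)⁻¹, by positivity, fun x => ?_⟩
  have hx : N.mulVec (B.mulVec x) = x := by rw [Matrix.mulVec_mulVec, h, Matrix.one_mulVec]
  have key : ∑ i, x i ^ 2 ≤ D * ∑ i, (B.mulVec x) i ^ 2 := by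
    rw [Finset.sum_mul]
    refine Finset.sum_le_sum fun i _ => ?_
    have : x i = ∑ j, N i j * (B.mulVec x) j := by
      conv_lhs => rw [← hx]
      rfl
    rw [this]
    exact Finset.sum_mul_sq_le_sq_mul_sq _ _ _
  have h0 : 0 ≤ ∑ i, (B.mulVec x) i ^ 2 := Finset.sum_nonneg fun i _ => sq_nonneg _
  rw [inv_mul_le_iff₀ (by positivity)]
  linarith

theorem integral_comp_mulVec {ι : Type*} [Fintype ι] [DecidableEq ι] {B : Matrix ι ι ℝ}
    (hB : B.det ≠ 0) (f : (ι → ℝ) → ℂ) :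
    ∫ x, f (B.mulVec x) = |B.det|⁻¹ * ∫ x, f x := by
  have hm := Real.map_matrix_volume_pi_eq_smul_volume_pi hB
  have hu : IsUnit B.det := isUnit_iff_ne_zero.mpr hB
  let e : (ι → ℝ) ≃ₗ[ℝ] (ι → ℝ) := Matrix.toLinearEquiv' B (B.invertibleOfIsUnitDet hu)
  have hemb : MeasurableEmbedding (Matrix.toLin' B) :=
    (e.toContinuousLinearEquiv.toHomeomorph.measurableEmbedding :)
  have := hemb.integral_map (μ := volume) f
  rw [hm, integral_smul_measure] at this
  simp only [Matrix.toLin'_apply] at this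
  rw [← this, ENNReal.toReal_ofReal (abs_nonneg _), abs_inv, Complex.real_smul]

theorem tsum_int_gaussian_mulVec {ι : Type*} [Fintype ι] [DecidableEq ι] {B N : Matrix ι ι ℝ}
    (h : N.transpose * B = 1) :
    ∑' m : ι → ℤ, Real.exp (-Real.pi * ∑ i, (B.mulVec fun j => (m j : ℝ)) i ^ 2) =
      |B.det|⁻¹ * ∑' m : ι → ℤ, Real.exp (-Real.pi * ∑ i, (N.mulVec fun j => (m j : ℝ)) i ^ 2) := by
  obtain ⟨c, hc, hcB⟩ := exists_mul_sum_sq_le_sum_mulVec_sq h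
  have h' : B.transpose * N = 1 := by
    have := congrArg Matrix.transpose h
    simpa using this
  obtain ⟨c', hc', hcN⟩ := exists_mul_sum_sq_le_sum_mulVec_sq h'
  have hdet : B.det ≠ 0 := by
    intro h0
    have := congrArg Matrix.det h
    simp [h0] at this
  have hBN : ∀ k x : ι → ℝ, ∑ i, (N.mulVec k) i * (B.mulVec x) i = ∑ i, k i * x i := by
    intro k x
    have e1 : N.mulVec k ⬝ᵥ B.mulVec x = k ⬝ᵥ x := by
      rw [← Matrix.vecMul_transpose N k, ← Matrix.dotProduct_mulVec, Matrix.mulVec_mulVec, h,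
        Matrix.one_mulVec]
    simpa [dotProduct] using e1
  set F : (ι → ℝ) → ℂ := fun x => Complex.exp (-Real.pi * ∑ i, ((B.mulVec x) i : ℂ) ^ 2) with hFdef
  have hFr : ∀ x, F x = ((Real.exp (-Real.pi * ∑ i, (B.mulVec x) i ^ 2) : ℝ) : ℂ) := by
    intro x; simp [hFdef]
  have hFn : ∀ x, ‖F x‖ ≤ Real.exp (-(Real.pi * c) * ∑ i, x i ^ 2) := by
    intro x
    rw [hFr, Complex.norm_real, Real.norm_eq_abs, Real.abs_exp]
    refine Real.exp_le_exp.mpr ?_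
    have := mul_le_mul_of_nonneg_left (hcB x) Real.pi_pos.le
    nlinarith
  have hFc : Continuous F := by
    have : Continuous fun x : ι → ℝ => B.mulVec x := (Matrix.toLin' B).continuous_of_finiteDimensional
    have h2 : ∀ i, Continuous fun x : ι → ℝ => B.mulVec x i := fun i => (continuous_apply i).comp this
    fun_prop
  have hπc : 0 < Real.pi * c := by positivity
  have hFi : Integrable F := by
    have h1 : Integrable fun x : ι → ℝ => ∏ i, Real.exp (-(Real.pi * c) * x i ^ 2) :=
      Integrable.fintype_prod (f := fun _ (y : ℝ) => Real.exp (-(Real.pi * c) * y ^ 2))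
        fun _ => integrable_exp_neg_mul_sq hπc
    refine h1.mono' hFc.aestronglyMeasurable (.of_forall fun x => ?_)
    rw [← Real.exp_sum, ← Finset.mul_sum]
    exact hFn x
  have hFT : ∀ k : ι → ℤ,
      ∫ x : ι → ℝ, Complex.exp (-2 * Real.pi * Complex.I * ∑ i, (k i : ℂ) * x i) * F x =
      ((|B.det|⁻¹ * Real.exp (-Real.pi * ∑ i, (N.mulVec fun j => (k j : ℝ)) i ^ 2) : ℝ) : ℂ) := by
    intro k
    set l : ι → ℝ := N.mulVec fun j => (k j : ℝ)
    have e1 : ∀ x : ι → ℝ, Complex.exp (-2 * Real.pi * Complex.I * ∑ i, (k i : ℂ) * x i) * F x =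
        (fun y : ι → ℝ => Complex.exp (-(Real.pi : ℂ) * ∑ i, (y i : ℂ) ^ 2 +
          ∑ i, (-2 * Real.pi * Complex.I * l i) * (y i : ℂ))) (B.mulVec x) := by
      intro x
      simp only [hFdef]
      rw [← Complex.exp_add, add_comm]
      congr 2
      have := hBN (fun j => (k j : ℝ)) x
      have h2 := congrArg (fun r : ℝ => (r : ℂ)) this
      push_cast at h2
      rw [← h2, Finset.mul_sum]
      exact Finset.sum_congr rfl fun i _ => by ring
    refine (integral_congr_ae (.of_forall e1)).trans ((integral_comp_mulVec hdet
      fun y : ι → ℝ => Complex.exp (-(Real.pi : ℂ) * ∑ i, (y i : ℂ) ^ 2 +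
          ∑ i, (-2 * Real.pi * Complex.I * l i) * (y i : ℂ))).trans ?_)
    rw [GaussianFourier.integral_cexp_neg_mul_sum_add (by simp [Real.pi_pos]),
      div_self (by exact_mod_cast Real.pi_ne_zero), Complex.one_cpow, one_mul]
    push_cast
    congr 2
    rw [Finset.mul_sum, Finset.sum_div]
    refine Finset.sum_congr rfl fun i _ => ?_
    have hpi : (Real.pi : ℂ) ≠ 0 := by exact_mod_cast Real.pi_ne_zero
    field_simp
    ring_nf
    simp
  have hsN : Summable fun m : ι → ℤ =>
      Real.exp (-Real.pi * ∑ i, (N.mulVec fun j => (m j : ℝ)) i ^ 2) := by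
    refine (summable_exp_neg_mul_sum_sq (ι := ι) (c := Real.pi * c') (by positivity)).of_nonneg_of_le
      (fun _ => (Real.exp_pos _).le) fun m => Real.exp_le_exp.mpr ?_
    have := mul_le_mul_of_nonneg_left (hcN fun j => (m j : ℝ)) Real.pi_pos.le
    nlinarith
  have key := tsum_int_pi_eq_tsum_fourier hFc hFi ?_ ?_
  · simp_rw [hFT, hFr] at key
    rw [← Complex.ofReal_tsum, ← Complex.ofReal_tsum] at key
    rw [← tsum_mul_left]
    exact_mod_cast key
  · intro R
    have hs := (summable_exp_neg_mul_sum_sq (ι := ι) (c := Real.pi * c / 2) (by positivity)).mul_left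
      (Real.exp (Real.pi * c * ∑ _i : ι, R ^ 2))
    refine ⟨_, hs, fun m x hx => ?_⟩
    refine (hFn _).trans ?_
    rw [← Real.exp_add]
    refine Real.exp_le_exp.mpr ?_
    rw [Finset.mul_sum, Finset.mul_sum, Finset.mul_sum, ← Finset.sum_add_distrib]
    refine Finset.sum_le_sum fun i _ => ?_
    have hxi : x i ^ 2 ≤ R ^ 2 := by
      have h1 : |x i| ≤ R := (norm_le_pi_norm x i).trans hx
      exact sq_le_sq' (by linarith [neg_abs_le (x i)]) (by linarith [le_abs_self (x i)])
    have e : 0 ≤ (2 * x i + m i) ^ 2 := sq_nonneg _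
    nlinarith [mul_nonneg hπc.le e, mul_le_mul_of_nonneg_left hxi hπc.le]
  · simp_rw [hFT]
    exact Complex.ofRealCLM.summable (hsN.mul_left _)

section IdealTheta

open scoped nonZeroDivisors

variable {K : Type*} [Field K] [NumberField K]

/-- The quadratic form `∑_w [K_w : ℝ] t_w |x|_w²` on a number field. -/
noncomputable def placeForm (t : InfinitePlace K → ℝ) (x : K) : ℝ :=
  ∑ w : InfinitePlace K, w.mult * t w * w x ^ 2

/-- The theta series of a fractional ideal with archimedean weights `t`. -/
noncomputable def idealTheta (I : FractionalIdeal (𝓞 K)⁰ K) (t : InfinitePlace K → ℝ) : ℝ :=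
  ∑' x : {x : K // x ∈ I}, Real.exp (-Real.pi * placeForm t x)

/-- The `ℤ`-linear combination of a basis with given integer coordinates. -/
noncomputable def latticePoint {ι : Type*} [Fintype ι] (b : Module.Basis ι ℚ K) (m : ι → ℤ) : K :=
  ∑ i, (m i : K) * b i

theorem latticePoint_injective {ι : Type*} [Fintype ι] (b : Module.Basis ι ℚ K) :
    Function.Injective (latticePoint b) := by
  intro m m' h
  have h1 : ∑ i, ((m i : ℚ)) • b i = ∑ i, ((m' i : ℚ)) • b i := by
    simpa [latticePoint, Algebra.smul_def] using h
  funext i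
  have := congrArg (fun x => b.repr x i) h1
  rw [b.repr_sum_self, b.repr_sum_self] at this
  exact_mod_cast this

theorem exists_latticePoint_eq_iff {ι : Type*} [Fintype ι] (b : Module.Basis ι ℚ K) (x : K) :
    x ∈ Submodule.span ℤ (range b) ↔ ∃ m, latticePoint b m = x := by
  rw [Submodule.mem_span_range_iff_exists_fun]
  simp [latticePoint]

/-- Integer coordinates on a fractional ideal spanned by a basis. -/
noncomputable def latticeEquiv {ι : Type*} [Fintype ι] {b : Module.Basis ι ℚ K}
    {I : FractionalIdeal (𝓞 K)⁰ K} (h : ∀ x, x ∈ I ↔ x ∈ Submodule.span ℤ (range b)) :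
    (ι → ℤ) ≃ {x : K // x ∈ I} :=
  Equiv.ofBijective
    (fun m => ⟨latticePoint b m, (h _).mpr ((exists_latticePoint_eq_iff b _).mpr ⟨m, rfl⟩)⟩)
    ⟨fun m m' hm => latticePoint_injective b (congrArg Subtype.val hm), fun x => by
      obtain ⟨m, hm⟩ := (exists_latticePoint_eq_iff b x.1).mp ((h x.1).mp x.2)
      exact ⟨m, Subtype.ext hm⟩⟩

theorem coe_latticeEquiv {ι : Type*} [Fintype ι] {b : Module.Basis ι ℚ K}
    {I : FractionalIdeal (𝓞 K)⁰ K} (h : ∀ x, x ∈ I ↔ x ∈ Submodule.span ℤ (range b))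
    (m : ι → ℤ) : (latticeEquiv h m : K) = latticePoint b m := rfl

theorem exists_basis_fractionalIdeal [DecidableEq (K →+* ℂ)] (I : FractionalIdeal (𝓞 K)⁰ K) (hI : I ≠ 0) :
    ∃ b : Module.Basis (K →+* ℂ) ℚ K,
      (∀ x, x ∈ I ↔ x ∈ Submodule.span ℤ (range b)) ∧
      ∀ x, x ∈ FractionalIdeal.dual ℤ ℚ I ↔ x ∈ Submodule.span ℤ (range b.traceDual) := by
  classical
  have hc : Fintype.card (Module.Free.ChooseBasisIndex ℤ (Units.mk0 I hI : FractionalIdeal (𝓞 K)⁰ K)) =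
      Fintype.card (K →+* ℂ) := by
    rw [Embeddings.card, Module.finrank_eq_card_basis (basisOfFractionalIdeal K (Units.mk0 I hI))]
  have e := Fintype.equivOfCardEq hc
  set b := (basisOfFractionalIdeal K (Units.mk0 I hI)).reindex e
  have hb : ∀ x, x ∈ I ↔ x ∈ Submodule.span ℤ (range b) := by
    intro x
    have h1 : range b = range (basisOfFractionalIdeal K (Units.mk0 I hI)) :=
      Module.Basis.range_reindex _ _
    rw [h1, mem_span_basisOfFractionalIdeal]
    rfl
  refine ⟨b, hb, fun x => ?_⟩
  have h2 := Submodule.traceDual_span_of_basis ℤ (K := ℚ) (I : Submodule (𝓞 K) K) b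
    (Submodule.ext fun x => hb x)
  rw [← h2, ← FractionalIdeal.coe_dual ℤ ℚ hI]
  rfl

theorem sum_embeddings_eq_zero_of_conjugate {f : (K →+* ℂ) → ℝ}
    (h : ∀ σ, f (ComplexEmbedding.conjugate σ) = -f σ) : ∑ σ, f σ = 0 := by
  have h1 : ∑ σ, f (ComplexEmbedding.conjugate σ) = ∑ σ, f σ :=
    Equiv.sum_comp (ComplexEmbedding.involutive_conjugate K).toPerm f
  simp only [h, Finset.sum_neg_distrib] at h1
  linarith

theorem sum_embeddings_mk (f : InfinitePlace K → ℝ) :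
    ∑ σ : K →+* ℂ, f (InfinitePlace.mk σ) = ∑ w : InfinitePlace K, w.mult * f w := by
  classical
  rw [← Finset.sum_fiberwise Finset.univ (fun σ : K →+* ℂ => InfinitePlace.mk σ)]
  refine Finset.sum_congr rfl fun w _ => ?_
  rw [Finset.sum_congr rfl (g := fun _ => f w)
    (fun σ hσ => by rw [(Finset.mem_filter.mp hσ).2]), Finset.sum_const,
    InfinitePlace.card_filter_mk_eq, nsmul_eq_mul]

theorem prod_embeddings_mk (f : InfinitePlace K → ℝ) :
    ∏ σ : K →+* ℂ, f (InfinitePlace.mk σ) = ∏ w : InfinitePlace K, f w ^ w.mult := by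
  classical
  rw [← Finset.prod_fiberwise Finset.univ (fun σ : K →+* ℂ => InfinitePlace.mk σ)]
  refine Finset.prod_congr rfl fun w _ => ?_
  rw [Finset.prod_congr rfl (g := fun _ => f w)
    (fun σ hσ => by rw [(Finset.mem_filter.mp hσ).2]), Finset.prod_const,
    InfinitePlace.card_filter_mk_eq]

theorem ratCast_trace_eq_sum (x : K) :
    ((Algebra.trace ℚ K x : ℚ) : ℝ) = ∑ σ : K →+* ℂ, (σ x).re := by
  have h := trace_eq_sum_embeddings (K := ℚ) (L := K) ℂ (x := x)
  have h2 : ∑ σ : K →+* ℂ, σ x = ∑ σ : K →ₐ[ℚ] ℂ, σ x :=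
    Fintype.sum_equiv (RingHom.equivRatAlgHom K ℂ) _ _ fun σ => rfl
  rw [← h2] at h
  have := congrArg Complex.re h
  simpa using this

/-- The twisted Minkowski matrix of a basis. -/
noncomputable def minkowskiMatrix (t : InfinitePlace K → ℝ) (δ : ℝ)
    (b : Module.Basis (K →+* ℂ) ℚ K) : Matrix (K →+* ℂ) (K →+* ℂ) ℝ :=
  Matrix.of fun σ i => √(t (InfinitePlace.mk σ)) * ((σ (b i)).re + δ * (σ (b i)).im)

theorem minkowskiMatrix_mulVec (t : InfinitePlace K → ℝ) (δ : ℝ)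
    (b : Module.Basis (K →+* ℂ) ℚ K) (m : (K →+* ℂ) → ℤ) (σ : K →+* ℂ) :
    (minkowskiMatrix t δ b).mulVec (fun j => (m j : ℝ)) σ =
      √(t (InfinitePlace.mk σ)) * ((σ (latticePoint b m)).re + δ * (σ (latticePoint b m)).im) := by
  simp only [Matrix.mulVec, dotProduct, minkowskiMatrix, Matrix.of_apply, latticePoint, map_sum,
    map_mul, map_intCast, Complex.re_sum, Complex.im_sum, Finset.mul_sum, ← Finset.sum_add_distrib]
  refine Finset.sum_congr rfl fun i _ => ?_
  simp [Complex.mul_re, Complex.mul_im]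
  ring

theorem sum_minkowskiMatrix_mulVec_sq {t : InfinitePlace K → ℝ} (ht : ∀ w, 0 < t w) {δ : ℝ}
    (hδ : δ ^ 2 = 1) (b : Module.Basis (K →+* ℂ) ℚ K) (m : (K →+* ℂ) → ℤ) :
    ∑ σ, (minkowskiMatrix t δ b).mulVec (fun j => (m j : ℝ)) σ ^ 2 =
      placeForm t (latticePoint b m) := by
  set x := latticePoint b m
  have h1 : ∀ σ : K →+* ℂ, (minkowskiMatrix t δ b).mulVec (fun j => (m j : ℝ)) σ ^ 2 =
      t (InfinitePlace.mk σ) * InfinitePlace.mk σ x ^ 2 +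
        t (InfinitePlace.mk σ) * (2 * δ * ((σ x).re * (σ x).im)) := by
    intro σ
    rw [minkowskiMatrix_mulVec, mul_pow, Real.sq_sqrt (ht _).le, InfinitePlace.apply,
      Complex.sq_norm, Complex.normSq_apply]
    linear_combination t (InfinitePlace.mk σ) * (σ x).im ^ 2 * hδ
  rw [Finset.sum_congr rfl fun σ _ => h1 σ, Finset.sum_add_distrib,
    sum_embeddings_eq_zero_of_conjugate (f := fun σ => t (InfinitePlace.mk σ) *
      (2 * δ * ((σ x).re * (σ x).im))), add_zero,
    sum_embeddings_mk fun w => t w * w x ^ 2, placeForm]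
  · exact Finset.sum_congr rfl fun w _ => by ring
  · intro σ
    simp [ComplexEmbedding.conjugate_coe_eq]

theorem minkowskiMatrix_traceDual_transpose_mul [DecidableEq (K →+* ℂ)] {t : InfinitePlace K → ℝ}
    (ht : ∀ w, 0 < t w) (b : Module.Basis (K →+* ℂ) ℚ K) :
    (minkowskiMatrix (fun w => (t w)⁻¹) (-1) b.traceDual).transpose * minkowskiMatrix t 1 b = 1 := by
  ext i j
  have h1 : ∀ σ : K →+* ℂ,
      (minkowskiMatrix (fun w => (t w)⁻¹) (-1) b.traceDual) σ i * minkowskiMatrix t 1 b σ j =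
      (σ (b.traceDual i * b j)).re +
        ((σ (b.traceDual i)).re * (σ (b j)).im - (σ (b.traceDual i)).im * (σ (b j)).re) := by
    intro σ
    have h0 : √(t (InfinitePlace.mk σ)) ≠ 0 := (Real.sqrt_pos.mpr (ht _)).ne'
    simp only [minkowskiMatrix, Matrix.of_apply, Real.sqrt_inv, map_mul, Complex.mul_re]
    field_simp
    ring
  simp only [Matrix.mul_apply, Matrix.transpose_apply]
  rw [Finset.sum_congr rfl fun σ _ => h1 σ, Finset.sum_add_distrib,
    sum_embeddings_eq_zero_of_conjugate (f := fun σ => (σ (b.traceDual i)).re * (σ (b j)).im -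
      (σ (b.traceDual i)).im * (σ (b j)).re), add_zero, ← ratCast_trace_eq_sum,
    Module.Basis.trace_traceDual_mul, Matrix.one_apply]
  · by_cases h : i = j
    · simp [h]
    · simp [h, Ne.symm h]
  · intro σ
    simp [ComplexEmbedding.conjugate_coe_eq]
    ring

theorem det_minkowskiMatrix [DecidableEq (K →+* ℂ)] (t : InfinitePlace K → ℝ) (δ : ℝ)
    (b : Module.Basis (K →+* ℂ) ℚ K) :
    (minkowskiMatrix t δ b).det =
      (∏ w, √(t w) ^ w.mult) * (minkowskiMatrix (fun _ => 1) δ b).det := by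
  rw [← prod_embeddings_mk fun w => √(t w), ← Matrix.det_mul_column]
  congr 1
  ext σ i
  simp [minkowskiMatrix]

/-- Transformation formula for the theta series of a fractional ideal. -/
theorem exists_idealTheta_eq_dual (I : FractionalIdeal (𝓞 K)⁰ K) (hI : I ≠ 0) :
    ∃ C > 0, ∀ t : InfinitePlace K → ℝ, (∀ w, 0 < t w) →
      idealTheta I t = C * (∏ w, √(t w) ^ w.mult)⁻¹ *
        idealTheta (FractionalIdeal.dual ℤ ℚ I) fun w => (t w)⁻¹ := by
  classical
  obtain ⟨b, hb, hb'⟩ := exists_basis_fractionalIdeal I hI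
  have h1 := minkowskiMatrix_traceDual_transpose_mul (t := fun _ => 1) (fun _ => one_pos) b
  have hdet : (minkowskiMatrix (fun _ => 1) 1 b).det ≠ 0 := by
    intro h0
    have := congrArg Matrix.det h1
    simp [h0] at this
  refine ⟨|(minkowskiMatrix (fun _ => 1) 1 b).det|⁻¹, by positivity, fun t ht => ?_⟩
  have key := tsum_int_gaussian_mulVec (minkowskiMatrix_traceDual_transpose_mul ht b)
  simp only [sum_minkowskiMatrix_mulVec_sq ht (one_pow 2),
    sum_minkowskiMatrix_mulVec_sq (fun w => inv_pos.mpr (ht w)) (neg_one_sq)] at key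
  have hp : 0 < ∏ w, √(t w) ^ w.mult :=
    Finset.prod_pos fun w _ => pow_pos (Real.sqrt_pos.mpr (ht w)) _
  rw [det_minkowskiMatrix, abs_mul, abs_of_pos hp, mul_inv, mul_comm (_)⁻¹] at key
  rw [idealTheta, idealTheta, ← Equiv.tsum_eq (latticeEquiv hb), ← Equiv.tsum_eq (latticeEquiv hb')]
  exact key

theorem placeForm_mono {s t : InfinitePlace K → ℝ} (h : ∀ w, s w ≤ t w) (x : K) :
    placeForm s x ≤ placeForm t x := by
  refine Finset.sum_le_sum fun w _ => ?_
  have := h w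
  gcongr

theorem placeForm_const (a : ℝ) (x : K) :
    placeForm (fun _ => a) x = a * placeForm (fun _ => 1) x := by
  rw [placeForm, placeForm, Finset.mul_sum]
  exact Finset.sum_congr rfl fun w _ => by ring

theorem exists_mul_sum_sq_le_placeForm (b : Module.Basis (K →+* ℂ) ℚ K) :
    ∃ c > 0, ∀ m, c * ∑ i, (m i : ℝ) ^ 2 ≤ placeForm (fun _ => 1) (latticePoint b m) := by
  classical
  obtain ⟨c, hc, h⟩ := exists_mul_sum_sq_le_sum_mulVec_sq
    (minkowskiMatrix_traceDual_transpose_mul (t := fun _ => 1) (fun _ => one_pos) b)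
  refine ⟨c, hc, fun m => ?_⟩
  have := h fun i => (m i : ℝ)
  rwa [sum_minkowskiMatrix_mulVec_sq (fun _ => one_pos) (one_pow 2)] at this

theorem summable_exp_neg_placeForm {I : FractionalIdeal (𝓞 K)⁰ K} (hI : I ≠ 0)
    {t : InfinitePlace K → ℝ} (ht : ∀ w, 0 < t w) :
    Summable fun x : {x : K // x ∈ I} => Real.exp (-Real.pi * placeForm t x) := by
  classical
  obtain ⟨b, hb, -⟩ := exists_basis_fractionalIdeal I hI
  obtain ⟨c, hc, h⟩ := exists_mul_sum_sq_le_placeForm b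
  obtain ⟨w₀, hw₀⟩ := Finite.exists_min t
  rw [← (latticeEquiv hb).summable_iff]
  refine (summable_exp_neg_mul_sum_sq (c := Real.pi * (t w₀ * c))
    (mul_pos Real.pi_pos (mul_pos (ht _) hc))).of_nonneg_of_le
    (fun _ => (Real.exp_pos _).le) fun m => Real.exp_le_exp.mpr ?_
  have h1 := placeForm_mono hw₀ (latticePoint b m)
  rw [placeForm_const] at h1
  have h2 := mul_le_mul_of_nonneg_left (h m) (ht w₀).le
  have h3 := mul_le_mul_of_nonneg_left (h2.trans h1) Real.pi_pos.le
  rw [coe_latticeEquiv]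
  linarith

theorem hasSum_idealTheta_sub_one {I : FractionalIdeal (𝓞 K)⁰ K} (hI : I ≠ 0)
    {t : InfinitePlace K → ℝ} (ht : ∀ w, 0 < t w) :
    HasSum (fun x : {x : K // x ∈ I ∧ x ≠ 0} => Real.exp (-Real.pi * placeForm t x))
      (idealTheta I t - 1) := by
  classical
  have h := (summable_exp_neg_placeForm hI ht).hasSum
  have h0 : placeForm t (0 : K) = 0 := by simp [placeForm]
  have h1 := (hasSum_ite_sub_hasSum h ⟨0, I.zero_mem⟩)
  simp only [h0, mul_zero, Real.exp_zero] at h1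
  let e : {x : K // x ∈ I ∧ x ≠ 0} → {x : K // x ∈ I} := fun x => ⟨x.1, x.2.1⟩
  have he : Function.Injective e := fun x y h => Subtype.ext (congrArg (fun z => z.1) h)
  rw [← he.hasSum_iff] at h1
  · refine h1.congr_fun fun x => ?_
    have : e x ≠ ⟨0, I.zero_mem⟩ := fun h => x.2.2 (congrArg Subtype.val h)
    simp [this, e]
  · rintro ⟨x, hx⟩ hx'
    by_cases h : x = 0
    · subst h
      simp
    · exact absurd ⟨⟨x, hx, h⟩, rfl⟩ hx'

theorem exists_idealTheta_sub_one_le {I : FractionalIdeal (𝓞 K)⁰ K} (hI : I ≠ 0) {a : ℝ}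
    (ha : 0 < a) : ∃ c > 0, ∃ M, ∀ ρ ≥ 1, ∀ t : InfinitePlace K → ℝ, (∀ w, a * ρ ≤ t w) →
      |idealTheta I t - 1| ≤ M * Real.exp (-c * ρ) := by
  classical
  obtain ⟨b, hb, -⟩ := exists_basis_fractionalIdeal I hI
  obtain ⟨c, hc, h⟩ := exists_mul_sum_sq_le_placeForm b
  set c' := Real.pi * a * c
  have hc' : 0 < c' := by positivity
  refine ⟨c', hc', Real.exp c' * ∑' m : (K →+* ℂ) → ℤ, Real.exp (-c' * ∑ i, (m i : ℝ) ^ 2),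
    fun ρ hρ t ht => ?_⟩
  have hρ0 : 0 < ρ := by linarith
  have ht0 : ∀ w, 0 < t w := fun w => (mul_pos ha hρ0).trans_le (ht w)
  have hs := ((latticeEquiv hb).hasSum_iff.mpr (summable_exp_neg_placeForm hI ht0).hasSum)
  have h1 := hasSum_ite_sub_hasSum hs 0
  have h0 : ((latticeEquiv hb 0 : {x : K // x ∈ I}) : K) = 0 := by
    simp [coe_latticeEquiv, latticePoint]
  have h00 : placeForm t (0 : K) = 0 := by simp [placeForm]
  simp only [Function.comp_apply, h0, h00, mul_zero, Real.exp_zero] at h1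
  have hsum := (summable_exp_neg_mul_sum_sq (ι := K →+* ℂ) hc').mul_left
    (Real.exp c' * Real.exp (-c' * ρ))
  have hnn : 0 ≤ idealTheta I t - 1 := h1.nonneg fun m => by
    split_ifs <;> positivity
  rw [abs_of_nonneg hnn]
  refine (hasSum_le (fun m => ?_) h1 hsum.hasSum).trans_eq (by rw [tsum_mul_left]; ring)
  split_ifs with hm
  · positivity
  rw [← Real.exp_add, ← Real.exp_add]
  refine Real.exp_le_exp.mpr ?_
  have h2 := placeForm_mono (s := fun _ => a * ρ) ht (latticePoint b m)
  rw [placeForm_const] at h2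
  have h3 := mul_le_mul_of_nonneg_left (h m) (mul_pos ha hρ0).le
  have h4 := mul_le_mul_of_nonneg_left (h3.trans h2) Real.pi_pos.le
  have h5 : (1 : ℝ) ≤ ∑ i, (m i : ℝ) ^ 2 := by
    obtain ⟨i, hi⟩ := Function.ne_iff.mp hm
    have h6 : (1 : ℝ) ≤ (m i : ℝ) ^ 2 := by
      have hi' : m i ≠ 0 := hi
      have : 0 < (m i) ^ 2 := by positivity
      exact_mod_cast this
    exact h6.trans (Finset.single_le_sum (f := fun i => (m i : ℝ) ^ 2) (fun _ _ => sq_nonneg _)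
      (Finset.mem_univ i))
  have h7 := mul_nonneg (mul_nonneg hc'.le (sub_nonneg.mpr hρ)) (sub_nonneg.mpr h5)
  rw [coe_latticeEquiv]
  simp only [c'] at h7 ⊢
  nlinarith
end IdealTheta

section UnitAverage

open scoped nonZeroDivisors

open Units

variable {K : Type*} [Field K] [NumberField K]

variable (K) in
/-- The linear map attaching to real exponents of the fundamental units the vector of twice the
logarithms of the absolute values of the corresponding product. -/
noncomputable def unitLog : (Fin (rank K) → ℝ) →ₗ[ℝ] (InfinitePlace K → ℝ) where
  toFun c w := ∑ j, c j * (2 * Real.log (w (fundSystem K j : K)))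
  map_add' c d := by
    funext w
    simp [add_mul, Finset.sum_add_distrib]
  map_smul' a c := by
    funext w
    simp [Finset.mul_sum, mul_assoc]

theorem unitLog_apply (c : Fin (rank K) → ℝ) (w : InfinitePlace K) :
    unitLog K c w = ∑ j, c j * (2 * Real.log (w (fundSystem K j : K))) := rfl

theorem sum_mult_mul_unitLog (c : Fin (rank K) → ℝ) :
    ∑ w : InfinitePlace K, w.mult * unitLog K c w = 0 := by
  simp only [unitLog_apply, Finset.mul_sum]
  rw [Finset.sum_comm]
  refine Finset.sum_eq_zero fun j _ => ?_
  have h := sum_mult_mul_log (fundSystem K j)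
  calc ∑ w : InfinitePlace K, (w.mult : ℝ) * (c j * (2 * Real.log (w (fundSystem K j : K))))
      = (c j * 2) * ∑ w : InfinitePlace K, (w.mult : ℝ) * Real.log (w (fundSystem K j : K)) := by
        rw [Finset.mul_sum]
        exact Finset.sum_congr rfl fun w _ => by ring
    _ = 0 := by rw [h, mul_zero]

theorem exp_unitLog_intCast (k : Fin (rank K) → ℤ) (w : InfinitePlace K) :
    Real.exp (unitLog K (fun i => (k i : ℝ)) w) =
      w ((∏ j, fundSystem K j ^ k j : (𝓞 K)ˣ) : K) ^ 2 := by
  have h : ∀ j, 0 < w (fundSystem K j : K) := fun j => pos_at_place _ _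
  rw [unitLog_apply, Real.exp_sum, coe_prod, map_prod, map_prod, ← Finset.prod_pow]
  refine Finset.prod_congr rfl fun j _ => ?_
  rw [coe_zpow, map_zpow₀, ← Real.rpow_intCast, ← Real.rpow_natCast, ← Real.rpow_mul (h j).le,
    Real.rpow_def_of_pos (h j)]
  congr 1
  push_cast
  ring

theorem placeForm_mul_sq (t : InfinitePlace K → ℝ) (u x : K) :
    placeForm (fun w => t w * w u ^ 2) x = placeForm t (u * x) := by
  refine Finset.sum_congr rfl fun w _ => ?_
  rw [map_mul]
  ring

omit [NumberField K] in
theorem unit_mul_mem_iff (I : FractionalIdeal (𝓞 K)⁰ K) (u : (𝓞 K)ˣ) (x : K) :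
    (u : K) * x ∈ I ↔ x ∈ I := by
  have h : ∀ (v : (𝓞 K)ˣ) (y : K), y ∈ I → (v : K) * y ∈ I := fun v y hy => by
    have := (I : Submodule (𝓞 K) K).smul_mem (v : 𝓞 K) hy
    rwa [Algebra.smul_def] at this
  refine ⟨fun hx => ?_, h u x⟩
  have := h u⁻¹ _ hx
  rwa [← mul_assoc, ← coe_mul, inv_mul_cancel, coe_one, one_mul] at this

theorem idealTheta_mul_sq (I : FractionalIdeal (𝓞 K)⁰ K) (t : InfinitePlace K → ℝ) (u : (𝓞 K)ˣ) :
    idealTheta I (fun w => t w * w (u : K) ^ 2) = idealTheta I t := by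
  have hu : (u : K) ≠ 0 := coe_ne_zero u
  let e : {x : K // x ∈ I} ≃ {x : K // x ∈ I} :=
    (Equiv.mulLeft₀ (u : K) hu).subtypeEquiv fun x => (unit_mul_mem_iff I u x).symm
  refine Eq.trans (tsum_congr fun x => ?_)
    (e.tsum_eq fun x : {x : K // x ∈ I} => Real.exp (-Real.pi * placeForm t x))
  rw [placeForm_mul_sq]
  rfl

/-- The archimedean weights with norm parameter `ρ` and unit parameters `c`. -/
noncomputable def unitWeight (ρ : ℝ) (c : Fin (rank K) → ℝ) (w : InfinitePlace K) : ℝ :=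
  ρ * Real.exp (unitLog K c w)

theorem unitWeight_pos {ρ : ℝ} (hρ : 0 < ρ) (c : Fin (rank K) → ℝ) (w : InfinitePlace K) :
    0 < unitWeight ρ c w := mul_pos hρ (Real.exp_pos _)

theorem unitWeight_add_intCast (ρ : ℝ) (c : Fin (rank K) → ℝ) (k : Fin (rank K) → ℤ) :
    unitWeight (K := K) ρ (fun i => c i + k i) = fun w => unitWeight ρ c w *
      w ((∏ j, fundSystem K j ^ k j : (𝓞 K)ˣ) : K) ^ 2 := by
  funext w
  have : (fun i => c i + k i) = c + fun i => (k i : ℝ) := rfl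
  rw [unitWeight, this, map_add, Pi.add_apply, Real.exp_add, exp_unitLog_intCast, unitWeight]
  ring

theorem prod_sqrt_unitWeight {ρ : ℝ} (hρ : 0 < ρ) (c : Fin (rank K) → ℝ) :
    ∏ w, √(unitWeight (K := K) ρ c w) ^ w.mult = ρ ^ ((Module.finrank ℚ K : ℝ) / 2) := by
  have h1 : ∀ w : InfinitePlace K, √(unitWeight ρ c w) ^ w.mult =
      Real.exp (w.mult * (Real.log ρ / 2) + (w.mult * unitLog K c w) / 2) := by
    intro w
    rw [Real.sqrt_eq_rpow, ← Real.rpow_natCast, ← Real.rpow_mul (unitWeight_pos hρ c w).le,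
      Real.rpow_def_of_pos (unitWeight_pos hρ c w), unitWeight,
      Real.log_mul hρ.ne' (Real.exp_pos _).ne', Real.log_exp]
    congr 1
    ring
  rw [Finset.prod_congr rfl fun w _ => h1 w, ← Real.exp_sum, Finset.sum_add_distrib,
    ← Finset.sum_div, sum_mult_mul_unitLog, ← Finset.sum_mul, Real.rpow_def_of_pos hρ]
  have h2 := InfinitePlace.sum_mult_eq (K := K)
  rw [← Nat.cast_sum, h2]
  congr 1
  ring

theorem exists_le_exp_unitLog : ∃ a > 0, ∀ c ∈ unitBox (Fin (rank K)), ∀ w : InfinitePlace K,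
    a ≤ Real.exp (unitLog K c w) := by
  set S := ∑ w : InfinitePlace K, ∑ j, |2 * Real.log (w (fundSystem K j : K))|
  refine ⟨Real.exp (-S), Real.exp_pos _, fun c hc w => Real.exp_le_exp.mpr ?_⟩
  have h1 : ∑ j, |2 * Real.log (w (fundSystem K j : K))| ≤ S :=
    Finset.single_le_sum (f := fun w : InfinitePlace K => ∑ j, |2 * Real.log (w (fundSystem K j : K))|)
      (fun _ _ => Finset.sum_nonneg fun _ _ => abs_nonneg _) (Finset.mem_univ w)
  have h2 : -∑ j, |2 * Real.log (w (fundSystem K j : K))| ≤ unitLog K c w := by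
    rw [unitLog_apply, ← Finset.sum_neg_distrib]
    refine Finset.sum_le_sum fun j _ => ?_
    have h3 := hc j trivial
    have h4 : |c j * (2 * Real.log (w (fundSystem K j : K)))| ≤
        |2 * Real.log (w (fundSystem K j : K))| := by
      rw [abs_mul, abs_of_pos h3.1]
      exact mul_le_of_le_one_left (abs_nonneg _) h3.2
    linarith [neg_abs_le (c j * (2 * Real.log (w (fundSystem K j : K))))]
  linarith

theorem setIntegral_unitBox_neg {ι : Type*} [Fintype ι] {Φ : (ι → ℝ) → ℝ}
    (hΦ : ∀ (c : ι → ℝ) (k : ι → ℤ), Φ (fun i => c i + k i) = Φ c) :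
    ∫ c in unitBox ι, Φ (-c) = ∫ c in unitBox ι, Φ c := by
  have h1 : ∀ c : ι → ℝ, Φ (-c) = Φ (1 - c) := by
    intro c
    rw [← hΦ (-c) 1]
    congr 1
    funext i
    simp
    ring
  have h2 : unitBox ι =ᵐ[volume] Set.pi univ fun _ : ι => Ico (0 : ℝ) 1 :=
    Measure.univ_pi_Ioc_ae_eq_Icc.trans Measure.univ_pi_Ico_ae_eq_Icc.symm
  have hm : MeasurableSet (Set.pi univ fun _ : ι => Ico (0 : ℝ) 1) :=
    MeasurableSet.univ_pi fun _ => measurableSet_Ico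
  simp_rw [h1]
  rw [setIntegral_congr_set h2, ← integral_indicator hm,
    ← integral_indicator (measurableSet_unitBox ι),
    ← integral_sub_left_eq_self ((unitBox ι).indicator Φ) volume 1]
  congr 1
  funext c
  have h3 : c ∈ (Set.pi univ fun _ : ι => Ico (0 : ℝ) 1) ↔ 1 - c ∈ unitBox ι := by
    simp only [unitBox, mem_univ_pi, mem_Ico, mem_Ioc, Pi.sub_apply, Pi.one_apply, sub_pos,
      sub_le_self_iff]
    exact forall_congr' fun i => and_comm
  by_cases h : 1 - c ∈ unitBox ι
  · rw [indicator_of_mem h, indicator_of_mem (h3.mpr h)]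
  · rw [indicator_of_notMem h, indicator_of_notMem fun h' => h (h3.mp h')]

theorem idealTheta_nonneg (I : FractionalIdeal (𝓞 K)⁰ K) (t : InfinitePlace K → ℝ) :
    0 ≤ idealTheta I t := tsum_nonneg fun _ => (Real.exp_pos _).le

theorem idealTheta_anti {I : FractionalIdeal (𝓞 K)⁰ K} (hI : I ≠ 0) {s t : InfinitePlace K → ℝ}
    (hs : ∀ w, 0 < s w) (h : ∀ w, s w ≤ t w) : idealTheta I t ≤ idealTheta I s := by
  refine (summable_exp_neg_placeForm hI fun w => (hs w).trans_le (h w)).tsum_le_tsum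
    (fun x => Real.exp_le_exp.mpr ?_) (summable_exp_neg_placeForm hI hs)
  have := mul_le_mul_of_nonneg_left (placeForm_mono h (x : K)) Real.pi_pos.le
  linarith

variable (K) in
theorem countable_numberField : Countable K :=
  (Module.finBasis ℚ K).equivFun.toEquiv.countable_iff.mpr inferInstance

theorem measurable_idealTheta_unitWeight {I : FractionalIdeal (𝓞 K)⁰ K} (hI : I ≠ 0) {ρ : ℝ}
    (hρ : 0 < ρ) : Measurable fun c => idealTheta I (unitWeight ρ c) := by
  have h1 : (fun c => idealTheta I (unitWeight ρ c)) = fun c =>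
      (∑' x : {x : K // x ∈ I}, ENNReal.ofReal
        (Real.exp (-Real.pi * placeForm (unitWeight ρ c) (x : K)))).toReal := by
    funext c
    rw [← ENNReal.ofReal_tsum_of_nonneg (fun _ => (Real.exp_pos _).le)
      (summable_exp_neg_placeForm hI (unitWeight_pos hρ c)), ENNReal.toReal_ofReal
      (tsum_nonneg fun _ => (Real.exp_pos _).le), idealTheta]
  have := countable_numberField K
  rw [h1]
  refine (Measurable.tsum fun x => ?_).ennreal_toReal
  have h2 : Continuous fun c => unitLog K c := (unitLog K).continuous_of_finiteDimensional
  have h3 : ∀ w, Continuous fun c => unitLog K c w := fun w => (continuous_apply w).comp h2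
  have h4 : Continuous fun c => Real.exp (-Real.pi * placeForm (unitWeight ρ c) (x : K)) := by
    unfold placeForm unitWeight
    fun_prop
  exact h4.measurable.ennreal_ofReal

/-- The average of the theta series over the torus of units. -/
noncomputable def avgTheta (I : FractionalIdeal (𝓞 K)⁰ K) (ρ : ℝ) : ℝ :=
  ∫ c in unitBox (Fin (rank K)), idealTheta I (unitWeight ρ c)

theorem integrableOn_idealTheta_unitWeight {I : FractionalIdeal (𝓞 K)⁰ K} (hI : I ≠ 0) {ρ : ℝ}
    (hρ : 0 < ρ) :
    IntegrableOn (fun c => idealTheta I (unitWeight ρ c)) (unitBox (Fin (rank K))) := by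
  obtain ⟨a, ha, h⟩ := exists_le_exp_unitLog (K := K)
  refine Measure.integrableOn_of_bounded (M := idealTheta I fun _ => ρ * a)
    (by rw [volume_unitBox]; exact ENNReal.one_ne_top)
    (measurable_idealTheta_unitWeight hI hρ).aestronglyMeasurable ?_
  refine (ae_restrict_iff' (measurableSet_unitBox _)).mpr (.of_forall fun c hc => ?_)
  rw [Real.norm_of_nonneg (idealTheta_nonneg _ _)]
  exact idealTheta_anti hI (fun _ => mul_pos hρ ha) fun w =>
    mul_le_mul_of_nonneg_left (h c hc w) hρ.le

theorem antitoneOn_avgTheta {I : FractionalIdeal (𝓞 K)⁰ K} (hI : I ≠ 0) :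
    AntitoneOn (avgTheta I) (Ioi 0) := by
  intro x hx y hy hxy
  refine integral_mono (integrableOn_idealTheta_unitWeight hI hy)
    (integrableOn_idealTheta_unitWeight hI hx) fun c => ?_
  exact idealTheta_anti hI (unitWeight_pos hx c) fun w =>
    mul_le_mul_of_nonneg_right hxy (Real.exp_pos _).le

theorem exists_avgTheta_one_div {I : FractionalIdeal (𝓞 K)⁰ K} (hI : I ≠ 0) :
    ∃ C > 0, ∀ ρ > 0, avgTheta I (1 / ρ) =
      C * ρ ^ ((Module.finrank ℚ K : ℝ) / 2) * avgTheta (FractionalIdeal.dual ℤ ℚ I) ρ := by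
  obtain ⟨C, hC, h⟩ := exists_idealTheta_eq_dual I hI
  refine ⟨C, hC, fun ρ hρ => ?_⟩
  have hρ' : 0 < 1 / ρ := one_div_pos.mpr hρ
  have hp : ∀ (c : Fin (rank K) → ℝ) (k : Fin (rank K) → ℤ),
      idealTheta (FractionalIdeal.dual ℤ ℚ I) (unitWeight ρ fun i => c i + k i) =
        idealTheta (FractionalIdeal.dual ℤ ℚ I) (unitWeight ρ c) := fun c k => by
    rw [unitWeight_add_intCast, idealTheta_mul_sq]
  rw [avgTheta, avgTheta, ← setIntegral_unitBox_neg
    (Φ := fun c => idealTheta (FractionalIdeal.dual ℤ ℚ I) (unitWeight ρ c)) hp, ← integral_const_mul]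
  refine integral_congr_ae (.of_forall fun c => ?_)
  simp only
  rw [h _ (unitWeight_pos hρ' c), prod_sqrt_unitWeight hρ', one_div, Real.inv_rpow hρ.le, inv_inv]
  congr 2
  funext w
  rw [unitWeight, unitWeight, map_neg, Pi.neg_apply, Real.exp_neg, _root_.mul_inv, inv_inv]

theorem exists_avgTheta_sub_one_le {I : FractionalIdeal (𝓞 K)⁰ K} (hI : I ≠ 0) :
    ∃ c > 0, ∃ M, ∀ ρ ≥ 1, |avgTheta I ρ - 1| ≤ M * Real.exp (-c * ρ) := by
  obtain ⟨a, ha, h⟩ := exists_le_exp_unitLog (K := K)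
  obtain ⟨c, hc, M, hM⟩ := exists_idealTheta_sub_one_le hI ha
  refine ⟨c, hc, M, fun ρ hρ => ?_⟩
  have hρ0 : 0 < ρ := by linarith
  have hv : volume.real (unitBox (Fin (rank K))) = 1 := by
    rw [Measure.real, volume_unitBox, ENNReal.toReal_one]
  have h1 : avgTheta I ρ - 1 =
      ∫ c in unitBox (Fin (rank K)), (idealTheta I (unitWeight ρ c) - 1) := by
    rw [integral_sub (integrableOn_idealTheta_unitWeight hI hρ0)
      (integrableOn_const (by rw [volume_unitBox]; exact ENNReal.one_ne_top)), setIntegral_const, hv,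
      one_smul, avgTheta]
  rw [h1, ← Real.norm_eq_abs]
  refine (norm_setIntegral_le_of_norm_le_const (C := M * Real.exp (-c * ρ))
    (by rw [volume_unitBox]; exact ENNReal.one_lt_top) fun x hx => ?_).trans_eq (by rw [hv, mul_one])
  refine hM ρ hρ _ fun w => ?_
  rw [mul_comm]
  exact mul_le_mul_of_nonneg_left (h x hx w) hρ0.le

end UnitAverage

section ThetaPair

open scoped nonZeroDivisors

variable {K : Type*} [Field K] [NumberField K]

theorem locallyIntegrableOn_avgTheta {I : FractionalIdeal (𝓞 K)⁰ K} (hI : I ≠ 0) :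
    LocallyIntegrableOn (fun ρ => (avgTheta I ρ : ℂ)) (Ioi 0) := by
  rw [locallyIntegrableOn_iff (isOpen_Ioi.isLocallyClosed)]
  intro k hk hkc
  exact ((antitoneOn_avgTheta hI).mono hk).integrableOn_isCompact hkc |>.ofReal

theorem isBigO_avgTheta_sub_one {I : FractionalIdeal (𝓞 K)⁰ K} (hI : I ≠ 0) (r : ℝ) :
    (fun ρ => (avgTheta I ρ : ℂ) - 1) =O[atTop] fun ρ : ℝ => ρ ^ r := by
  obtain ⟨c, hc, M, h⟩ := exists_avgTheta_sub_one_le hI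
  have h1 : (fun ρ => (avgTheta I ρ : ℂ) - 1) =O[atTop] fun ρ => Real.exp (-c * ρ) := by
    refine IsBigO.of_bound M ?_
    filter_upwards [eventually_ge_atTop 1] with ρ hρ
    rw [Real.norm_eq_abs, Real.abs_exp, ← Complex.ofReal_one, ← Complex.ofReal_sub,
      Complex.norm_real]
    exact h ρ hρ
  exact h1.trans (isLittleO_exp_neg_mul_rpow_atTop hc r).isBigO

/-- The theta series of a fractional ideal and of its dual, averaged over the torus of units, as a
pair of functions related by a functional equation. -/
noncomputable def thetaPair {I : FractionalIdeal (𝓞 K)⁰ K} (hI : I ≠ 0) : WeakFEPair ℂ where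
  f ρ := avgTheta I ρ
  g ρ := avgTheta (FractionalIdeal.dual ℤ ℚ I) ρ
  k := (Module.finrank ℚ K : ℝ) / 2
  ε := ((exists_avgTheta_one_div hI).choose : ℝ)
  f₀ := 1
  g₀ := 1
  hf_int := locallyIntegrableOn_avgTheta hI
  hg_int := locallyIntegrableOn_avgTheta (FractionalIdeal.dual_ne_zero ℤ ℚ hI)
  hk := by
    have := Module.finrank_pos (R := ℚ) (M := K)
    positivity
  hε := by exact_mod_cast (exists_avgTheta_one_div hI).choose_spec.1.ne'
  h_feq ρ hρ := by
    rw [(exists_avgTheta_one_div hI).choose_spec.2 ρ hρ, smul_eq_mul]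
    push_cast
    rfl
  hf_top := isBigO_avgTheta_sub_one hI
  hg_top := isBigO_avgTheta_sub_one (FractionalIdeal.dual_ne_zero ℤ ℚ hI)

end ThetaPair

section ExpCoordinates

theorem integral_cpow_smul_eq_integral_exp (g : ℝ → ℂ) (s : ℂ) :
    ∫ t in Ioi (0 : ℝ), (t : ℂ) ^ (s - 1) * g t =
      ∫ y : ℝ, Complex.exp (s * y) * g (Real.exp y) := by
  rw [← Real.range_exp, ← image_univ, integral_image_eq_integral_abs_deriv_smul
    MeasurableSet.univ (fun x _ => (Real.hasDerivAt_exp x).hasDerivWithinAt)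
    Real.exp_injective.injOn, setIntegral_univ]
  refine integral_congr_ae (.of_forall fun y => ?_)
  simp only [Complex.real_smul, Real.abs_exp]
  rw [Complex.ofReal_exp, Complex.cpow_def_of_ne_zero (Complex.exp_ne_zero _), ← Complex.ofReal_exp,
    ← Complex.ofReal_log (Real.exp_pos y).le, Real.log_exp, ← mul_assoc, Complex.ofReal_exp,
    ← Complex.exp_add]
  ring_nf

theorem integral_exp_mul_exp_neg_exp {a : ℝ} (ha : 0 < a) {s : ℂ} (hs : 0 < s.re) :
    ∫ y : ℝ, Complex.exp (s * y) * Complex.exp (-(a * Real.exp y) : ℝ) =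
      (a : ℂ) ^ (-s) * Complex.Gamma s := by
  rw [← integral_cpow_smul_eq_integral_exp (fun t => Complex.exp (-(a * t) : ℝ)) s]
  have := Complex.integral_cpow_mul_exp_neg_mul_Ioi (a := s) (r := a) hs ha
  rw [Complex.cpow_neg]
  rw [one_div, Complex.inv_cpow] at this
  · rw [← this]
    simp
  · rw [Complex.arg_ofReal_of_nonneg ha.le]
    exact Real.pi_pos.ne

theorem integrable_exp_mul_exp_neg_exp {a : ℝ} (ha : 0 < a) {s : ℂ} (hs : 0 < s.re) :
    Integrable fun y : ℝ => Complex.exp (s * y) * Complex.exp (-(a * Real.exp y) : ℝ) := by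
  refine .of_integral_ne_zero ?_
  rw [integral_exp_mul_exp_neg_exp ha hs]
  refine mul_ne_zero ?_ (Complex.Gamma_ne_zero_of_re_pos hs)
  simp [Complex.cpow_eq_zero_iff, ha.ne']

end ExpCoordinates

section UnitCoordinates

open Units

variable {K : Type*} [Field K] [NumberField K]

theorem unitLog_injective : Function.Injective (unitLog K) := by
  rw [← LinearMap.ker_eq_bot, LinearMap.ker_eq_bot']
  intro c hc
  have h := isMaxRank_fundSystem K
  rw [IsMaxRank, Fintype.linearIndependent_iff] at h
  funext i
  refine h c ?_ i
  funext w
  have := congrFun hc w.1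
  rw [unitLog_apply] at this
  simp only [Finset.sum_apply, Pi.smul_apply, _root_.smul_eq_mul,
    dirichletUnitTheorem.logEmbedding_component, Pi.zero_apply] at this ⊢
  have h2 : ∑ x, c x * ((w.1.mult : ℝ) * Real.log (w.1 (fundSystem K x : K))) =
    w.1.mult / 2 * ∑ j, c j * (2 * Real.log (w.1 (fundSystem K j : K))) := by
    rw [Finset.mul_sum]
    exact Finset.sum_congr rfl fun j _ => by ring
  exact h2.trans (by rw [this, mul_zero])

variable (K) in
/-- The coordinates `(y, c) ↦ (y + unitLog c w)_w` on the space of logarithms of weights. -/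
noncomputable def logCoord : (ℝ × (Fin (rank K) → ℝ)) ≃ₗ[ℝ] (InfinitePlace K → ℝ) :=
  LinearEquiv.ofInjectiveOfFinrankEq
    ((LinearMap.pi fun _ => LinearMap.fst ℝ ℝ _) + unitLog K ∘ₗ LinearMap.snd ℝ ℝ _)
    (by
      rw [← LinearMap.ker_eq_bot, LinearMap.ker_eq_bot']
      rintro ⟨y, c⟩ h
      have h' (w : InfinitePlace K) : y + unitLog K c w = 0 := congrFun h w
      have h1 := sum_mult_mul_unitLog (K := K) c
      have h2 : ∑ w : InfinitePlace K, (w.mult : ℝ) * (y + unitLog K c w) = 0 := by simp [h']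
      simp only [mul_add, Finset.sum_add_distrib, h1, add_zero, ← Finset.sum_mul,
        ← Nat.cast_sum, InfinitePlace.sum_mult_eq] at h2
      have hy : y = 0 := by
        have := Module.finrank_pos (R := ℚ) (M := K)
        rcases mul_eq_zero.mp h2 with h | h
        · norm_cast at h; omega
        · exact h
      subst hy
      have : c = 0 := unitLog_injective (by funext w; simpa using h' w)
      simp [this])
    (by
      have : 0 < Fintype.card (InfinitePlace K) := Fintype.card_pos
      have h1 (r : ℕ) : Module.finrank ℝ (ℝ × (Fin r → ℝ)) = 1 + r := by simp
      rw [h1, Module.finrank_fintype_fun_eq_card, Units.rank]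
      omega)

theorem logCoord_apply (p : ℝ × (Fin (rank K) → ℝ)) (w : InfinitePlace K) :
    logCoord K p w = p.1 + unitLog K p.2 w := rfl

theorem exists_map_logCoord : ∃ C : NNReal, 0 < C ∧
    Measure.map (logCoord K) volume = C • volume := by
  let L := (logCoord K).toContinuousLinearEquiv
  have h0 : (volume : Measure (ℝ × (Fin (rank K) → ℝ))).IsAddHaarMeasure :=
    inferInstanceAs (volume.prod volume).IsAddHaarMeasure
  have : (Measure.map L volume).IsAddHaarMeasure := L.isAddHaarMeasure_map volume
  exact ⟨_, Measure.addHaarScalarFactor_pos_of_isAddHaarMeasure (Measure.map L volume) volume,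
    Measure.isAddLeftInvariant_eq_smul _ _⟩

theorem exists_integral_comp_logCoord : ∃ C : ℝ, 0 < C ∧ ∀ f : (InfinitePlace K → ℝ) → ℂ,
    Integrable f → Integrable (fun p => f (logCoord K p)) ∧
      ∫ p, f (logCoord K p) = C * ∫ y, f y := by
  obtain ⟨C, hC, h⟩ := exists_map_logCoord (K := K)
  refine ⟨C, hC, fun f hf => ?_⟩
  have he : MeasurableEmbedding (logCoord K) :=
    (logCoord K).toContinuousLinearEquiv.toHomeomorph.measurableEmbedding
  have hi : Integrable f (Measure.map (logCoord K) volume) := by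
    rw [h]
    exact hf.smul_measure_nnreal
  refine ⟨he.integrable_map_iff.mp hi, ?_⟩
  rw [← he.integral_map, h, integral_smul_nnreal_measure]
  simp [NNReal.smul_def]

variable (K) in
/-- The product of the archimedean Euler factors of `ζ_K`. -/
noncomputable def archFactor (s : ℂ) : ℂ :=
  ∏ w : InfinitePlace K, ((Real.pi * w.mult : ℝ) : ℂ) ^ (-(w.mult * s / 2)) *
    Complex.Gamma (w.mult * s / 2)

/-- The integrand of the unfolded Mellin transform of a theta series. -/
noncomputable def placeKernel (x : K) (s : ℂ) (p : ℝ × (Fin (rank K) → ℝ)) : ℂ :=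
  Complex.exp (Module.finrank ℚ K * s / 2 * p.1) *
    Real.exp (-Real.pi * placeForm (unitWeight (Real.exp p.1) p.2) x)

theorem placeKernel_eq (x : K) (s : ℂ) (p : ℝ × (Fin (rank K) → ℝ)) :
    placeKernel x s p = ∏ w : InfinitePlace K, Complex.exp (w.mult * s / 2 * logCoord K p w) *
      Complex.exp (-(Real.pi * w.mult * w x ^ 2 * Real.exp (logCoord K p w)) : ℝ) := by
  rw [Finset.prod_mul_distrib, ← Complex.exp_sum, ← Complex.exp_sum, placeKernel]
  congr 2
  · have h := sum_mult_mul_unitLog (K := K) p.2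
    have h2 : ∑ w : InfinitePlace K, (w.mult : ℝ) * logCoord K p w = Module.finrank ℚ K * p.1 := by
      simp only [logCoord_apply, mul_add, Finset.sum_add_distrib, h, add_zero, ← Finset.sum_mul,
        ← Nat.cast_sum, InfinitePlace.sum_mult_eq]
    have h3 : (Module.finrank ℚ K * p.1 : ℂ) = ∑ w : InfinitePlace K, (w.mult * logCoord K p w : ℂ) := by
      exact_mod_cast h2.symm
    calc (Module.finrank ℚ K * s / 2 * p.1 : ℂ) = s / 2 * (Module.finrank ℚ K * p.1) := by ring
      _ = _ := by
        rw [h3, Finset.mul_sum]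
        exact Finset.sum_congr rfl fun w _ => by ring
  · rw [Complex.ofReal_exp]
    congr 1
    rw [← Complex.ofReal_sum, placeForm, Finset.mul_sum]
    congr 1
    refine Finset.sum_congr rfl fun w _ => ?_
    rw [logCoord_apply, unitWeight, Real.exp_add]
    ring

theorem exists_integral_placeKernel : ∃ C : ℝ, 0 < C ∧ ∀ x : K, x ≠ 0 → ∀ s : ℂ, 0 < s.re →
    Integrable (placeKernel x s) ∧
      ∫ p, placeKernel x s p =
        C * archFactor K s * ((|Algebra.norm ℚ x| : ℚ) : ℂ) ^ (-s) := by
  obtain ⟨C, hC, h⟩ := exists_integral_comp_logCoord (K := K)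
  refine ⟨C, hC, fun x hx s hs => ?_⟩
  have hw (w : InfinitePlace K) : 0 < (w.mult : ℝ) := by exact_mod_cast w.mult_pos
  have hxw (w : InfinitePlace K) : 0 < w x := w.pos_iff.mpr hx
  have ha (w : InfinitePlace K) : 0 < Real.pi * w.mult * w x ^ 2 := by
    have := hw w; have := hxw w; positivity
  have hsw (w : InfinitePlace K) : 0 < (w.mult * s / 2 : ℂ).re := by
    have h1 : (w.mult * s / 2 : ℂ) = ((w.mult / 2 : ℝ) : ℂ) * s := by push_cast; ring
    rw [h1, Complex.re_ofReal_mul]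
    have := hw w; positivity
  let F (w : InfinitePlace K) (y : ℝ) : ℂ := Complex.exp (w.mult * s / 2 * y) *
    Complex.exp (-(Real.pi * w.mult * w x ^ 2 * Real.exp y) : ℝ)
  have hF (w : InfinitePlace K) : Integrable (F w) := integrable_exp_mul_exp_neg_exp (ha w) (hsw w)
  have hi : Integrable fun y : InfinitePlace K → ℝ => ∏ w, F w (y w) := .fintype_prod hF
  obtain ⟨h1, h2⟩ := h _ hi
  have he : placeKernel x s = fun p => ∏ w, F w (logCoord K p w) := funext (placeKernel_eq x s)
  rw [he]
  refine ⟨h1, ?_⟩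
  rw [h2, integral_fintype_prod_volume_eq_prod, mul_assoc]
  congr 1
  have h3 (w : InfinitePlace K) : ∫ y, F w y = (((Real.pi * w.mult : ℝ) : ℂ) ^ (-(w.mult * s / 2)) *
      Complex.Gamma (w.mult * s / 2)) * ((w x ^ w.mult : ℝ) : ℂ) ^ (-s) := by
    have hx2 : (0 : ℝ) < w x ^ 2 := by have := hxw w; positivity
    have := hw w
    rw [integral_exp_mul_exp_neg_exp (ha w) (hsw w), Complex.ofReal_mul,
      Complex.mul_cpow_ofReal_nonneg (by positivity) hx2.le,
      Complex.cpow_def_of_ne_zero (x := ((w x ^ 2 : ℝ) : ℂ)) (by exact_mod_cast hx2.ne'),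
      Complex.cpow_def_of_ne_zero (x := ((w x ^ w.mult : ℝ) : ℂ))
        (by exact_mod_cast (pow_pos (hxw w) _).ne'),
      ← Complex.ofReal_log hx2.le, ← Complex.ofReal_log (pow_pos (hxw w) _).le, Real.log_pow,
      Real.log_pow]
    have : (((2 : ℕ) * Real.log (w x) : ℝ) : ℂ) * -(w.mult * s / 2) =
      ((w.mult * Real.log (w x) : ℝ) : ℂ) * -s := by push_cast; ring
    rw [this]
    ring
  have hprod : ∏ w : InfinitePlace K, ((w x ^ w.mult : ℝ) : ℂ) ^ (-s) =
      ((∏ w : InfinitePlace K, w x ^ w.mult : ℝ) : ℂ) ^ (-s) := by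
    rw [Complex.ofReal_prod]
    classical
    induction (Finset.univ : Finset (InfinitePlace K)) using Finset.induction_on with
    | empty => simp
    | insert a s has ih =>
      rw [Finset.prod_insert has, Finset.prod_insert has, ih, ← Complex.ofReal_prod,
        Complex.mul_cpow_ofReal_nonneg (by have := hxw a; positivity)
          (Finset.prod_nonneg fun w _ => by have := hxw w; positivity)]
  calc ∏ w, ∫ y, F w y = archFactor K s * ∏ w : InfinitePlace K, ((w x ^ w.mult : ℝ) : ℂ) ^ (-s) := by
        rw [archFactor, ← Finset.prod_mul_distrib]
        exact Finset.prod_congr rfl fun w _ => h3 w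
    _ = _ := by
        rw [hprod, InfinitePlace.prod_eq_abs_norm]
        norm_cast

end UnitCoordinates

section Unfolding

open scoped nonZeroDivisors
open Units

variable {K : Type*} [Field K] [NumberField K]

/-- The unit with the given torsion part and exponents. -/
noncomputable def unitOf (e : torsion K × (Fin (rank K) → ℤ)) : (𝓞 K)ˣ :=
  e.1 * ∏ i, fundSystem K i ^ e.2 i

theorem unitOf_bijective : Function.Bijective (unitOf (K := K)) := by
  rw [Function.bijective_iff_existsUnique]
  intro u
  obtain ⟨e, he, h⟩ := exist_unique_eq_mul_prod K u
  exact ⟨e, he.symm, fun e' he' => h e' he'.symm⟩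

theorem placeForm_unitOf_mul (e : torsion K × (Fin (rank K) → ℤ)) (ρ : ℝ) (c : Fin (rank K) → ℝ)
    (x : K) : placeForm (unitWeight ρ c) ((unitOf e : K) * x) =
      placeForm (unitWeight ρ fun i => c i + e.2 i) x := by
  have h := unitWeight_add_intCast (K := K) ρ c e.2
  rw [h, placeForm_mul_sq]
  simp only [placeForm]
  refine Finset.sum_congr rfl fun w _ => ?_
  have hw : w ((e.1 : (𝓞 K)ˣ) : K) = 1 := by
    have := (mem_torsion K).mp e.1.2 w
    exact this
  have : ((unitOf e : (𝓞 K)ˣ) : K) =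
      ((e.1 : (𝓞 K)ˣ) : K) * ((∏ i, fundSystem K i ^ e.2 i : (𝓞 K)ˣ) : K) := by
    simp only [unitOf, coe_mul]
  rw [this, map_mul, map_mul, map_mul, hw, one_mul]

theorem placeKernel_unitOf_mul (e : torsion K × (Fin (rank K) → ℤ)) (s : ℂ) (y : ℝ)
    (c : Fin (rank K) → ℝ) (x : K) :
    placeKernel ((unitOf e : K) * x) s (y, c) = placeKernel x s (y, fun i => c i + e.2 i) := by
  simp only [placeKernel, placeForm_unitOf_mul]

theorem integrable_placeKernel {x : K} (hx : x ≠ 0) {s : ℂ} (hs : 0 < s.re) :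
    Integrable (placeKernel x s) :=
  (exists_integral_placeKernel.choose_spec.2 x hx s hs).1

/-- The integral of `placeKernel` over a fundamental domain for the action of the units. -/
noncomputable def boxKernel (x : K) (s : ℂ) : ℂ :=
  ∫ y, ∫ c in unitBox (Fin (rank K)), placeKernel x s (y, c)

theorem integrable_placeKernel_box {x : K} (hx : x ≠ 0) {s : ℂ} (hs : 0 < s.re) :
    Integrable (placeKernel x s)
      ((volume : Measure ℝ).prod (volume.restrict (unitBox (Fin (rank K))))) := by
  have h : (volume : Measure ℝ).prod (volume.restrict (unitBox (Fin (rank K)))) =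
      (volume : Measure (ℝ × (Fin (rank K) → ℝ))).restrict (univ ×ˢ unitBox (Fin (rank K))) := by
    rw [Measure.volume_eq_prod, ← Measure.prod_restrict, Measure.restrict_univ]
  rw [h]
  exact (integrable_placeKernel hx hs).integrableOn

theorem hasSum_boxKernel {x : K} (hx : x ≠ 0) {s : ℂ} (hs : 0 < s.re) (ζ : torsion K) :
    HasSum (fun k : Fin (rank K) → ℤ => boxKernel ((unitOf (ζ, k) : K) * x) s)
      (∫ p, placeKernel x s p) := by
  have hi := integrable_placeKernel hx hs
  have h := hasSum_setIntegral_unitBox_translate (h := fun c => ∫ y, placeKernel x s (y, c))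
    hi.integral_prod_right
  have h2 : ∫ p, placeKernel x s p = ∫ c, ∫ y, placeKernel x s (y, c) := integral_prod_symm _ hi
  rw [h2]
  convert! h using 2 with k
  have hux : ((unitOf (ζ, k) : (𝓞 K)ˣ) : K) * x ≠ 0 := mul_ne_zero (by simp) hx
  rw [boxKernel, integral_integral_swap (f := fun y c => placeKernel _ s (y, c))
    (integrable_placeKernel_box hux hs)]
  simp only [placeKernel_unitOf_mul]

theorem norm_placeKernel (x : K) (s : ℂ) (p : ℝ × (Fin (rank K) → ℝ)) :
    (‖placeKernel x s p‖ : ℂ) = placeKernel x s.re p := by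
  rw [placeKernel, placeKernel, norm_mul, Complex.norm_exp, Complex.norm_real, Real.norm_eq_abs,
    Real.abs_exp]
  push_cast
  congr 2
  have : (Module.finrank ℚ K * s / 2 * p.1 : ℂ) =
    ((Module.finrank ℚ K / 2 * p.1 : ℝ) : ℂ) * s := by push_cast; ring
  rw [this, Complex.re_ofReal_mul]
  push_cast
  ring

/-- The integral ideals lying in the inverse of the class of `I`. -/
def inverseClass (I : FractionalIdeal (𝓞 K)⁰ K) : Set (Ideal (𝓞 K)) :=
  {J | ∃ x : K, x ≠ 0 ∧ (J : FractionalIdeal (𝓞 K)⁰ K) * I = FractionalIdeal.spanSingleton (𝓞 K)⁰ x}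

/-- A generator of `J * I`. -/
noncomputable def classGenerator {I : FractionalIdeal (𝓞 K)⁰ K} (J : inverseClass I) : K :=
  J.2.choose

theorem classGenerator_ne_zero {I : FractionalIdeal (𝓞 K)⁰ K} (J : inverseClass I) :
    classGenerator J ≠ 0 := J.2.choose_spec.1

theorem mul_eq_spanSingleton_classGenerator {I : FractionalIdeal (𝓞 K)⁰ K} (J : inverseClass I) :
    (J.1 : FractionalIdeal (𝓞 K)⁰ K) * I = FractionalIdeal.spanSingleton (𝓞 K)⁰ (classGenerator J) :=
  J.2.choose_spec.2

theorem abs_norm_classGenerator {I : FractionalIdeal (𝓞 K)⁰ K} (J : inverseClass I) :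
    |Algebra.norm ℚ (classGenerator J)| = Ideal.absNorm J.1 * FractionalIdeal.absNorm I := by
  rw [← FractionalIdeal.absNorm_span_singleton (R := 𝓞 K), ← mul_eq_spanSingleton_classGenerator, map_mul,
    FractionalIdeal.coeIdeal_absNorm]

theorem spanSingleton_unit_mul (u : (𝓞 K)ˣ) (x : K) :
    FractionalIdeal.spanSingleton (𝓞 K)⁰ ((u : K) * x) = FractionalIdeal.spanSingleton (𝓞 K)⁰ x := by
  apply le_antisymm
  · rw [FractionalIdeal.spanSingleton_le_iff_mem, unit_mul_mem_iff]
    exact FractionalIdeal.mem_spanSingleton_self _ _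
  · rw [FractionalIdeal.spanSingleton_le_iff_mem, ← unit_mul_mem_iff _ u]
    exact FractionalIdeal.mem_spanSingleton_self _ _

theorem exists_unit_mul_of_spanSingleton_eq {x y : K} (hy : y ≠ 0)
    (h : FractionalIdeal.spanSingleton (𝓞 K)⁰ x = FractionalIdeal.spanSingleton (𝓞 K)⁰ y) :
    ∃ u : (𝓞 K)ˣ, x = (u : K) * y := by
  obtain ⟨a, ha⟩ := (FractionalIdeal.mem_spanSingleton (𝓞 K)⁰).mp
    (h ▸ FractionalIdeal.mem_spanSingleton_self (𝓞 K)⁰ x)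
  obtain ⟨b, hb⟩ := (FractionalIdeal.mem_spanSingleton (𝓞 K)⁰).mp
    (h ▸ FractionalIdeal.mem_spanSingleton_self (𝓞 K)⁰ y)
  rw [Algebra.smul_def] at ha hb
  have hab : b * a = 1 := by
    apply RingOfIntegers.coe_injective
    have : (algebraMap (𝓞 K) K (b * a)) * y = 1 * y := by
      rw [map_mul, mul_assoc, ha, hb, one_mul]
    simpa using mul_right_cancel₀ hy this
  exact ⟨⟨a, b, by rw [mul_comm, hab], hab⟩, ha.symm⟩

/-- Up to units, the nonzero elements of `I` are parametrised by the integral ideals in the inverse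
class of `I`. -/
noncomputable def inverseClassEquiv (I : FractionalIdeal (𝓞 K)⁰ K) (hI : I ≠ 0) :
    (inverseClass I × torsion K) × (Fin (rank K) → ℤ) ≃ {x : K // x ∈ I ∧ x ≠ 0} :=
  Equiv.ofBijective (fun e => ⟨(unitOf (e.1.2, e.2) : K) * classGenerator e.1.1, by
      rw [unit_mul_mem_iff, ← FractionalIdeal.spanSingleton_le_iff_mem,
        ← mul_eq_spanSingleton_classGenerator]
      exact mul_le_of_le_one_left' FractionalIdeal.coeIdeal_le_one,
    mul_ne_zero (by simp) (classGenerator_ne_zero _)⟩) (by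
    constructor
    · rintro ⟨⟨J, ζ⟩, k⟩ ⟨⟨J', ζ'⟩, k'⟩ h
      replace h := congrArg Subtype.val h
      simp only at h
      have hJ : J = J' := by
        have h1 := congrArg (FractionalIdeal.spanSingleton (𝓞 K)⁰) h
        rw [spanSingleton_unit_mul, spanSingleton_unit_mul, ← mul_eq_spanSingleton_classGenerator,
          ← mul_eq_spanSingleton_classGenerator] at h1
        exact Subtype.ext (FractionalIdeal.coeIdeal_injective (mul_right_cancel₀ hI h1))
      subst hJ
      have h2 := unitOf_bijective.1 (coe_injective K (mul_right_cancel₀ (classGenerator_ne_zero J) h))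
      simp only [Prod.mk.injEq] at h2 ⊢
      exact ⟨⟨trivial, h2.1⟩, h2.2⟩
    · rintro ⟨x, hx, hx0⟩
      have hle : FractionalIdeal.spanSingleton (𝓞 K)⁰ x * I⁻¹ ≤ 1 := by
        rw [← mul_inv_cancel₀ hI]
        gcongr
        exact FractionalIdeal.spanSingleton_le_iff_mem.mpr hx
      obtain ⟨J, hJ⟩ := FractionalIdeal.le_one_iff_exists_coeIdeal.mp hle
      have hJI : (J : FractionalIdeal (𝓞 K)⁰ K) * I = FractionalIdeal.spanSingleton (𝓞 K)⁰ x := by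
        rw [hJ, mul_assoc, inv_mul_cancel₀ hI, mul_one]
      let J' : inverseClass I := ⟨J, x, hx0, hJI⟩
      obtain ⟨u, hu⟩ := exists_unit_mul_of_spanSingleton_eq (classGenerator_ne_zero J')
        (hJI.symm.trans (mul_eq_spanSingleton_classGenerator J'))
      obtain ⟨e, rfl⟩ := unitOf_bijective.2 u
      exact ⟨((J', e.1), e.2), Subtype.ext hu.symm⟩)

theorem hasSum_avgTheta_sub_one {I : FractionalIdeal (𝓞 K)⁰ K} (hI : I ≠ 0) {ρ : ℝ} (hρ : 0 < ρ) :
    HasSum (fun x : {x : K // x ∈ I ∧ x ≠ 0} => ∫ c in unitBox (Fin (rank K)),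
      ((Real.exp (-Real.pi * placeForm (unitWeight ρ c) (x : K)) : ℝ) : ℂ))
      (avgTheta I ρ - 1) := by
  have := countable_numberField K
  obtain ⟨a, ha, h⟩ := exists_le_exp_unitLog (K := K)
  have hvol : volume.real (unitBox (Fin (rank K))) = 1 := by simp [Measure.real, volume_unitBox]
  have hfin : IsFiniteMeasure (volume.restrict (unitBox (Fin (rank K)))) :=
    ⟨by rw [Measure.restrict_apply_univ, volume_unitBox]; exact ENNReal.one_lt_top⟩
  have hb (x : K) : ∀ᵐ c ∂volume.restrict (unitBox (Fin (rank K))),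
      ‖Real.exp (-Real.pi * placeForm (unitWeight ρ c) x)‖ ≤
        Real.exp (-Real.pi * placeForm (fun _ => ρ * a) x) := by
    refine (ae_restrict_iff' (measurableSet_unitBox _)).mpr (.of_forall fun c hc => ?_)
    rw [Real.norm_eq_abs, Real.abs_exp, Real.exp_le_exp]
    have := mul_le_mul_of_nonneg_left (placeForm_mono (s := fun _ => ρ * a) (t := unitWeight ρ c)
      (fun w => mul_le_mul_of_nonneg_left (h c hc w) hρ.le) x) Real.pi_pos.le
    linarith
  have hcont (x : K) : Continuous fun c => Real.exp (-Real.pi * placeForm (unitWeight ρ c) x) := by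
    have h2 : Continuous fun c => unitLog K c := (unitLog K).continuous_of_finiteDimensional
    have h3 : ∀ w, Continuous fun c => unitLog K c w := fun w => (continuous_apply w).comp h2
    unfold placeForm unitWeight
    fun_prop
  have hint (x : K) : Integrable (fun c => Real.exp (-Real.pi * placeForm (unitWeight ρ c) x))
      (volume.restrict (unitBox (Fin (rank K)))) :=
    .of_bound (hcont x).aestronglyMeasurable _ (hb x)
  have hsum : Summable fun x : {x : K // x ∈ I ∧ x ≠ 0} =>
      Real.exp (-Real.pi * placeForm (fun _ => ρ * a) (x : K)) :=
    (hasSum_idealTheta_sub_one hI fun _ => mul_pos hρ ha).summable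
  have key := hasSum_integral_of_summable_integral_norm
    (μ := volume.restrict (unitBox (Fin (rank K))))
    (F := fun (x : {x : K // x ∈ I ∧ x ≠ 0}) c =>
      Real.exp (-Real.pi * placeForm (unitWeight ρ c) (x : K))) (fun x => hint x)
    (hsum.of_nonneg_of_le (fun x => integral_nonneg fun c => norm_nonneg _) fun x => ?_)
  · have h1 : ∫ c in unitBox (Fin (rank K)), ∑' x : {x : K // x ∈ I ∧ x ≠ 0},
        Real.exp (-Real.pi * placeForm (unitWeight ρ c) (x : K)) = avgTheta I ρ - 1 := by
      simp_rw [fun c => (hasSum_idealTheta_sub_one hI (unitWeight_pos hρ c)).tsum_eq]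
      rw [integral_sub (integrableOn_idealTheta_unitWeight hI hρ) (integrable_const _), avgTheta]
      simp [hvol]
    rw [h1] at key
    have := Complex.hasSum_ofReal.mpr key
    simpa only [integral_complex_ofReal, Complex.ofReal_sub, Complex.ofReal_one] using this
  · refine (integral_mono_ae (hint x).norm (integrable_const _) (hb x)).trans_eq ?_
    simp [hvol]

end Unfolding

section IdealSums

open Units

variable (K : Type*) [Field K] [NumberField K]

theorem isBigO_sum_rK :
    (fun n : ℕ => ∑ m ∈ Finset.Icc 1 n, (rK K m : ℝ)) =O[atTop] fun n => (n : ℝ) ^ (1 : ℝ) := by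
  have h : Tendsto (fun n : ℕ => (∑ m ∈ Finset.Icc 1 n, (rK K m : ℝ)) / (n : ℝ) ^ (1 : ℝ))
      atTop (nhds (dedekindZeta_residue K)) := by
    refine ((Ideal.tendsto_norm_le_div_atTop₀ K).comp tendsto_natCast_atTop_atTop).congr fun n ↦ ?_
    simp only [Function.comp_apply, Nat.cast_le, ← Nat.cast_sum, Real.rpow_one, rK]
    congr
    rw [← add_left_inj 1, ← Ideal.card_norm_le_eq_card_norm_le_add_one,
      show Finset.Icc 1 n = Finset.Ioc 0 n from Finset.Icc_succ_left_eq_Ioc _ _,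
      show 1 = Nat.card {I : Ideal (𝓞 K) // Ideal.absNorm I = 0} by
        simp [Ideal.absNorm_eq_zero_iff],
      Finset.sum_Ioc_add_eq_sum_Icc (n.zero_le),
      ← Finset.card_preimage_eq_sum_card_image_eq (fun k _ ↦ Ideal.finite_setOfPred_absNorm_eq k)]
    simp [Set.coe_eq_subtype]
  refine isBigO_of_div_tendsto_nhds ?_ _ h
  filter_upwards [eventually_gt_atTop 0] with n hn h0
  have : (0 : ℝ) < n := by exact_mod_cast hn
  simp at h0; omega

theorem summable_rK_mul_cpow {s : ℂ} (hs : 1 < s.re) :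
    Summable fun m : ℕ => (rK K m : ℂ) * (m : ℂ) ^ (-s) := by
  have h : LSeriesSummable (fun n => ((rK K n : ℝ) : ℂ)) s :=
    LSeriesSummable_of_sum_norm_bigO_and_nonneg (isBigO_sum_rK K)
      (fun _ => Nat.cast_nonneg _) zero_le_one hs
  refine h.congr fun m => ?_
  have hs0 : s ≠ 0 := fun h => by rw [h, Complex.zero_re] at hs; linarith
  rcases eq_or_ne m 0 with rfl | hm
  · simp [hs0]
  · rw [LSeries.term_of_ne_zero hm, Complex.cpow_neg, div_eq_mul_inv]
    simp

theorem finite_absNorm_eq (m : ℕ) : Finite {J : Ideal (𝓞 K) // Ideal.absNorm J = m} :=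
  (Ideal.finite_setOfPred_absNorm_eq m).to_subtype

theorem summable_absNorm_cpow {s : ℂ} (hs : 1 < s.re) :
    Summable fun J : Ideal (𝓞 K) => (Ideal.absNorm J : ℂ) ^ (-s) := by
  have hfin := finite_absNorm_eq K
  rw [← summable_norm_iff, ← (Equiv.sigmaFiberEquiv (Ideal.absNorm (S := 𝓞 K))).summable_iff]
  refine (summable_sigma_of_nonneg fun _ => norm_nonneg _).mpr ⟨fun m => ?_, ?_⟩
  · exact Summable.of_finite
  · have := (summable_rK_mul_cpow K hs).norm
    refine this.congr fun m => ?_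
    rw [norm_mul, tsum_congr (g := fun _ => ‖(m : ℂ) ^ (-s)‖) (fun J => by
      have := J.2
      simp [Equiv.sigmaFiberEquiv, this])]
    rw [tsum_const, nsmul_eq_mul, rK]
    simp

theorem hasSum_absNorm_cpow {s : ℂ} (hs : 1 < s.re) :
    HasSum (fun J : Ideal (𝓞 K) => (Ideal.absNorm J : ℂ) ^ (-s))
      (∑' m : ℕ, (rK K m : ℂ) * (m : ℂ) ^ (-s)) := by
  have hfin := finite_absNorm_eq K
  have h := (Equiv.sigmaFiberEquiv (Ideal.absNorm (S := 𝓞 K))).hasSum_iff.mpr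
    (summable_absNorm_cpow K hs).hasSum
  have h2 := h.sigma (g := fun m : ℕ => (rK K m : ℂ) * (m : ℂ) ^ (-s)) fun m => by
    have := Fintype.ofFinite {J : Ideal (𝓞 K) // Ideal.absNorm J = m}
    have := hasSum_fintype (fun _ : {J : Ideal (𝓞 K) // Ideal.absNorm J = m} => (m : ℂ) ^ (-s))
      (L := .unconditional _)
    rw [Finset.sum_const, nsmul_eq_mul, Finset.card_univ, ← Nat.card_eq_fintype_card] at this
    refine HasSum.congr_fun this fun J => ?_
    have := J.2
    simp [Equiv.sigmaFiberEquiv, this]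
  rw [h2.tsum_eq]
  exact (summable_absNorm_cpow K hs).hasSum

open scoped nonZeroDivisors

variable {K}

/-- A fractional ideal representing an ideal class. -/
noncomputable def classRep (C : ClassGroup (𝓞 K)) : FractionalIdeal (𝓞 K)⁰ K :=
  ((ClassGroup.mk0_surjective C).choose : Ideal (𝓞 K))

theorem classRep_ne_zero (C : ClassGroup (𝓞 K)) : classRep C ≠ 0 :=
  FractionalIdeal.coeIdeal_ne_zero.mpr
    (nonZeroDivisors.coe_ne_zero (ClassGroup.mk0_surjective C).choose)

theorem mem_inverseClass_classRep {J : Ideal (𝓞 K)} (hJ : J ≠ 0) (C : ClassGroup (𝓞 K)) :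
    J ∈ inverseClass (classRep C) ↔
      C = (ClassGroup.mk0 ⟨J, mem_nonZeroDivisors_of_ne_zero hJ⟩)⁻¹ := by
  have hC := (ClassGroup.mk0_surjective C).choose_spec
  rw [eq_inv_iff_mul_eq_one, mul_comm]
  nth_rewrite 2 [← hC]
  rw [← map_mul, eq_comm, ← map_one ClassGroup.mk0,
    ClassGroup.mk0_eq_mk0_iff_exists_fraction_ring K]
  simp only [inverseClass, mem_ofPred_eq, classRep, exists_prop, Submonoid.coe_mul, Submonoid.coe_one,
    FractionalIdeal.coeIdeal_mul, Ideal.one_eq_top, FractionalIdeal.coeIdeal_top, mul_one, eq_comm]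

theorem tsum_rK_eq_sum_class {s : ℂ} (hs : 1 < s.re) :
    ∑' m : ℕ, (rK K m : ℂ) * (m : ℂ) ^ (-s) =
      ∑ C : ClassGroup (𝓞 K), ∑' J : inverseClass (classRep C), (Ideal.absNorm J.1 : ℂ) ^ (-s) := by
  have hs0 : s ≠ 0 := fun h => by rw [h, Complex.zero_re] at hs; linarith
  have hsum := summable_absNorm_cpow K hs
  rw [← (hasSum_absNorm_cpow K hs).tsum_eq]
  simp_rw [fun C : ClassGroup (𝓞 K) => tsum_subtype (inverseClass (classRep C))
    fun J => (Ideal.absNorm J : ℂ) ^ (-s)]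
  rw [← Summable.tsum_finsetSum fun C _ => hsum.indicator _]
  refine tsum_congr fun J => ?_
  rcases eq_or_ne J 0 with rfl | hJ
  · have h0 : ((Ideal.absNorm (0 : Ideal (𝓞 K)) : ℕ) : ℂ) ^ (-s) = 0 := by simp [hs0]
    rw [h0]
    symm
    refine Finset.sum_eq_zero fun C _ => ?_
    by_cases h : (0 : Ideal (𝓞 K)) ∈ inverseClass (classRep C)
    · rw [indicator_of_mem h, h0]
    · rw [indicator_of_notMem h]
  · classical
    simp only [indicator_apply, mem_inverseClass_classRep hJ]
    simp

end IdealSums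

section Unfolding

open scoped nonZeroDivisors
open Units

variable {K : Type*} [Field K] [NumberField K]

variable (K) in
/-- The Jacobian of the logarithmic coordinates. -/
noncomputable def logJacobian : ℝ := (exists_integral_placeKernel (K := K)).choose

theorem logJacobian_pos : 0 < logJacobian K := (exists_integral_placeKernel (K := K)).choose_spec.1

theorem integral_placeKernel {x : K} (hx : x ≠ 0) {s : ℂ} (hs : 0 < s.re) :
    ∫ p, placeKernel x s p =
        logJacobian K * archFactor K s * ((|Algebra.norm ℚ x| : ℚ) : ℂ) ^ (-s) :=
  ((exists_integral_placeKernel (K := K)).choose_spec.2 x hx s hs).2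

theorem integral_placeKernel_classGenerator {I : FractionalIdeal (𝓞 K)⁰ K} (J : inverseClass I)
    {s : ℂ} (hs : 0 < s.re) :
    ∫ p, placeKernel (classGenerator J) s p =
      logJacobian K * archFactor K s * ((FractionalIdeal.absNorm I : ℝ) : ℂ) ^ (-s) *
        (Ideal.absNorm J.1 : ℂ) ^ (-s) := by
  rw [integral_placeKernel (classGenerator_ne_zero J) hs, abs_norm_classGenerator]
  have h0 : (0 : ℝ) ≤ (FractionalIdeal.absNorm I : ℝ) := by
    exact_mod_cast FractionalIdeal.absNorm_nonneg I
  have := Complex.mul_cpow_ofReal_nonneg (Nat.cast_nonneg (Ideal.absNorm J.1)) h0 (-s)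
  push_cast at this ⊢
  rw [this]
  ring

/-- The integral of the norm of `placeKernel` over a fundamental domain for the units. -/
noncomputable def boxKernelNorm (x : K) (s : ℂ) : ℝ :=
  ∫ y, ∫ c in unitBox (Fin (rank K)), ‖placeKernel x s (y, c)‖

theorem ofReal_boxKernelNorm (x : K) (s : ℂ) : (boxKernelNorm x s : ℂ) = boxKernel x s.re := by
  simp only [boxKernelNorm, boxKernel, ← norm_placeKernel, integral_complex_ofReal]

theorem boxKernelNorm_nonneg (x : K) (s : ℂ) : 0 ≤ boxKernelNorm x s :=
  integral_nonneg fun _ => integral_nonneg fun _ => norm_nonneg _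

theorem hasSum_boxKernelNorm {x : K} (hx : x ≠ 0) {s : ℂ} (hs : 0 < s.re) (ζ : torsion K) :
    HasSum (fun k : Fin (rank K) → ℤ => boxKernelNorm ((unitOf (ζ, k) : K) * x) s)
      (∫ p, ‖placeKernel x s p‖) := by
  rw [← Complex.hasSum_ofReal]
  have h := hasSum_boxKernel hx (s := s.re) (by simpa using hs) ζ
  simpa only [Function.comp_def, ofReal_boxKernelNorm, ← integral_complex_ofReal,
    norm_placeKernel] using h

theorem summable_boxKernelNorm {I : FractionalIdeal (𝓞 K)⁰ K} (hI : I ≠ 0) {s : ℂ}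
    (hs : 1 < s.re) :
    Summable fun e => boxKernelNorm (inverseClassEquiv I hI e : K) s := by
  have hs0 : 0 < s.re := zero_lt_one.trans hs
  have h1 (e : inverseClass I × torsion K) := hasSum_boxKernelNorm (classGenerator_ne_zero e.1) hs0 e.2
  refine (summable_prod_of_nonneg fun e => boxKernelNorm_nonneg _ _).mpr
    ⟨fun e => (h1 e).summable, ?_⟩
  refine Summable.congr (f := fun e : inverseClass I × torsion K =>
    (∫ p, ‖placeKernel (classGenerator e.1) s p‖) * 1) ?_ fun e => by
      rw [mul_one]; exact (h1 e).tsum_eq.symm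
  refine Summable.mul_of_nonneg (f := fun J : inverseClass I => ∫ p, ‖placeKernel (classGenerator J) s p‖)
    (g := fun _ : torsion K => (1 : ℝ)) ?_ Summable.of_finite
    (fun J => integral_nonneg fun _ => norm_nonneg _) fun _ => zero_le_one
  rw [← Complex.summable_ofReal]
  simp only [← integral_complex_ofReal, norm_placeKernel]
  have h2 := ((summable_absNorm_cpow K (s := s.re) (by simpa using hs)).subtype
    (inverseClass I)).mul_left (logJacobian K * archFactor K s.re *
      ((FractionalIdeal.absNorm I : ℝ) : ℂ) ^ (-(s.re : ℂ)))
  refine h2.congr fun J => ?_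
  rw [integral_placeKernel_classGenerator J (by simpa using hs0)]
  rfl

theorem integrable_integral_placeKernel {x : K} (hx : x ≠ 0) {s : ℂ} (hs : 0 < s.re) :
    Integrable fun y => ∫ c in unitBox (Fin (rank K)), placeKernel x s (y, c) :=
  (integrable_placeKernel_box hx hs).integral_prod_left

theorem hasSum_boxKernel_thetaPair {I : FractionalIdeal (𝓞 K)⁰ K} (hI : I ≠ 0) {s : ℂ}
    (hs : 1 < s.re) :
    HasSum (fun e => boxKernel (inverseClassEquiv I hI e : K) s)
      ((thetaPair hI).Λ (Module.finrank ℚ K * s / 2)) := by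
  have := countable_numberField K
  have hs0 : 0 < s.re := zero_lt_one.trans hs
  have hn := Module.finrank_pos (R := ℚ) (M := K)
  have hn' : (0 : ℝ) < Module.finrank ℚ K := by exact_mod_cast hn
  have hre : (Module.finrank ℚ K * s / 2 : ℂ).re = Module.finrank ℚ K / 2 * s.re := by
    have h1 : (Module.finrank ℚ K * s / 2 : ℂ) = ((Module.finrank ℚ K / 2 : ℝ) : ℂ) * s := by
      push_cast; ring
    rw [h1, Complex.re_ofReal_mul]
  have hmel := ((thetaPair hI).hasMellin (s := Module.finrank ℚ K * s / 2)
    (by rw [hre]; change (Module.finrank ℚ K : ℝ) / 2 < _; nlinarith)).2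
  have hsum := (inverseClassEquiv I hI).summable_iff
    (f := fun x : {x : K // x ∈ I ∧ x ≠ 0} => boxKernelNorm (x : K) s) |>.mp
    (summable_boxKernelNorm hI hs)
  have key := hasSum_integral_of_summable_integral_norm (μ := (volume : Measure ℝ))
    (F := fun (x : {x : K // x ∈ I ∧ x ≠ 0}) y =>
      ∫ c in unitBox (Fin (rank K)), placeKernel (x : K) s (y, c))
    (fun x => integrable_integral_placeKernel x.2.2 hs0)
    (hsum.of_nonneg_of_le (fun x => integral_nonneg fun c => norm_nonneg _) fun x =>
      integral_mono (integrable_integral_placeKernel x.2.2 hs0).norm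
        (integrable_placeKernel_box x.2.2 hs0).norm.integral_prod_left
        fun y => norm_integral_le_integral_norm _)
  have h2 (y : ℝ) : ∑' x : {x : K // x ∈ I ∧ x ≠ 0},
      ∫ c in unitBox (Fin (rank K)), placeKernel (x : K) s (y, c) =
      Complex.exp (Module.finrank ℚ K * s / 2 * y) * (avgTheta I (Real.exp y) - 1) := by
    rw [← (hasSum_avgTheta_sub_one hI (Real.exp_pos y)).tsum_eq, ← tsum_mul_left]
    refine tsum_congr fun x => ?_
    rw [← integral_const_mul]
    rfl
  simp only [h2] at key
  have h3 : ∫ y : ℝ, Complex.exp (Module.finrank ℚ K * s / 2 * y) * (avgTheta I (Real.exp y) - 1) =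
      (thetaPair hI).Λ (Module.finrank ℚ K * s / 2) := by
    rw [← hmel, mellin]
    exact (integral_cpow_smul_eq_integral_exp (fun t => avgTheta I t - 1) _).symm
  rw [h3] at key
  exact (inverseClassEquiv I hI).hasSum_iff.mpr key

/-- The Mellin transform of the averaged theta series is a partial zeta function. -/
theorem Λ_thetaPair {I : FractionalIdeal (𝓞 K)⁰ K} (hI : I ≠ 0) {s : ℂ} (hs : 1 < s.re) :
    (thetaPair hI).Λ (Module.finrank ℚ K * s / 2) =
      torsionOrder K * (logJacobian K * archFactor K s *
        ((FractionalIdeal.absNorm I : ℝ) : ℂ) ^ (-s)) *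
        ∑' J : inverseClass I, (Ideal.absNorm J.1 : ℂ) ^ (-s) := by
  have hs0 : 0 < s.re := zero_lt_one.trans hs
  have := Fintype.ofFinite (torsion K)
  have h := (hasSum_boxKernel_thetaPair hI hs).prod_fiberwise fun e =>
    hasSum_boxKernel (classGenerator_ne_zero e.1) hs0 e.2
  have h2 := h.prod_fiberwise fun J =>
    hasSum_fintype (fun _ : torsion K => ∫ p, placeKernel (classGenerator J) s p)
      (L := .unconditional _)
  rw [← h2.tsum_eq, ← tsum_mul_left]
  refine tsum_congr fun J => ?_
  rw [Finset.sum_const, Finset.card_univ, nsmul_eq_mul, torsionOrder,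
    Nat.card_eq_fintype_card,
    integral_placeKernel_classGenerator J hs0]
  ring

end Unfolding

section GammaRatio

theorem convexOn_log_sq_add_sq_sub_log (t : ℝ) :
    ConvexOn ℝ (Ioi 0) fun u : ℝ => Real.log (u ^ 2 + t ^ 2) / 2 - Real.log u := by
  have hd (u : ℝ) (hu : 0 < u) : HasDerivAt (fun u : ℝ => Real.log (u ^ 2 + t ^ 2) / 2 - Real.log u)
      (-(t ^ 2 / (u * (u ^ 2 + t ^ 2)))) u := by
    have h0 : 0 < u ^ 2 + t ^ 2 := by positivity
    have h1 : HasDerivAt (fun u : ℝ => u ^ 2 + t ^ 2) (2 * u) u := by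
      simpa using (hasDerivAt_pow 2 u).add_const (t ^ 2)
    convert! ((h1.log h0.ne').div_const 2).sub (Real.hasDerivAt_log hu.ne') using 1
    field_simp
    ring
  refine MonotoneOn.convexOn_of_deriv (convex_Ioi 0)
    (fun u hu => (hd u hu).continuousAt.continuousWithinAt)
    (fun u hu => (hd u (by simpa using hu)).differentiableAt.differentiableWithinAt) ?_
  rw [interior_Ioi]
  intro u hu v hv huv
  have hu : 0 < u := hu
  have hv : 0 < v := hv
  rw [(hd u hu).deriv, (hd v hv).deriv]
  gcongr

theorem log_norm_GammaSeq_sub {σ : ℝ} (hσ : 0 < σ) (t : ℝ) {n : ℕ} (hn : n ≠ 0) :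
    Real.log ‖Complex.GammaSeq σ n‖ - Real.log ‖Complex.GammaSeq (σ + t * Complex.I) n‖ =
      ∑ j ∈ Finset.range (n + 1), (Real.log ((σ + j) ^ 2 + t ^ 2) / 2 - Real.log (σ + j)) := by
  have hn' : (0 : ℝ) < n := by exact_mod_cast Nat.pos_of_ne_zero hn
  have h1 (j : ℕ) : 0 < σ + j := by positivity
  have hnorm (j : ℕ) (t : ℝ) : Real.log ‖(σ + t * Complex.I + j : ℂ)‖ =
      Real.log ((σ + j) ^ 2 + t ^ 2) / 2 := by
    have : (σ + t * Complex.I + j : ℂ) = ((σ + j : ℝ) : ℂ) + t * Complex.I := by push_cast; ring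
    rw [this, Complex.norm_add_mul_I, Real.log_sqrt (by positivity)]
  have hne (j : ℕ) (t : ℝ) : ‖(σ + t * Complex.I + j : ℂ)‖ ≠ 0 := by
    rw [norm_ne_zero_iff]
    intro h
    have := congrArg Complex.re h
    simp at this
    exact (h1 j).ne' this
  have key (t : ℝ) : Real.log ‖Complex.GammaSeq (σ + t * Complex.I) n‖ =
      Real.log ((n : ℝ) ^ σ * n.factorial) -
        ∑ j ∈ Finset.range (n + 1), Real.log ((σ + j) ^ 2 + t ^ 2) / 2 := by
    rw [Complex.GammaSeq, norm_div, norm_mul, norm_prod, Complex.norm_natCast,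
      Complex.norm_natCast_cpow_of_pos (Nat.pos_of_ne_zero hn), Real.log_div (by positivity)
      (Finset.prod_ne_zero_iff.mpr fun j _ => hne j t), Real.log_prod (fun j _ => hne j t)]
    simp [hnorm]
  have key0 := key 0
  simp only [Complex.ofReal_zero, zero_mul, add_zero] at key0
  rw [key0, key t, Finset.sum_sub_distrib]
  have : ∀ j : ℕ, Real.log ((σ + j) ^ 2 + 0 ^ 2) / 2 = Real.log (σ + j) := fun j => by
    rw [zero_pow two_ne_zero, add_zero, Real.log_pow]
    push_cast; ring
  simp only [this]
  ring

theorem convexOn_log_norm_Gamma_sub (t : ℝ) : ConvexOn ℝ (Ioi 0) fun σ : ℝ =>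
    Real.log ‖Complex.Gamma σ‖ - Real.log ‖Complex.Gamma (σ + t * Complex.I)‖ := by
  have hlim (σ : ℝ) (hσ : 0 < σ) : Tendsto (fun n : ℕ => ∑ j ∈ Finset.range (n + 1),
      (Real.log ((σ + j) ^ 2 + t ^ 2) / 2 - Real.log (σ + j))) atTop
      (nhds (Real.log ‖Complex.Gamma σ‖ - Real.log ‖Complex.Gamma (σ + t * Complex.I)‖)) := by
    have h1 := (Complex.GammaSeq_tendsto_Gamma σ).norm.log
      (norm_ne_zero_iff.mpr (Complex.Gamma_ne_zero_of_re_pos (by simpa using hσ)))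
    have h2 := (Complex.GammaSeq_tendsto_Gamma (σ + t * Complex.I)).norm.log
      (norm_ne_zero_iff.mpr (Complex.Gamma_ne_zero_of_re_pos (by simpa using hσ)))
    refine (h1.sub h2).congr' ?_
    filter_upwards [eventually_ne_atTop 0] with n hn
    exact log_norm_GammaSeq_sub hσ t hn
  have hconv (j : ℕ) : ConvexOn ℝ (Ioi 0) fun σ : ℝ =>
      Real.log ((σ + j) ^ 2 + t ^ 2) / 2 - Real.log (σ + j) := by
    refine ((convexOn_log_sq_add_sq_sub_log t).translate_left (j : ℝ)).subset (fun σ hσ => ?_)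
      (convex_Ioi 0)
    have : (0 : ℝ) < σ := hσ
    simp only [mem_preimage, mem_Ioi]
    positivity
  refine ⟨convex_Ioi 0, fun x hx y hy a b ha hb hab => ?_⟩
  refine le_of_tendsto_of_tendsto' (hlim _ ((convex_Ioi (0 : ℝ)) hx hy ha hb hab))
    (((hlim x hx).const_smul a).add ((hlim y hy).const_smul b)) fun n => ?_
  rw [Finset.smul_sum, Finset.smul_sum, ← Finset.sum_add_distrib]
  exact Finset.sum_le_sum fun j _ => (hconv j).2 hx hy ha hb hab

theorem norm_Gamma_sub_le {p h : ℝ} (hph : 0 < p - h) (hh : 0 ≤ h) (t : ℝ) :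
    ‖Complex.Gamma ((p - h : ℝ) + t * Complex.I)‖ ≤
      ‖Complex.Gamma ((p - h : ℝ) : ℂ)‖ / ‖Complex.Gamma (p : ℝ)‖ *
        ‖Complex.Gamma (p + t * Complex.I)‖ * (p / ‖(p + t * Complex.I : ℂ)‖) ^ h := by
  have hp : 0 < p := by linarith
  have hpc : (p + t * Complex.I : ℂ) ≠ 0 := fun h => by
    have := congrArg Complex.re h
    simp at this
    exact hp.ne' this
  have hG (σ : ℝ) (hσ : 0 < σ) (t : ℝ) : 0 < ‖Complex.Gamma (σ + t * Complex.I)‖ :=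
    norm_pos_iff.mpr (Complex.Gamma_ne_zero_of_re_pos (by simpa using hσ))
  have hG0 (σ : ℝ) (hσ : 0 < σ) : 0 < ‖Complex.Gamma σ‖ :=
    norm_pos_iff.mpr (Complex.Gamma_ne_zero_of_re_pos (by simpa using hσ))
  have hpn : 0 < ‖(p + t * Complex.I : ℂ)‖ := norm_pos_iff.mpr hpc
  have hconv := (convexOn_log_norm_Gamma_sub t).2 (show p - h ∈ Ioi (0 : ℝ) from hph)
    (show p + 1 ∈ Ioi (0 : ℝ) by simp only [mem_Ioi]; linarith)
    (show 0 ≤ 1 / (1 + h) by positivity) (show 0 ≤ h / (1 + h) by positivity) (by field_simp)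
  have hcomb : (1 / (1 + h)) • (p - h) + (h / (1 + h)) • (p + 1) = p := by
    simp only [smul_eq_mul]; field_simp; ring
  rw [hcomb] at hconv
  have e1 : Complex.Gamma ((p + 1 : ℝ) : ℂ) = p * Complex.Gamma p := by
    rw [← Complex.Gamma_add_one _ (by exact_mod_cast hp.ne')]; push_cast; rfl
  have e2 : Complex.Gamma ((p + 1 : ℝ) + t * Complex.I) =
      (p + t * Complex.I) * Complex.Gamma (p + t * Complex.I) := by
    rw [← Complex.Gamma_add_one _ hpc]; push_cast; ring_nf
  simp only [e1, e2, norm_mul, smul_eq_mul] at hconv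
  rw [Real.log_mul (by simpa using hp.ne') (hG0 p hp).ne', Real.log_mul hpn.ne' (hG p hp t).ne',
    Complex.norm_real, Real.norm_of_nonneg hp.le] at hconv
  rw [← Real.log_le_log_iff (hG _ hph t)
    (mul_pos (mul_pos (div_pos (hG0 _ hph) (hG0 p hp)) (hG p hp t)) (by positivity)),
    Real.log_mul (mul_pos (div_pos (hG0 _ hph) (hG0 p hp)) (hG p hp t)).ne' (by positivity),
    Real.log_mul (div_pos (hG0 _ hph) (hG0 p hp)).ne' (hG p hp t).ne',
    Real.log_div (hG0 _ hph).ne' (hG0 p hp).ne', Real.log_rpow (by positivity),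
    Real.log_div hp.ne' hpn.ne']
  have h3 := mul_le_mul_of_nonneg_left hconv (show 0 ≤ 1 + h by linarith)
  have h4 : ∀ a b : ℝ, (1 + h) * (1 / (1 + h) * a + h / (1 + h) * b) = a + h * b := fun a b => by
    field_simp
  rw [h4] at h3
  linarith

theorem one_add_abs_le_mul_norm {p : ℝ} (hp : 0 < p) (t : ℝ) :
    1 + |t| ≤ (1 + 1 / p) * ‖(p + t * Complex.I : ℂ)‖ := by
  have h1 : p ≤ ‖(p + t * Complex.I : ℂ)‖ := by
    exact (le_abs_self p).trans (by simpa using Complex.abs_re_le_norm (p + t * Complex.I : ℂ))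
  have h2 : |t| ≤ ‖(p + t * Complex.I : ℂ)‖ := by
    simpa using Complex.abs_im_le_norm (p + t * Complex.I : ℂ)
  have h3 : 1 ≤ 1 / p * ‖(p + t * Complex.I : ℂ)‖ := by
    rw [one_div, ← div_eq_inv_mul, one_le_div hp]; exact h1
  linarith

theorem norm_Gamma_sub_le' {p h : ℝ} (hph : 0 < p - h) (hh : 0 ≤ h) :
    ∃ C : ℝ, 0 < C ∧ ∀ t : ℝ, ‖Complex.Gamma ((p - h : ℝ) + t * Complex.I)‖ ≤
      C * ‖Complex.Gamma (p + t * Complex.I)‖ * (1 + |t|) ^ (-h) := by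
  have hp : 0 < p := by linarith
  have hG0 (σ : ℝ) (hσ : 0 < σ) : 0 < ‖Complex.Gamma σ‖ :=
    norm_pos_iff.mpr (Complex.Gamma_ne_zero_of_re_pos (by simpa using hσ))
  have hA : 0 < ‖Complex.Gamma ((p - h : ℝ) : ℂ)‖ / ‖Complex.Gamma (p : ℝ)‖ :=
    div_pos (hG0 _ hph) (hG0 p hp)
  refine ⟨‖Complex.Gamma ((p - h : ℝ) : ℂ)‖ / ‖Complex.Gamma (p : ℝ)‖ * (p * (1 + 1 / p)) ^ h,
    by positivity, fun t => (norm_Gamma_sub_le hph hh t).trans ?_⟩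
  have hpn : 0 < ‖(p + t * Complex.I : ℂ)‖ := by
    refine lt_of_lt_of_le hp ?_
    exact (le_abs_self p).trans (by simpa using Complex.abs_re_le_norm (p + t * Complex.I : ℂ))
  have ht : 0 < 1 + |t| := by positivity
  have key : (p / ‖(p + t * Complex.I : ℂ)‖) ^ h ≤ (p * (1 + 1 / p)) ^ h * (1 + |t|) ^ (-h) := by
    rw [Real.rpow_neg ht.le, ← Real.inv_rpow ht.le, ← Real.mul_rpow (by positivity) (by positivity)]
    refine Real.rpow_le_rpow (by positivity) ?_ hh
    rw [← div_eq_mul_inv, div_le_div_iff₀ hpn ht]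
    have := mul_le_mul_of_nonneg_left (one_add_abs_le_mul_norm hp t) hp.le
    linarith
  calc _ ≤ ‖Complex.Gamma ((p - h : ℝ) : ℂ)‖ / ‖Complex.Gamma (p : ℝ)‖ *
        ‖Complex.Gamma (p + t * Complex.I)‖ * ((p * (1 + 1 / p)) ^ h * (1 + |t|) ^ (-h)) := by
        gcongr
    _ = _ := by ring

theorem norm_neg_add_mul_I_le {b : ℝ} (hb : 0 ≤ b) (hb1 : b ≤ 1) (t : ℝ) :
    ‖(-b + t * Complex.I : ℂ)‖ ≤ 1 + |t| ∧ ‖(1 - b + t * Complex.I : ℂ)‖ ≤ 1 + |t| := by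
  constructor
  · refine (norm_add_le _ _).trans ?_
    simp [abs_of_nonneg hb, hb1]
  · have : (1 - b + t * Complex.I : ℂ) = ((1 - b : ℝ) : ℂ) + t * Complex.I := by push_cast; ring
    rw [this]
    refine (norm_add_le _ _).trans ?_
    rw [Complex.norm_real, Real.norm_of_nonneg (by linarith)]
    simp [hb]

/-- The ratio of Gamma factors on the two sides of the functional equation has polynomial
growth of the expected order. -/
theorem exists_norm_Gamma_le_mul {m : ℕ} (hm : m = 1 ∨ m = 2) {b : ℝ} (hb : 0 < b)
    (hbm : b ≤ m / 4) (hb1 : b < 1) : ∃ C : ℝ, 0 < C ∧ ∀ t : ℝ,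
    ‖Complex.Gamma ((m / 2 + b : ℝ) + t * Complex.I)‖ ≤
      C * ‖Complex.Gamma (-b + t * Complex.I)‖ * (1 + |t|) ^ ((m : ℝ) / 2 + 2 * b) := by
  have hm0 : (0 : ℝ) < m := by rcases hm with rfl | rfl <;> norm_num
  obtain ⟨C, hC, h⟩ := norm_Gamma_sub_le' (p := m - b) (h := m / 2 - 2 * b) (by
    have : (m : ℝ) - b - (m / 2 - 2 * b) = m / 2 + b := by ring
    rw [this]; positivity) (by linarith)
  refine ⟨C, hC, fun t => ?_⟩
  have h' := h t
  rw [show (m : ℝ) - b - (m / 2 - 2 * b) = m / 2 + b by ring] at h'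
  refine h'.trans ?_
  have ht : 0 < 1 + |t| := by positivity
  have hz : (-b + t * Complex.I : ℂ) ≠ 0 := fun h => by
    have := congrArg Complex.re h
    simp at this
    exact hb.ne' this
  have hz1 : (1 - b + t * Complex.I : ℂ) ≠ 0 := fun h => by
    have := congrArg Complex.re h
    simp at this
    linarith
  obtain ⟨hn0, hn1⟩ := norm_neg_add_mul_I_le hb.le hb1.le t
  have key : ‖Complex.Gamma ((m - b : ℝ) + t * Complex.I)‖ ≤
      ‖Complex.Gamma (-b + t * Complex.I)‖ * (1 + |t|) ^ (m : ℝ) := by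
    have e1 : Complex.Gamma (1 - b + t * Complex.I) =
        (-b + t * Complex.I) * Complex.Gamma (-b + t * Complex.I) := by
      rw [← Complex.Gamma_add_one _ hz]; ring_nf
    have e2 : Complex.Gamma (2 - b + t * Complex.I) =
        (1 - b + t * Complex.I) * Complex.Gamma (1 - b + t * Complex.I) := by
      rw [← Complex.Gamma_add_one _ hz1]; ring_nf
    rcases hm with rfl | rfl
    · have : (((1 : ℕ) - b : ℝ) + t * Complex.I : ℂ) = 1 - b + t * Complex.I := by
        push_cast; ring
      rw [this, e1, norm_mul, mul_comm]
      simp only [Nat.cast_one, Real.rpow_one]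
      gcongr
    · have : (((2 : ℕ) - b : ℝ) + t * Complex.I : ℂ) = 2 - b + t * Complex.I := by
        push_cast; ring
      rw [this, e2, e1, norm_mul, norm_mul, Real.rpow_natCast]
      calc _ ≤ (1 + |t|) * ((1 + |t|) * ‖Complex.Gamma (-b + t * Complex.I)‖) := by gcongr
        _ = _ := by ring
  calc _ ≤ C * (‖Complex.Gamma (-b + t * Complex.I)‖ * (1 + |t|) ^ (m : ℝ)) *
        (1 + |t|) ^ (-((m : ℝ) / 2 - 2 * b)) := by gcongr
    _ = C * ‖Complex.Gamma (-b + t * Complex.I)‖ *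
        ((1 + |t|) ^ (m : ℝ) * (1 + |t|) ^ (-((m : ℝ) / 2 - 2 * b))) := by ring
    _ = _ := by rw [← Real.rpow_add ht]; ring_nf

end GammaRatio

section StripGrowth

/-- At most exponential growth in the imaginary direction on the strip `-1/4 ≤ re s ≤ 5/4`. -/
def StripGrowth (f : ℂ → ℂ) : Prop :=
  ∃ C A : ℝ, 0 ≤ C ∧ 0 ≤ A ∧ ∀ s : ℂ, s.re ∈ Icc (-1 / 4 : ℝ) (5 / 4) →
    ‖f s‖ ≤ C * Real.exp (A * |s.im|)

theorem StripGrowth.of_bounded {f : ℂ → ℂ} (C : ℝ)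
    (h : ∀ s : ℂ, s.re ∈ Icc (-1 / 4 : ℝ) (5 / 4) → ‖f s‖ ≤ C) : StripGrowth f :=
  ⟨C, 0, (norm_nonneg _).trans (h 0 (by norm_num)), le_rfl, fun s hs => by simpa using h s hs⟩

theorem stripGrowth_const (c : ℂ) : StripGrowth fun _ => c :=
  .of_bounded ‖c‖ fun _ _ => le_rfl

theorem StripGrowth.add {f g : ℂ → ℂ} (hf : StripGrowth f) (hg : StripGrowth g) :
    StripGrowth fun s => f s + g s := by
  obtain ⟨C, A, hC, hA, h⟩ := hf
  obtain ⟨C', A', hC', hA', h'⟩ := hg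
  refine ⟨C + C', A + A', by positivity, by positivity, fun s hs => (norm_add_le _ _).trans ?_⟩
  have h1 : A * |s.im| ≤ (A + A') * |s.im| := by
    gcongr; linarith
  have h2 : A' * |s.im| ≤ (A + A') * |s.im| := by
    gcongr; linarith
  rw [add_mul]
  exact add_le_add ((h s hs).trans (by gcongr)) ((h' s hs).trans (by gcongr))

theorem StripGrowth.mul {f g : ℂ → ℂ} (hf : StripGrowth f) (hg : StripGrowth g) :
    StripGrowth fun s => f s * g s := by
  obtain ⟨C, A, hC, hA, h⟩ := hf
  obtain ⟨C', A', hC', hA', h'⟩ := hg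
  refine ⟨C * C', A + A', by positivity, by positivity, fun s hs => ?_⟩
  rw [norm_mul, add_mul, Real.exp_add]
  calc _ ≤ (C * Real.exp (A * |s.im|)) * (C' * Real.exp (A' * |s.im|)) :=
        mul_le_mul (h s hs) (h' s hs) (norm_nonneg _) (by positivity)
    _ = _ := by ring

theorem StripGrowth.sub {f g : ℂ → ℂ} (hf : StripGrowth f) (hg : StripGrowth g) :
    StripGrowth fun s => f s - g s := by
  simpa [sub_eq_add_neg] using hf.add ((stripGrowth_const (-1)).mul hg)

theorem StripGrowth.sum {ι : Type*} (S : Finset ι) {f : ι → ℂ → ℂ}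
    (hf : ∀ i ∈ S, StripGrowth (f i)) : StripGrowth fun s => ∑ i ∈ S, f i s := by
  classical
  induction S using Finset.induction_on with
  | empty => simpa using stripGrowth_const 0
  | insert a S ha ih =>
    simp only [Finset.sum_insert ha]
    exact (hf a (by simp)).add (ih fun i hi => hf i (by simp [hi]))

theorem StripGrowth.prod {ι : Type*} (S : Finset ι) {f : ι → ℂ → ℂ}
    (hf : ∀ i ∈ S, StripGrowth (f i)) : StripGrowth fun s => ∏ i ∈ S, f i s := by
  classical
  induction S using Finset.induction_on with
  | empty => simpa using stripGrowth_const 1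
  | insert a S ha ih =>
    simp only [Finset.prod_insert ha]
    exact (hf a (by simp)).mul (ih fun i hi => hf i (by simp [hi]))

theorem norm_ofReal_cpow_le_of_strip {a : ℝ} (ha : 0 < a) {l u : ℝ} {z : ℂ} (hl : l ≤ z.re)
    (hu : z.re ≤ u) : ‖(a : ℂ) ^ z‖ ≤ a ^ l + a ^ u := by
  rw [Complex.norm_cpow_eq_rpow_re_of_pos ha]
  rcases le_total 1 a with h | h
  · exact (Real.rpow_le_rpow_of_exponent_le h hu).trans (le_add_of_nonneg_left (by positivity))
  · exact (Real.rpow_le_rpow_of_exponent_ge ha h hl).trans (le_add_of_nonneg_right (by positivity))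

theorem stripGrowth_cpow {a : ℝ} (ha : 0 < a) {c : ℝ} (hc : 0 ≤ c) :
    StripGrowth fun s => (a : ℂ) ^ (c * s) :=
  .of_bounded (a ^ (c * (-1 / 4)) + a ^ (c * (5 / 4))) fun s hs =>
    norm_ofReal_cpow_le_of_strip ha
      (by simpa using mul_le_mul_of_nonneg_left hs.1 hc)
      (by simpa using mul_le_mul_of_nonneg_left hs.2 hc)

theorem isCompact_re_Icc_im_Icc (a b c d : ℝ) :
    IsCompact {s : ℂ | s.re ∈ Icc a b ∧ s.im ∈ Icc c d} :=
  (isCompact_Icc (a := a) (b := b)).reProdIm (isCompact_Icc (a := c) (b := d))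

theorem Differentiable.dslope {f : ℂ → ℂ} (hf : Differentiable ℂ f) (c : ℂ) :
    Differentiable ℂ (dslope f c) := by
  have := (Complex.differentiableOn_dslope (f := f) (s := univ) (c := c) univ_mem).mpr
    hf.differentiableOn
  exact differentiableOn_univ.mp this

theorem StripGrowth.dslope {f : ℂ → ℂ} (hf : StripGrowth f) (hd : Differentiable ℂ f) (c : ℂ) :
    StripGrowth (dslope f c) := by
  obtain ⟨B, hB⟩ := (isCompact_closedBall c 1).exists_bound_of_continuousOn
    (hd.dslope c).continuous.continuousOn
  obtain ⟨C, A, hC, hA, h⟩ := hf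
  have hB0 : 0 ≤ B := (norm_nonneg _).trans (hB c (by simp))
  refine ⟨C + ‖f c‖ + B, A, by positivity, hA, fun s hs => ?_⟩
  have he : 1 ≤ Real.exp (A * |s.im|) := Real.one_le_exp (by positivity)
  by_cases hsc : s ∈ Metric.closedBall c 1
  · calc _ ≤ B * 1 := by simpa using hB s hsc
      _ ≤ _ := by gcongr; linarith [norm_nonneg (f c)]
  · have h1 : 1 < ‖s - c‖ := by simpa [dist_eq_norm] using hsc
    have hne : s ≠ c := fun h => by simp [h] at hsc
    rw [dslope_of_ne _ hne, slope_def_field, norm_div]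
    calc _ ≤ ‖f s - f c‖ := div_le_self (norm_nonneg _) h1.le
      _ ≤ ‖f s‖ + ‖f c‖ := norm_sub_le _ _
      _ ≤ C * Real.exp (A * |s.im|) + ‖f c‖ * Real.exp (A * |s.im|) :=
        add_le_add (h s hs) (le_mul_of_one_le_right (norm_nonneg _) he)
      _ ≤ _ := by
        rw [← add_mul]
        exact mul_le_mul_of_nonneg_right (by linarith) (by positivity)

theorem norm_Gamma_le_Gamma_re {s : ℂ} (hs : 0 < s.re) : ‖Complex.Gamma s‖ ≤ Real.Gamma s.re := by
  rw [Complex.Gamma_eq_integral hs, Real.Gamma_eq_integral hs, Complex.GammaIntegral]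
  refine (norm_integral_le_integral_norm _).trans (le_of_eq ?_)
  refine setIntegral_congr_fun measurableSet_Ioi fun x (hx : 0 < x) => ?_
  simp only [norm_mul, Complex.norm_cpow_eq_rpow_re_of_pos hx]
  rw [Complex.norm_real, Real.norm_of_nonneg (Real.exp_pos _).le]
  simp

theorem norm_sin_le_exp (z : ℂ) : ‖Complex.sin z‖ ≤ Real.exp |z.im| := by
  rw [Complex.sin, norm_div, norm_mul, Complex.norm_I, mul_one, Complex.norm_ofNat, div_le_iff₀ two_pos]
  refine (norm_sub_le _ _).trans ?_
  rw [Complex.norm_exp, Complex.norm_exp]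
  have h1 : (-z * Complex.I).re = z.im := by simp
  have h2 : (z * Complex.I).re = -z.im := by simp
  rw [h1, h2, mul_two]
  gcongr
  · exact le_abs_self _
  · exact neg_le_abs _

theorem stripGrowth_inv_Gamma : StripGrowth fun s => (Complex.Gamma s)⁻¹ := by
  obtain ⟨B, hB⟩ := (isCompact_re_Icc_im_Icc (-1 / 4) (5 / 4) (-1) 1).exists_bound_of_continuousOn
    Complex.differentiable_one_div_Gamma.continuous.continuousOn
  obtain ⟨D, hD⟩ := (isCompact_Icc (a := (3 / 4 : ℝ)) (b := 9 / 4)).exists_bound_of_continuousOn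
    (f := Real.Gamma) fun x hx => (Real.differentiableAt_Gamma fun m h => by
      have := hx.1
      rw [h] at this
      linarith [Nat.cast_nonneg (α := ℝ) m]).continuousAt.continuousWithinAt
  have hB0 : 0 ≤ B := (norm_nonneg _).trans (hB 0 (by norm_num))
  have hD0 : 0 ≤ D := (norm_nonneg _).trans (hD 1 (by norm_num))
  refine ⟨B + D, Real.pi, by positivity, Real.pi_pos.le, fun s hs => ?_⟩
  have he : 1 ≤ Real.exp (Real.pi * |s.im|) := Real.one_le_exp (by positivity)
  by_cases him : |s.im| ≤ 1
  · calc _ ≤ B * 1 := by simpa using hB s ⟨hs, abs_le.mp him⟩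
      _ ≤ _ := by gcongr; linarith
  push Not at him
  have him0 : s.im ≠ 0 := fun h => by simp [h] at him; linarith
  have h1s : (1 - s) ≠ 0 := fun h => by
    have := congrArg Complex.im h
    simp at this
    exact him0 this
  have hsin : Complex.sin (Real.pi * s) ≠ 0 := by
    intro h
    obtain ⟨k, hk⟩ := Complex.sin_eq_zero_iff.mp h
    have := congrArg Complex.im hk
    simp [Real.pi_ne_zero] at this
    exact him0 this
  have hrefl := Complex.Gamma_mul_Gamma_one_sub s
  have hG2 : Complex.Gamma (2 - s) = (1 - s) * Complex.Gamma (1 - s) := by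
    rw [← Complex.Gamma_add_one _ h1s]; ring_nf
  have hG : Complex.Gamma s ≠ 0 := fun h => by
    rw [h, zero_mul] at hrefl
    exact div_ne_zero (by exact_mod_cast Real.pi_ne_zero) hsin hrefl.symm
  have hpi : (Real.pi : ℂ) ≠ 0 := by exact_mod_cast Real.pi_ne_zero
  have key : (Complex.Gamma s)⁻¹ =
      Complex.Gamma (2 - s) * Complex.sin (Real.pi * s) / (Real.pi * (1 - s)) := by
    rw [hG2]
    rw [eq_div_iff hsin] at hrefl
    rw [inv_eq_iff_eq_inv, inv_div, eq_div_iff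
      (mul_ne_zero (mul_ne_zero h1s fun h => ?_) hsin)]
    · linear_combination (1 - s) * hrefl
    · rw [h, mul_zero, zero_mul] at hrefl
      exact hpi hrefl.symm
  simp only [key]
  rw [ norm_div, norm_mul, norm_mul]
  have h2 : ‖Complex.Gamma (2 - s)‖ ≤ D := by
    have hre : (2 - s).re = 2 - s.re := by simp
    refine (norm_Gamma_le_Gamma_re (by rw [hre]; linarith [hs.2])).trans ?_
    rw [hre]
    exact (le_abs_self _).trans (hD _ ⟨by linarith [hs.2], by linarith [hs.1]⟩)
  have h3 : ‖Complex.sin (Real.pi * s)‖ ≤ Real.exp (Real.pi * |s.im|) := by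
    simpa [abs_mul, abs_of_pos Real.pi_pos] using norm_sin_le_exp (Real.pi * s)
  have h4 : 1 ≤ ‖(Real.pi : ℂ)‖ * ‖1 - s‖ := by
    have h5 : 1 ≤ ‖1 - s‖ := him.le.trans (by simpa using Complex.abs_im_le_norm (1 - s))
    have h6 : 1 ≤ ‖(Real.pi : ℂ)‖ := by
      rw [Complex.norm_real, Real.norm_of_nonneg Real.pi_pos.le]
      linarith [Real.pi_gt_three]
    nlinarith
  calc _ ≤ ‖Complex.Gamma (2 - s)‖ * ‖Complex.sin (Real.pi * s)‖ :=
        div_le_self (by positivity) h4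
    _ ≤ D * Real.exp (Real.pi * |s.im|) := by gcongr
    _ ≤ _ := by gcongr; linarith

theorem StripGrowth.comp_mul {f : ℂ → ℂ} (hf : StripGrowth f) {c : ℝ} (hc : 0 ≤ c) (hc1 : c ≤ 1) :
    StripGrowth fun s => f (c * s) := by
  obtain ⟨C, A, hC, hA, h⟩ := hf
  refine ⟨C, A, hC, hA, fun s hs => (h (c * s) ?_).trans ?_⟩
  · rw [Complex.re_ofReal_mul]
    constructor <;> nlinarith [hs.1, hs.2]
  · rw [Complex.im_ofReal_mul, abs_mul, abs_of_nonneg hc]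
    gcongr
    exact mul_le_of_le_one_left (abs_nonneg _) hc1

theorem WeakFEPair.exists_norm_Λ₀_le (P : WeakFEPair ℂ) (l u : ℝ) :
    ∃ C : ℝ, ∀ s : ℂ, l ≤ s.re → s.re ≤ u → ‖P.Λ₀ s‖ ≤ C := by
  have hint (r : ℝ) : IntegrableOn (fun t : ℝ => t ^ (r - 1) * ‖P.f_modif t‖) (Ioi 0) := by
    have := (P.isStrongFEPair_toStrongFEPair.hasMellin (r : ℂ)).1.norm
    refine IntegrableOn.congr_fun this (fun t (ht : 0 < t) => ?_) measurableSet_Ioi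
    simp [Complex.norm_cpow_eq_rpow_re_of_pos ht, WeakFEPair.toStrongFEPair]
  refine ⟨∫ t in Ioi (0 : ℝ), (t ^ (l - 1) * ‖P.f_modif t‖ + t ^ (u - 1) * ‖P.f_modif t‖),
    fun s hl hu => ?_⟩
  rw [WeakFEPair.Λ₀, mellin]
  refine (norm_integral_le_integral_norm _).trans ?_
  refine setIntegral_mono_on ((P.isStrongFEPair_toStrongFEPair.hasMellin s).1.norm)
    ((hint l).add (hint u)) measurableSet_Ioi fun t (ht : 0 < t) => ?_
  rw [norm_smul, ← add_mul]
  gcongr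
  exact norm_ofReal_cpow_le_of_strip ht (by simpa using hl) (by simpa using hu)

theorem WeakFEPair.stripGrowth_Λ₀ (P : WeakFEPair ℂ) {c : ℝ} (hc : 0 ≤ c) :
    StripGrowth fun s => P.Λ₀ (c * s) := by
  obtain ⟨C, h⟩ := P.exists_norm_Λ₀_le (c * (-1 / 4)) (c * (5 / 4))
  refine .of_bounded C fun s hs => h _ ?_ ?_ <;> rw [Complex.re_ofReal_mul]
  · exact mul_le_mul_of_nonneg_left hs.1 hc
  · exact mul_le_mul_of_nonneg_left hs.2 hc

end StripGrowth

section Continuation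

open scoped nonZeroDivisors

variable (K : Type*) [Field K] [NumberField K]

/-- The reciprocal of the product of the archimedean Euler factors of `ζ_K`. -/
noncomputable def archInv (s : ℂ) : ℂ :=
  ∏ w : InfinitePlace K, ((Real.pi * w.mult : ℝ) : ℂ) ^ (((w.mult / 2 : ℝ) : ℂ) * s) *
    (Complex.Gamma (((w.mult / 2 : ℝ) : ℂ) * s))⁻¹

variable {K}

omit [NumberField K] in
theorem pi_mul_mult_pos (w : InfinitePlace K) : 0 < Real.pi * w.mult := by
  have := w.mult_pos
  positivity

omit [NumberField K] in
theorem mult_eq_one_or_two (w : InfinitePlace K) : w.mult = 1 ∨ w.mult = 2 := by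
  rw [InfinitePlace.mult]; split_ifs <;> simp

omit [NumberField K] in
theorem mult_half_le_one (w : InfinitePlace K) : (w.mult / 2 : ℝ) ≤ 1 := by
  rcases mult_eq_one_or_two w with h | h <;> rw [h] <;> norm_num

theorem differentiable_archInv : Differentiable ℂ (archInv K) := by
  unfold archInv
  refine Differentiable.fun_finsetProd fun w _ => ?_
  have h : ((Real.pi * w.mult : ℝ) : ℂ) ≠ 0 := by exact_mod_cast (pi_mul_mult_pos w).ne'
  refine Differentiable.mul ?_ ?_
  · exact (differentiable_id.const_mul _).const_cpow (Or.inl h)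
  · exact Complex.differentiable_one_div_Gamma.comp (differentiable_id.const_mul _)

theorem stripGrowth_archInv : StripGrowth (archInv K) :=
  StripGrowth.prod _ fun w _ => (stripGrowth_cpow (pi_mul_mult_pos w) (by positivity)).mul
    (stripGrowth_inv_Gamma.comp_mul (by positivity) (mult_half_le_one w))

theorem archInv_zero : archInv K 0 = 0 := by
  obtain ⟨w⟩ := (inferInstance : Nonempty (InfinitePlace K))
  exact Finset.prod_eq_zero (Finset.mem_univ w) (by simp)

theorem archInv_mul_archFactor {s : ℂ} (hs : 0 < s.re) : archInv K s * archFactor K s = 1 := by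
  rw [archInv, archFactor, ← Finset.prod_mul_distrib]
  refine Finset.prod_eq_one fun w _ => ?_
  have h : ((Real.pi * w.mult : ℝ) : ℂ) ≠ 0 := by exact_mod_cast (pi_mul_mult_pos w).ne'
  have e : ((w.mult / 2 : ℝ) : ℂ) * s = w.mult * s / 2 := by push_cast; ring
  have hG : Complex.Gamma (w.mult * s / 2) ≠ 0 := by
    refine Complex.Gamma_ne_zero_of_re_pos ?_
    rw [← e, Complex.re_ofReal_mul]
    have := w.mult_pos
    positivity
  rw [e, Complex.cpow_neg]
  have h2 : ((Real.pi * w.mult : ℝ) : ℂ) ^ (w.mult * s / 2) ≠ 0 := by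
    simp [Complex.cpow_eq_zero_iff]
  field_simp

theorem exists_archInv_mul_archFactor_le {δ : ℝ} (hδ : 0 < δ) (hδ' : δ ≤ 1 / 4) :
    ∃ C : ℝ, 0 < C ∧ ∀ t : ℝ,
      ‖archInv K (-δ + t * Complex.I)‖ * ‖archFactor K (1 + δ - t * Complex.I)‖ ≤
        C * (1 + |t|) ^ ((Module.finrank ℚ K : ℝ) / 2 + Module.finrank ℚ K * δ) := by
  have hplace (w : InfinitePlace K) : ∃ C : ℝ, 0 < C ∧ ∀ t : ℝ,
      ‖((Real.pi * w.mult : ℝ) : ℂ) ^ (((w.mult / 2 : ℝ) : ℂ) * (-δ + t * Complex.I)) *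
        (Complex.Gamma (((w.mult / 2 : ℝ) : ℂ) * (-δ + t * Complex.I)))⁻¹‖ *
      ‖((Real.pi * w.mult : ℝ) : ℂ) ^ (-(w.mult * (1 + δ - t * Complex.I) / 2)) *
        Complex.Gamma (w.mult * (1 + δ - t * Complex.I) / 2)‖ ≤
      C * (1 + |t|) ^ ((w.mult : ℝ) / 2 + w.mult * δ) := by
    have hm := w.mult_pos
    have hm' : (0 : ℝ) < w.mult := by exact_mod_cast hm
    obtain ⟨C, hC, h⟩ := exists_norm_Gamma_le_mul (mult_eq_one_or_two w) (b := w.mult * δ / 2)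
      (by positivity) (by nlinarith) (by nlinarith [mult_half_le_one w])
    have hp := pi_mul_mult_pos w
    refine ⟨(Real.pi * w.mult) ^ (-(w.mult * δ / 2)) *
      (Real.pi * w.mult) ^ (-(w.mult * (1 + δ) / 2)) * C, by positivity, fun t => ?_⟩
    set τ : ℝ := w.mult / 2 * t with hτ
    have e1 : ((w.mult / 2 : ℝ) : ℂ) * (-δ + t * Complex.I) =
        -((w.mult * δ / 2 : ℝ) : ℂ) + τ * Complex.I := by
      rw [hτ]; push_cast; ring
    have e2 : (w.mult * (1 + δ - t * Complex.I) / 2 : ℂ) =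
        (starRingEnd ℂ) (((w.mult / 2 + w.mult * δ / 2 : ℝ) : ℂ) + τ * Complex.I) := by
      rw [hτ, map_add, map_mul, Complex.conj_ofReal, Complex.conj_ofReal, Complex.conj_I]
      push_cast; ring
    have hτt : |τ| ≤ |t| := by
      rw [hτ, abs_mul, abs_of_pos (by positivity : (0 : ℝ) < w.mult / 2)]
      exact mul_le_of_le_one_left (abs_nonneg _) (mult_half_le_one w)
    rw [norm_mul, norm_mul, e2, Complex.Gamma_conj, Complex.norm_conj, ← e2, e1, norm_inv,
      Complex.norm_cpow_eq_rpow_re_of_pos hp, Complex.norm_cpow_eq_rpow_re_of_pos hp]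
    have r1 : (-((w.mult * δ / 2 : ℝ) : ℂ) + τ * Complex.I).re = -(w.mult * δ / 2) := by simp
    have r2 : (-(w.mult * (1 + δ - t * Complex.I) / 2 : ℂ)).re = -(w.mult * (1 + δ) / 2) := by
      have : (-(w.mult * (1 + δ - t * Complex.I) / 2 : ℂ)) =
          ((-(w.mult * (1 + δ) / 2) : ℝ) : ℂ) + τ * Complex.I := by
        rw [hτ]; push_cast; ring
      rw [this]; simp
    rw [r1, r2]
    have h' := h τ
    have hG : ‖Complex.Gamma (-((w.mult * δ / 2 : ℝ) : ℂ) + τ * Complex.I)‖⁻¹ *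
        ‖Complex.Gamma (((w.mult / 2 + w.mult * δ / 2 : ℝ) : ℂ) + τ * Complex.I)‖ ≤
        C * (1 + |t|) ^ ((w.mult : ℝ) / 2 + w.mult * δ) := by
      calc _ ≤ ‖Complex.Gamma (-((w.mult * δ / 2 : ℝ) : ℂ) + τ * Complex.I)‖⁻¹ *
            (C * ‖Complex.Gamma (-((w.mult * δ / 2 : ℝ) : ℂ) + τ * Complex.I)‖ *
              (1 + |τ|) ^ ((w.mult : ℝ) / 2 + 2 * (w.mult * δ / 2))) := by gcongr
        _ = (‖Complex.Gamma (-((w.mult * δ / 2 : ℝ) : ℂ) + τ * Complex.I)‖⁻¹ *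
            ‖Complex.Gamma (-((w.mult * δ / 2 : ℝ) : ℂ) + τ * Complex.I)‖) *
              (C * (1 + |τ|) ^ ((w.mult : ℝ) / 2 + w.mult * δ)) := by ring_nf
        _ ≤ 1 * (C * (1 + |t|) ^ ((w.mult : ℝ) / 2 + w.mult * δ)) := by
          gcongr
          exact inv_mul_le_one
        _ = _ := one_mul _
    calc _ = (Real.pi * w.mult) ^ (-(w.mult * δ / 2)) *
          (Real.pi * w.mult) ^ (-(w.mult * (1 + δ) / 2)) *
          (‖Complex.Gamma (-((w.mult * δ / 2 : ℝ) : ℂ) + τ * Complex.I)‖⁻¹ *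
        ‖Complex.Gamma (((w.mult / 2 + w.mult * δ / 2 : ℝ) : ℂ) + τ * Complex.I)‖) := by ring
      _ ≤ (Real.pi * w.mult) ^ (-(w.mult * δ / 2)) *
          (Real.pi * w.mult) ^ (-(w.mult * (1 + δ) / 2)) *
          (C * (1 + |t|) ^ ((w.mult : ℝ) / 2 + w.mult * δ)) := by gcongr
      _ = _ := by ring
  choose C hC h using hplace
  refine ⟨∏ w, C w, Finset.prod_pos fun w _ => hC w, fun t => ?_⟩
  have ht : 0 < 1 + |t| := by positivity
  have hsum : (Module.finrank ℚ K : ℝ) / 2 + Module.finrank ℚ K * δ =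
      ∑ w : InfinitePlace K, ((w.mult : ℝ) / 2 + w.mult * δ) := by
    rw [Finset.sum_add_distrib, ← Finset.sum_div, ← Finset.sum_mul, ← Nat.cast_sum,
      InfinitePlace.sum_mult_eq]
  rw [hsum, Real.rpow_sum_of_pos ht, archInv, archFactor, norm_prod, norm_prod,
    ← Finset.prod_mul_distrib, ← Finset.prod_mul_distrib]
  exact Finset.prod_le_prod (fun w _ => by positivity) fun w _ => h w t

theorem absNorm_fractionalIdeal_pos {I : FractionalIdeal (𝓞 K)⁰ K} (hI : I ≠ 0) :
    (0 : ℝ) < (FractionalIdeal.absNorm I : ℝ) := by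
  have h := (FractionalIdeal.absNorm_nonneg I).lt_of_ne' fun h =>
    hI (FractionalIdeal.absNorm_eq_zero_iff.mp h)
  exact_mod_cast h

theorem symm_Λ_thetaPair {I : FractionalIdeal (𝓞 K)⁰ K} (hI : I ≠ 0) {z : ℂ}
    (hz : (Module.finrank ℚ K : ℝ) / 2 < z.re) : (thetaPair hI).symm.Λ z =
      (thetaPair (FractionalIdeal.dual_ne_zero ℤ ℚ hI)).Λ z := by
  rw [← ((thetaPair hI).symm.hasMellin hz).2,
    ← ((thetaPair (FractionalIdeal.dual_ne_zero ℤ ℚ hI)).hasMellin hz).2]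
  rfl

theorem exists_norm_tsum_absNorm_cpow_le (S : Set (Ideal (𝓞 K))) {σ : ℝ} (hσ : 1 < σ) :
    ∃ C : ℝ, ∀ s : ℂ, s.re = σ → ‖∑' J : S, (Ideal.absNorm J.1 : ℂ) ^ (-s)‖ ≤ C := by
  refine ⟨∑' J : S, ‖(Ideal.absNorm J.1 : ℂ) ^ (-(σ : ℂ))‖, fun s hs => ?_⟩
  have h1 : Summable fun J : S => ‖(Ideal.absNorm J.1 : ℂ) ^ (-s)‖ :=
    ((summable_absNorm_cpow K (by rw [hs]; exact hσ)).norm).subtype S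
  refine (norm_tsum_le_tsum_norm h1).trans (le_of_eq (tsum_congr fun J => ?_))
  have hs0 : s ≠ 0 := fun h => by rw [h, Complex.zero_re] at hs; linarith
  rcases eq_or_ne (Ideal.absNorm J.1) 0 with h0 | h0
  · rw [h0, Nat.cast_zero, Complex.zero_cpow (neg_ne_zero.mpr hs0), Complex.zero_cpow]
    exact neg_ne_zero.mpr (by exact_mod_cast (zero_lt_one.trans hσ).ne')
  · rw [Complex.norm_natCast_cpow_of_pos (Nat.pos_of_ne_zero h0),
      Complex.norm_natCast_cpow_of_pos (Nat.pos_of_ne_zero h0)]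
    simp [hs]

/-- Meromorphic continuation, growth and convexity-type bounds for the zeta function of an ideal
class. -/
theorem exists_classZeta {I : FractionalIdeal (𝓞 K)⁰ K} (hI : I ≠ 0) :
    ∃ (P : ℂ → ℂ) (κ : ℂ), Differentiable ℂ P ∧ StripGrowth P ∧
      (∀ s : ℂ, 1 < s.re →
        ∑' J : inverseClass I, (Ideal.absNorm J.1 : ℂ) ^ (-s) = P s + κ / (s - 1)) ∧
      ∀ δ : ℝ, 0 < δ → δ ≤ 1 / 4 → ∃ C : ℝ, ∀ t : ℝ, ‖P (-δ + t * Complex.I)‖ ≤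
        C * (1 + |t|) ^ ((Module.finrank ℚ K : ℝ) / 2 + Module.finrank ℚ K * δ) := by
  set n : ℝ := ((Module.finrank ℚ K : ℕ) : ℝ) with hn
  have hn0 : 0 < n := by rw [hn]; exact_mod_cast Module.finrank_pos (R := ℚ) (M := K)
  have hnC : (n : ℂ) ≠ 0 := by exact_mod_cast hn0.ne'
  set T := thetaPair hI with hT
  set a : ℝ := (FractionalIdeal.absNorm I : ℝ) with ha
  have ha0 : 0 < a := absNorm_fractionalIdeal_pos hI
  have haC : (a : ℂ) ≠ 0 := by exact_mod_cast ha0.ne'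
  set b : ℝ := (FractionalIdeal.absNorm (FractionalIdeal.dual ℤ ℚ I) : ℝ) with hb
  have hb0 : 0 < b := absNorm_fractionalIdeal_pos (FractionalIdeal.dual_ne_zero ℤ ℚ hI)
  set D : ℂ := Units.torsionOrder K * logJacobian K with hD
  have hD0 : D ≠ 0 := mul_ne_zero (by exact_mod_cast (Units.torsionOrder_pos K).ne')
    (by exact_mod_cast (logJacobian_pos (K := K)).ne')
  set A := archInv K with hA
  have hAd : Differentiable ℂ A := differentiable_archInv
  have hapd : Differentiable ℂ fun s : ℂ => (a : ℂ) ^ s :=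
    differentiable_id.const_cpow (Or.inl haC)
  have hapg : StripGrowth fun s : ℂ => (a : ℂ) ^ s := by
    simpa using stripGrowth_cpow ha0 zero_le_one
  let F : ℂ → ℂ := fun s => (2 * T.ε / (n * D)) * ((a : ℂ) ^ s * A s)
  have hFd : Differentiable ℂ F := (hapd.mul hAd).const_mul _
  have hFg : StripGrowth F := (stripGrowth_const _).mul (hapg.mul stripGrowth_archInv)
  let P : ℂ → ℂ := fun s => D⁻¹ * ((a : ℂ) ^ s * A s) * T.Λ₀ (((n / 2 : ℝ) : ℂ) * s) -
    (2 / (n * D)) * ((a : ℂ) ^ s * dslope A 0 s) + dslope F 1 s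
  have hP (s : ℂ) (h0 : s ≠ 0) (h1 : s ≠ 1) :
      P s = D⁻¹ * ((a : ℂ) ^ s * A s) * T.Λ (((n / 2 : ℝ) : ℂ) * s) - F 1 / (s - 1) := by
    have h1' : s - 1 ≠ 0 := sub_ne_zero.mpr h1
    have h1'' : 1 - s ≠ 0 := sub_ne_zero.mpr h1.symm
    have hΛ : T.Λ₀ (((n / 2 : ℝ) : ℂ) * s) = T.Λ (((n / 2 : ℝ) : ℂ) * s) + 2 / (n * s) +
        2 * T.ε / (n * (1 - s)) := by
      rw [T.Λ₀_eq]
      have e1 : T.f₀ = 1 := rfl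
      have e2 : T.g₀ = 1 := rfl
      have e3 : T.k = n / 2 := rfl
      rw [e1, e2, e3, smul_eq_mul, smul_eq_mul]
      have : ((n / 2 : ℝ) : ℂ) - ((n / 2 : ℝ) : ℂ) * s = n / 2 * (1 - s) := by push_cast; ring
      rw [this]
      push_cast
      field_simp
    have hd0 : dslope A 0 s = A s / s := by
      rw [dslope_of_ne _ h0, slope_def_field, hA, archInv_zero, sub_zero, sub_zero]
    have hd1 : dslope F 1 s = (F s - F 1) / (s - 1) := by
      rw [dslope_of_ne _ h1, slope_def_field]
    simp only [P]
    rw [hΛ, hd0, hd1]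
    have hF : F s = (2 * T.ε / (n * D)) * ((a : ℂ) ^ s * A s) := rfl
    rw [hF]
    have h1n : (1 - s) = -(s - 1) := by ring
    rw [h1n]
    field_simp
    ring
  have hfin : (Module.finrank ℚ K : ℂ) = (n : ℂ) := by rw [hn]; push_cast; rfl
  refine ⟨P, F 1, ?_, ?_, fun s hs => ?_, fun δ hδ hδ' => ?_⟩
  · refine ((((hapd.mul hAd).const_mul _).mul
      (T.differentiable_Λ₀.comp (differentiable_id.const_mul _))).sub
      ((hapd.mul (hAd.dslope 0)).const_mul _)).add (hFd.dslope 1)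
  · exact ((((stripGrowth_const _).mul (hapg.mul stripGrowth_archInv)).mul
      (T.stripGrowth_Λ₀ (by positivity))).sub ((stripGrowth_const _).mul
      (hapg.mul (stripGrowth_archInv.dslope hAd 0)))).add (hFg.dslope hFd 1)
  · have hs0 : s ≠ 0 := fun h => by rw [h, Complex.zero_re] at hs; linarith
    have hs1 : s ≠ 1 := fun h => by rw [h, Complex.one_re] at hs; linarith
    rw [hP s hs0 hs1, sub_add_cancel]
    have h := Λ_thetaPair hI hs
    rw [hfin, show (n : ℂ) * s / 2 = ((n / 2 : ℝ) : ℂ) * s by push_cast; ring] at h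
    rw [hT, h, Complex.cpow_neg]
    have hA1 := archInv_mul_archFactor (K := K) (s := s) (by linarith)
    have hap : (a : ℂ) ^ s ≠ 0 := by simp [Complex.cpow_eq_zero_iff, haC]
    set Z := ∑' J : inverseClass I, (Ideal.absNorm J.1 : ℂ) ^ (-s)
    calc Z = (D⁻¹ * D) * ((a : ℂ) ^ s * ((a : ℂ) ^ s)⁻¹) * (archInv K s * archFactor K s) * Z := by
          rw [inv_mul_cancel₀ hD0, mul_inv_cancel₀ hap, hA1]; ring
      _ = _ := by rw [hD]; ring
  · obtain ⟨C, hC, hAC⟩ := exists_archInv_mul_archFactor_le (K := K) hδ hδ'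
    obtain ⟨M, hM⟩ := exists_norm_tsum_absNorm_cpow_le
      (inverseClass (FractionalIdeal.dual ℤ ℚ I)) (σ := 1 + δ) (by linarith)
    have hM0 : 0 ≤ M := (norm_nonneg _).trans (hM ((1 + δ : ℝ) : ℂ) (by simp))
    refine ⟨‖D⁻¹‖ * a ^ (-δ) * ‖T.ε‖ * ‖D‖ * b ^ (-(1 + δ)) * M * C + ‖F 1‖, fun t => ?_⟩
    set s : ℂ := -δ + t * Complex.I with hs
    have hsre : s.re = -δ := by simp [hs]
    have h1s : 1 - s = 1 + δ - t * Complex.I := by rw [hs]; ring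
    have h1sre : (1 - s).re = 1 + δ := by simp [hsre]
    have hs0 : s ≠ 0 := fun h => by rw [h, Complex.zero_re] at hsre; linarith
    have hs1 : s ≠ 1 := fun h => by rw [h, Complex.one_re] at hsre; linarith
    have hpow : 1 ≤ (1 + |t|) ^ (n / 2 + n * δ) :=
      Real.one_le_rpow (by linarith [abs_nonneg t]) (by positivity)
    have hΛ : T.Λ (((n / 2 : ℝ) : ℂ) * s) = T.ε * (D * archFactor K (1 - s) *
        (b : ℂ) ^ (-(1 - s)) * ∑' J : inverseClass (FractionalIdeal.dual ℤ ℚ I),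
          (Ideal.absNorm J.1 : ℂ) ^ (-(1 - s))) := by
      have e : ((n / 2 : ℝ) : ℂ) * s = T.k - ((n / 2 : ℝ) : ℂ) * (1 - s) := by
        have e3 : T.k = n / 2 := rfl
        rw [e3]; ring
      have hre : n / 2 < (((n / 2 : ℝ) : ℂ) * (1 - s)).re := by
        rw [Complex.re_ofReal_mul, h1sre]
        nlinarith
      rw [e, T.functional_equation, smul_eq_mul, symm_Λ_thetaPair hI hre]
      have h := Λ_thetaPair (FractionalIdeal.dual_ne_zero ℤ ℚ hI) (s := 1 - s)
        (by rw [h1sre]; linarith)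
      rw [hfin, show (n : ℂ) * (1 - s) / 2 = ((n / 2 : ℝ) : ℂ) * (1 - s) by push_cast; ring] at h
      rw [h, hD, hb]
      ring
    rw [hP s hs0 hs1, hΛ]
    refine (norm_sub_le _ _).trans ?_
    have h2 : ‖F 1 / (s - 1)‖ ≤ ‖F 1‖ * (1 + |t|) ^ (n / 2 + n * δ) := by
      rw [norm_div]
      have : 1 ≤ ‖s - 1‖ := by
        have := Complex.abs_re_le_norm (s - 1)
        rw [Complex.sub_re, hsre, Complex.one_re, abs_of_neg (by linarith)] at this
        linarith
      exact (div_le_self (norm_nonneg _) this).trans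
        (le_mul_of_one_le_right (norm_nonneg _) hpow)
    have hAC' := hAC t
    rw [← h1s, ← hs] at hAC'
    rw [add_mul]
    refine add_le_add ?_ h2
    simp only [norm_mul]
    rw [Complex.norm_cpow_eq_rpow_re_of_pos ha0, Complex.norm_cpow_eq_rpow_re_of_pos hb0, hsre,
      Complex.neg_re, h1sre]
    calc _ = ‖D⁻¹‖ * a ^ (-δ) * ‖T.ε‖ * ‖D‖ * b ^ (-(1 + δ)) *
          ‖∑' J : inverseClass (FractionalIdeal.dual ℤ ℚ I),
            (Ideal.absNorm J.1 : ℂ) ^ (-(1 - s))‖ * (‖archInv K s‖ * ‖archFactor K (1 - s)‖) := by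
          rw [hA]; ring
      _ ≤ ‖D⁻¹‖ * a ^ (-δ) * ‖T.ε‖ * ‖D‖ * b ^ (-(1 + δ)) * M *
          (C * (1 + |t|) ^ (n / 2 + n * δ)) := by
          gcongr
          exact hM _ h1sre
      _ = _ := by ring

variable (K) in
/-- Meromorphic continuation, growth and convexity-type bounds for the Dedekind zeta function. -/
theorem exists_dedekindZeta_continuation :
    ∃ (P : ℂ → ℂ) (κ : ℂ), Differentiable ℂ P ∧ StripGrowth P ∧
      (∀ s : ℂ, 1 < s.re →
        ∑' m : ℕ, (rK K m : ℂ) * (m : ℂ) ^ (-s) = P s + κ / (s - 1)) ∧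
      ∀ δ : ℝ, 0 < δ → δ ≤ 1 / 4 → ∃ C : ℝ, ∀ t : ℝ, ‖P (-δ + t * Complex.I)‖ ≤
        C * (1 + |t|) ^ ((Module.finrank ℚ K : ℝ) / 2 + Module.finrank ℚ K * δ) := by
  choose P κ hd hg hP hC using fun C : ClassGroup (𝓞 K) => exists_classZeta (classRep_ne_zero C)
  refine ⟨fun s => ∑ C, P C s, ∑ C, κ C, Differentiable.fun_sum fun C _ => hd C,
    .sum _ fun C _ => hg C, fun s hs => ?_, fun δ hδ hδ' => ?_⟩
  · rw [tsum_rK_eq_sum_class hs, Finset.sum_div, ← Finset.sum_add_distrib]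
    exact Finset.sum_congr rfl fun C _ => hP C s hs
  · choose M hM using fun C => hC C δ hδ hδ'
    refine ⟨∑ C, M C, fun t => (norm_sum_le _ _).trans ?_⟩
    rw [Finset.sum_mul]
    exact Finset.sum_le_sum fun C _ => hM C t

end Continuation

section Smoothing

open ProbabilityTheory
open scoped NNReal

variable {v : ℝ≥0}

theorem gaussianPDFReal_eq_integral (hv : v ≠ 0) (σ w : ℝ) :
    (gaussianPDFReal 0 v w : ℂ) = (2 * Real.pi : ℂ)⁻¹ * ∫ t : ℝ,
      Complex.exp (v * (σ + t * Complex.I) ^ 2 / 2 - (σ + t * Complex.I) * w) := by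
  have hv0 : (0 : ℝ) < v := by exact_mod_cast pos_iff_ne_zero.mpr hv
  have hvC : ((v : ℝ) : ℂ) ≠ 0 := by exact_mod_cast hv0.ne'
  have hpi := Real.pi_pos
  have e (t : ℝ) : ((v : ℝ) : ℂ) * (σ + t * Complex.I) ^ 2 / 2 - (σ + t * Complex.I) * w =
      ((-(v : ℝ) / 2 : ℝ) : ℂ) * t ^ 2 + (((v : ℝ) * σ - w : ℝ) * Complex.I) * t +
        ((v : ℝ) * σ ^ 2 / 2 - σ * w : ℝ) := by
    push_cast
    linear_combination ((v : ℝ) : ℂ) * t ^ 2 / 2 * Complex.I_sq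
  simp_rw [e]
  rw [integral_cexp_quadratic (by rw [Complex.ofReal_re]; linarith)]
  have h1 : (Real.pi / -((-(v : ℝ) / 2 : ℝ) : ℂ)) ^ (1 / 2 : ℂ) = ((√(2 * Real.pi / v) : ℝ) : ℂ) := by
    rw [Real.sqrt_eq_rpow, Complex.ofReal_cpow (by positivity)]
    push_cast
    congr 1
    field_simp
  have h2 : (((v : ℝ) * σ ^ 2 / 2 - σ * w : ℝ) : ℂ) -
      (((v : ℝ) * σ - w : ℝ) * Complex.I) ^ 2 / (4 * ((-(v : ℝ) / 2 : ℝ) : ℂ)) =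
      ((-(w - 0) ^ 2 / (2 * v) : ℝ) : ℂ) := by
    rw [mul_pow, Complex.I_sq]
    push_cast
    field_simp
    ring
  have h3 : (√(2 * Real.pi * v))⁻¹ = (2 * Real.pi)⁻¹ * √(2 * Real.pi / v) := by
    have h4 : √(2 * Real.pi / v) * √(2 * Real.pi * v) = 2 * Real.pi := by
      rw [← Real.sqrt_mul (by positivity), show 2 * Real.pi / v * (2 * Real.pi * v) =
        (2 * Real.pi) ^ 2 by field_simp, Real.sqrt_sq (by positivity)]
    have h5 : √(2 * Real.pi * v) ≠ 0 := by positivity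
    field_simp
    linarith
  rw [h1, h2, gaussianPDFReal, h3]
  push_cast
  ring

theorem integrable_cexp_gaussian (hv : v ≠ 0) (σ L : ℝ) : Integrable fun t : ℝ =>
    Complex.exp (v * (σ + t * Complex.I) ^ 2 / 2 + (σ + t * Complex.I) * L) := by
  have hv0 : (0 : ℝ) < v := by exact_mod_cast pos_iff_ne_zero.mpr hv
  have e (t : ℝ) : ((v : ℝ) : ℂ) * (σ + t * Complex.I) ^ 2 / 2 + (σ + t * Complex.I) * L =
      ((-(v : ℝ) / 2 : ℝ) : ℂ) * t ^ 2 + (((v : ℝ) * σ + L : ℝ) * Complex.I) * t +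
        ((v : ℝ) * σ ^ 2 / 2 + σ * L : ℝ) := by
    push_cast
    linear_combination ((v : ℝ) : ℂ) * t ^ 2 / 2 * Complex.I_sq
  simp_rw [e]
  exact integrable_cexp_quadratic' (by rw [Complex.ofReal_re]; linarith) _ _

/-- Gaussian smoothing of a function on the half line, expressed through its Laplace transform. -/
theorem setIntegral_mul_gaussianPDFReal (hv : v ≠ 0) {k : ℝ → ℂ} {σ : ℝ}
    (hk : IntegrableOn (fun u : ℝ => k u * Complex.exp (-(σ * u))) (Ioi 0)) (L : ℝ) :
    ∫ u in Ioi (0 : ℝ), k u * gaussianPDFReal 0 v (u - L) = (2 * Real.pi : ℂ)⁻¹ * ∫ t : ℝ,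
      Complex.exp (v * (σ + t * Complex.I) ^ 2 / 2 + (σ + t * Complex.I) * L) *
        ∫ u in Ioi (0 : ℝ), k u * Complex.exp (-((σ + t * Complex.I) * u)) := by
  have hint : Integrable (Function.uncurry fun (u t : ℝ) =>
      k u * Complex.exp (-((σ + t * Complex.I) * u)) *
      Complex.exp (v * (σ + t * Complex.I) ^ 2 / 2 + (σ + t * Complex.I) * L))
      ((volume.restrict (Ioi 0)).prod volume) := by
    have h := Integrable.mul_prod hk (integrable_cexp_gaussian hv σ L)
    have h2 : Continuous fun p : ℝ × ℝ => Complex.exp (-(p.2 * p.1 : ℝ) * Complex.I) := by fun_prop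
    have h3 : AEStronglyMeasurable (Function.uncurry fun (u t : ℝ) =>
      k u * Complex.exp (-((σ + t * Complex.I) * u)) *
      Complex.exp (v * (σ + t * Complex.I) ^ 2 / 2 + (σ + t * Complex.I) * L))
      ((volume.restrict (Ioi 0)).prod volume) := by
      refine (h.aestronglyMeasurable.mul h2.aestronglyMeasurable).congr (ae_of_all _ fun p => ?_)
      obtain ⟨u, t⟩ := p
      simp only [Function.uncurry, Pi.mul_apply]
      rw [show -((σ + t * Complex.I) * u : ℂ) = -(σ * u) + -(t * u : ℝ) * Complex.I by
        push_cast; ring, Complex.exp_add (-(σ * u : ℂ))]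
      ring
    refine h.mono h3 (ae_of_all _ fun p => le_of_eq ?_)
    obtain ⟨u, t⟩ := p
    simp only [Function.uncurry, norm_mul, Complex.norm_exp]
    congr 3
    simp
  calc _ = ∫ u in Ioi (0 : ℝ), (2 * Real.pi : ℂ)⁻¹ * ∫ t : ℝ,
        k u * Complex.exp (-((σ + t * Complex.I) * u)) *
        Complex.exp (v * (σ + t * Complex.I) ^ 2 / 2 + (σ + t * Complex.I) * L) := by
        refine integral_congr_ae (ae_of_all _ fun u => ?_)
        simp only
        rw [gaussianPDFReal_eq_integral hv σ, mul_left_comm, ← integral_const_mul]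
        congr 1
        refine integral_congr_ae (ae_of_all _ fun t => ?_)
        simp only
        rw [mul_assoc, ← Complex.exp_add]
        congr 2
        push_cast
        ring
    _ = _ := by
        rw [integral_const_mul, integral_integral_swap hint]
        congr 1
        refine integral_congr_ae (ae_of_all _ fun t => ?_)
        simp only
        rw [integral_mul_const, mul_comm]

theorem integral_indicator_gaussianReal (hv : v ≠ 0) (k : ℝ → ℂ) (L : ℝ) :
    ∫ z, (Ioi 0).indicator k (L + z) ∂gaussianReal 0 v =
      ∫ u in Ioi (0 : ℝ), k u * gaussianPDFReal 0 v (u - L) := by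
  rw [integral_gaussianReal_eq_integral_smul hv,
    ← integral_sub_right_eq_self _ L, ← integral_indicator measurableSet_Ioi]
  refine integral_congr_ae (ae_of_all _ fun u => ?_)
  simp only [indicator]
  rw [add_sub_cancel]
  split_ifs
  · rw [Complex.real_smul, mul_comm]
  · simp

end Smoothing

section ContourShift

open scoped NNReal

theorem integrable_vertical_of_gaussian_bound {G : ℂ → ℂ} {a b c C : ℝ} (hc : 0 < c)
    (hG : ContinuousOn G (Complex.re ⁻¹' Icc a b))
    (hb : ∀ s : ℂ, s.re ∈ Icc a b → ‖G s‖ ≤ C * Real.exp (-c * s.im ^ 2)) {σ : ℝ}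
    (hσ : σ ∈ Icc a b) : Integrable fun t : ℝ => G (σ + t * Complex.I) := by
  refine ((integrable_exp_neg_mul_sq hc).const_mul C).mono' ?_ (ae_of_all _ fun t => ?_)
  · refine (hG.comp_continuous (by fun_prop) fun t => ?_).aestronglyMeasurable
    simpa using hσ
  · simpa using hb (σ + t * Complex.I) (by simpa using hσ)

/-- Shifting a vertical line of integration under Gaussian decay. -/
theorem integral_vertical_eq_of_gaussian_bound {G : ℂ → ℂ} {a b c C : ℝ} (hab : a ≤ b) (hc : 0 < c)
    (hG : DifferentiableOn ℂ G (Complex.re ⁻¹' Icc a b))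
    (hb : ∀ s : ℂ, s.re ∈ Icc a b → ‖G s‖ ≤ C * Real.exp (-c * s.im ^ 2)) :
    ∫ t : ℝ, G (b + t * Complex.I) = ∫ t : ℝ, G (a + t * Complex.I) := by
  have hint {σ : ℝ} (hσ : σ ∈ Icc a b) :
      Tendsto (fun T : ℝ => ∫ t in (-T)..T, G (σ + t * Complex.I)) atTop
        (nhds (∫ t : ℝ, G (σ + t * Complex.I))) :=
    intervalIntegral_tendsto_integral
      (integrable_vertical_of_gaussian_bound hc hG.continuousOn hb hσ)
      tendsto_neg_atTop_atBot tendsto_id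
  have hzero : Tendsto (fun T : ℝ => C * Real.exp (-c * T ^ 2) * |b - a|) atTop (nhds 0) := by
    have h1 : Tendsto (fun T : ℝ => -c * T ^ 2) atTop atBot :=
      (tendsto_pow_atTop two_ne_zero).const_mul_atTop_of_neg (by linarith)
    simpa using ((Real.tendsto_exp_atBot.comp h1).const_mul C).mul_const |b - a|
  have hhor (y : ℝ) : ‖∫ x in a..b, G (x + y * Complex.I)‖ ≤
      C * Real.exp (-c * y ^ 2) * |b - a| := by
    refine intervalIntegral.norm_integral_le_of_norm_le_const fun x hx => ?_
    rw [uIoc_of_le hab] at hx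
    simpa using hb (x + y * Complex.I) (by simpa using ⟨hx.1.le, hx.2⟩)
  have hup : Tendsto (fun T : ℝ => ∫ x in a..b, G (x + T * Complex.I)) atTop (nhds 0) :=
    squeeze_zero_norm (fun T => hhor T) hzero
  have hdown : Tendsto (fun T : ℝ => ∫ x in a..b, G (x + (-T : ℝ) * Complex.I)) atTop (nhds 0) :=
    squeeze_zero_norm (fun T => by simpa using hhor (-T)) hzero
  have hrect (T : ℝ) : (∫ x in a..b, G (x + (-T : ℝ) * Complex.I)) -
      (∫ x in a..b, G (x + T * Complex.I)) +
      Complex.I • (∫ t in (-T)..T, G (b + t * Complex.I)) -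
      Complex.I • (∫ t in (-T)..T, G (a + t * Complex.I)) = 0 := by
    have h := Complex.integral_boundary_rect_eq_zero_of_differentiableOn G
      (a + (-T : ℝ) * Complex.I) (b + T * Complex.I) (hG.mono fun s hs => by
        rw [Complex.mem_reProdIm] at hs
        simpa [uIcc_of_le hab] using hs.1)
    simpa using h
  have hlim := ((hdown.sub hup).add ((hint (right_mem_Icc.2 hab)).const_smul Complex.I)).sub
    ((hint (left_mem_Icc.2 hab)).const_smul Complex.I)
  simp_rw [hrect] at hlim
  have h0 := tendsto_nhds_unique hlim tendsto_const_nhds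
  rw [sub_zero, zero_add, ← smul_sub, smul_eq_zero] at h0
  exact sub_eq_zero.1 (h0.resolve_left Complex.I_ne_zero)

theorem one_add_abs_rpow_mul_exp_le {b : ℝ} (hb : 0 ≤ b) (u : ℝ) :
    (1 + |u|) ^ b * Real.exp (-u ^ 2 / 2) ≤ Real.exp (b ^ 2) * Real.exp (-(1 / 4) * u ^ 2) := by
  have h1 : 0 < 1 + |u| := by positivity
  rw [Real.rpow_def_of_pos h1, ← Real.exp_add, ← Real.exp_add, Real.exp_le_exp]
  have h2 : Real.log (1 + |u|) ≤ |u| := by linarith [Real.log_le_sub_one_of_pos h1]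
  nlinarith [mul_le_mul_of_nonneg_right h2 hb, sq_nonneg (b - |u| / 2), sq_abs u]

theorem integrable_one_add_abs_rpow_mul_exp {b : ℝ} (hb : 0 ≤ b) :
    Integrable fun u : ℝ => (1 + |u|) ^ b * Real.exp (-u ^ 2 / 2) := by
  refine ((integrable_exp_neg_mul_sq (by norm_num : (0 : ℝ) < 1 / 4)).const_mul
    (Real.exp (b ^ 2))).mono' ?_ (ae_of_all _ fun u => ?_)
  · refine Continuous.aestronglyMeasurable ?_
    exact (Continuous.rpow_const (by fun_prop) fun u => Or.inr hb).mul (by fun_prop)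
  · rw [Real.norm_of_nonneg (by positivity)]
    exact one_add_abs_rpow_mul_exp_le hb u

/-- The moment `∫ (1 + |t|) ^ b exp (-η² t² / 2) dt` is `O(η ^ (-b - 1))`. -/
theorem integral_one_add_abs_rpow_mul_exp_le {b η : ℝ} (hb : 0 ≤ b) (hη : 0 < η) (hη1 : η ≤ 1) :
    (Integrable fun t : ℝ => (1 + |t|) ^ b * Real.exp (-(η * t) ^ 2 / 2)) ∧
    ∫ t : ℝ, (1 + |t|) ^ b * Real.exp (-(η * t) ^ 2 / 2) ≤
      η ^ (-(b + 1)) * ∫ u : ℝ, (1 + |u|) ^ b * Real.exp (-u ^ 2 / 2) := by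
  have hle (t : ℝ) : (1 + |t|) ^ b * Real.exp (-(η * t) ^ 2 / 2) ≤
      η ^ (-b) * ((1 + |η * t|) ^ b * Real.exp (-(η * t) ^ 2 / 2)) := by
    rw [← mul_assoc]
    refine mul_le_mul_of_nonneg_right ?_ (Real.exp_pos _).le
    rw [Real.rpow_neg hη.le, ← Real.inv_rpow hη.le, ← Real.mul_rpow (by positivity) (by positivity)]
    refine Real.rpow_le_rpow (by positivity) ?_ hb
    rw [abs_mul, abs_of_pos hη, mul_add, mul_one, inv_mul_cancel_left₀ hη.ne']
    linarith [one_le_inv₀ hη |>.2 hη1]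
  have hint := ((integrable_one_add_abs_rpow_mul_exp hb).comp_mul_left' hη.ne').const_mul (η ^ (-b))
  have hint2 : Integrable fun t : ℝ => (1 + |t|) ^ b * Real.exp (-(η * t) ^ 2 / 2) := by
    refine hint.mono' (Continuous.aestronglyMeasurable ?_) (ae_of_all _ fun t => ?_)
    · exact (Continuous.rpow_const (by fun_prop) fun u => Or.inr hb).mul (by fun_prop)
    · rw [Real.norm_of_nonneg (by positivity)]
      exact hle t
  refine ⟨hint2, (integral_mono hint2 hint hle).trans (le_of_eq ?_)⟩
  rw [integral_const_mul, Measure.integral_comp_mul_left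
    (fun u => (1 + |u|) ^ b * Real.exp (-u ^ 2 / 2)) η, abs_of_pos (inv_pos.2 hη), smul_eq_mul,
    ← mul_assoc, neg_add, Real.rpow_add hη, Real.rpow_neg_one]

theorem norm_cexp_gaussian (v σ t L : ℝ) :
    ‖Complex.exp (v * (σ + t * Complex.I) ^ 2 / 2 + (σ + t * Complex.I) * L)‖ =
      Real.exp (v * σ ^ 2 / 2 + σ * L) * Real.exp (-(v * t ^ 2) / 2) := by
  rw [Complex.norm_exp, ← Real.exp_add]
  congr 1
  rw [show (v * (σ + t * Complex.I) ^ 2 / 2 + (σ + t * Complex.I) * L : ℂ) =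
    ((v * (σ ^ 2 - t ^ 2) / 2 + σ * L : ℝ) : ℂ) + ((v * σ * t + t * L : ℝ) : ℂ) * Complex.I by
      push_cast
      linear_combination (v * t ^ 2 / 2 : ℂ) * Complex.I_sq,
    Complex.add_re, Complex.ofReal_re, Complex.re_ofReal_mul, Complex.I_re]
  ring

theorem norm_integral_gaussian_mul_dslope_le {P : ℂ → ℂ} (hP : Differentiable ℂ P)
    (hPg : StripGrowth P) {δ e C : ℝ} (hδ : 0 < δ) (hδ' : δ ≤ 1 / 4) (he : 2 ≤ e)
    (hPb : ∀ t : ℝ, ‖P (-δ + t * Complex.I)‖ ≤ C * (1 + |t|) ^ e) :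
    ∃ C₀ : ℝ, 0 ≤ C₀ ∧ ∀ η : ℝ, 0 < η → η ≤ 1 → ∀ L : ℝ,
      ‖∫ t : ℝ, Complex.exp ((η ^ 2 : ℝ) * ((2 + δ : ℝ) + t * Complex.I) ^ 2 / 2 +
          ((2 + δ : ℝ) + t * Complex.I) * L) *
        (dslope P 0 ((2 + δ : ℝ) + t * Complex.I - 1) / ((2 + δ : ℝ) + t * Complex.I))‖ ≤
      C₀ * Real.exp ((1 - δ) * L) * η ^ (-(e - 1)) := by
  obtain ⟨Cd, A, hCd, hA, hdb⟩ := hPg.dslope hP 0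
  have hdd := hP.dslope 0
  set b := e - 2 with hbdef
  have hb : 0 ≤ b := by linarith
  set J := ∫ u : ℝ, (1 + |u|) ^ b * Real.exp (-u ^ 2 / 2) with hJ
  have hJ0 : 0 ≤ J := integral_nonneg fun u => by positivity
  have hC : 0 ≤ C := by
    have := (norm_nonneg _).trans (hPb 0)
    simpa using this
  set D := 8 * (C + ‖P 0‖) / δ with hD
  have hD0 : 0 ≤ D := by positivity
  -- pointwise bound on the left line
  have hline (t : ℝ) : ‖dslope P 0 (((1 - δ : ℝ) : ℂ) + t * Complex.I - 1) /
      (((1 - δ : ℝ) : ℂ) + t * Complex.I)‖ ≤ D * (1 + |t|) ^ b := by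
    have hs : ((1 - δ : ℝ) : ℂ) + t * Complex.I - 1 = -δ + t * Complex.I := by push_cast; ring
    rw [hs]
    have hne : (-δ + t * Complex.I : ℂ) ≠ 0 := by
      intro h
      have := congrArg Complex.re h
      simp at this
      linarith
    have h1t : 0 < 1 + |t| := by positivity
    have hn1 : δ * (1 + |t|) / 2 ≤ ‖(-δ + t * Complex.I : ℂ)‖ := by
      have h1 := Complex.abs_re_le_norm (-δ + t * Complex.I : ℂ)
      have h2 := Complex.abs_im_le_norm (-δ + t * Complex.I : ℂ)
      simp only [Complex.add_re, Complex.neg_re, Complex.ofReal_re, Complex.mul_re, Complex.I_re,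
        mul_zero, Complex.ofReal_im, Complex.I_im, mul_one, sub_self, add_zero, abs_neg,
        Complex.add_im, Complex.neg_im, neg_zero, Complex.mul_im, zero_add, abs_of_pos hδ] at h1 h2
      nlinarith [abs_nonneg t]
    have hn2 : (1 + |t|) / 4 ≤ ‖(((1 - δ : ℝ) : ℂ) + t * Complex.I)‖ := by
      have h1 := Complex.abs_re_le_norm (((1 - δ : ℝ) : ℂ) + t * Complex.I)
      have h2 := Complex.abs_im_le_norm (((1 - δ : ℝ) : ℂ) + t * Complex.I)
      simp only [Complex.add_re, Complex.ofReal_re, Complex.mul_re, Complex.I_re,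
        mul_zero, Complex.ofReal_im, Complex.I_im, mul_one, sub_self, add_zero,
        Complex.add_im, Complex.mul_im, zero_add, abs_of_pos (by linarith : 0 < 1 - δ)] at h1 h2
      linarith
    have hnum : ‖P (-δ + t * Complex.I) - P 0‖ ≤ (C + ‖P 0‖) * (1 + |t|) ^ e := by
      have : (1 : ℝ) ≤ (1 + |t|) ^ e :=
        Real.one_le_rpow (by linarith [abs_nonneg t]) (by linarith)
      nlinarith [norm_sub_le (P (-δ + t * Complex.I)) (P 0), hPb t, norm_nonneg (P 0)]
    rw [dslope_of_ne _ hne, slope_def_field, sub_zero, norm_div, norm_div, div_div]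
    have hden : δ * (1 + |t|) ^ 2 / 8 ≤ ‖(-δ + t * Complex.I : ℂ)‖ *
        ‖(((1 - δ : ℝ) : ℂ) + t * Complex.I)‖ := by
      have := mul_le_mul hn1 hn2 (by positivity) (norm_nonneg _)
      nlinarith
    refine (div_le_div₀ (by positivity) hnum (by positivity) hden).trans (le_of_eq ?_)
    rw [hD, hbdef, Real.rpow_sub h1t, Real.rpow_two]
    field_simp
  refine ⟨Real.exp 1 * D * J, by positivity, fun η hη hη1 L => ?_⟩
  have hη2 : 0 < η ^ 2 := by positivity
  set G : ℂ → ℂ := fun s => Complex.exp ((η ^ 2 : ℝ) * s ^ 2 / 2 + s * L) *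
    (dslope P 0 (s - 1) / s) with hG
  have hshift : ∫ t : ℝ, G ((2 + δ : ℝ) + t * Complex.I) =
      ∫ t : ℝ, G ((1 - δ : ℝ) + t * Complex.I) := by
    refine integral_vertical_eq_of_gaussian_bound (c := η ^ 2 / 4)
      (C := Real.exp (η ^ 2 * 9 + 3 * |L|) * (2 * Cd * Real.exp (A ^ 2 / η ^ 2)))
      (by linarith) (by positivity) ?_ fun s hs => ?_
    · refine DifferentiableOn.mul (by fun_prop) (DifferentiableOn.div ?_ (by fun_prop) ?_)
      · exact (hdd.comp (by fun_prop : Differentiable ℂ fun s : ℂ => s - 1)).differentiableOn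
      · rintro s hs rfl
        simp only [mem_preimage, Complex.zero_re, mem_Icc] at hs
        linarith [hs.1]
    · obtain ⟨h1, h2⟩ := hs
      have hse : s = (s.re : ℂ) + s.im * Complex.I := (Complex.re_add_im s).symm
      have hexp : ‖Complex.exp ((η ^ 2 : ℝ) * s ^ 2 / 2 + s * L)‖ ≤
          Real.exp (η ^ 2 * 9 + 3 * |L|) * Real.exp (-(η ^ 2 * s.im ^ 2) / 2) := by
        conv_lhs => rw [hse]
        rw [norm_cexp_gaussian]
        refine mul_le_mul_of_nonneg_right ?_ (Real.exp_pos _).le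
        rw [Real.exp_le_exp]
        have h3 : s.re ^ 2 ≤ 9 := by nlinarith
        have h4 : s.re * L ≤ 3 * |L| := by nlinarith [le_abs_self L, abs_nonneg L]
        nlinarith
      have hds : ‖dslope P 0 (s - 1)‖ ≤ Cd * Real.exp (A * |s.im|) := by
        have := hdb (s - 1) (by simp only [Complex.sub_re, Complex.one_re, mem_Icc]; constructor <;> linarith)
        simpa using this
      have hsn : 1 / 2 ≤ ‖s‖ := by linarith [Complex.re_le_norm s]
      rw [hG, norm_mul, norm_div]
      have hq : ‖dslope P 0 (s - 1)‖ / ‖s‖ ≤ 2 * Cd * Real.exp (A * |s.im|) := by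
        rw [div_le_iff₀ (by linarith)]
        nlinarith [mul_nonneg hCd (Real.exp_pos (A * |s.im|)).le]
      refine (mul_le_mul hexp hq (by positivity) (by positivity)).trans ?_
      have hkey : Real.exp (-(η ^ 2 * s.im ^ 2) / 2) * Real.exp (A * |s.im|) ≤
          Real.exp (A ^ 2 / η ^ 2) * Real.exp (-(η ^ 2 / 4) * s.im ^ 2) := by
        rw [← Real.exp_add, ← Real.exp_add, Real.exp_le_exp]
        have h5 : A * |s.im| ≤ A ^ 2 / η ^ 2 + η ^ 2 / 4 * s.im ^ 2 := by
          have h6 : A ^ 2 / η ^ 2 + η ^ 2 / 4 * s.im ^ 2 - A * |s.im| =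
              (A / η - η / 2 * |s.im|) ^ 2 := by
            rw [← sq_abs s.im]
            field_simp
            ring
          nlinarith [sq_nonneg (A / η - η / 2 * |s.im|)]
        linarith
      have h7 : 0 ≤ Real.exp (η ^ 2 * 9 + 3 * |L|) * (2 * Cd) := by positivity
      linarith [mul_le_mul_of_nonneg_left hkey h7]
  obtain ⟨hmi, hml⟩ := integral_one_add_abs_rpow_mul_exp_le hb hη hη1
  change ‖∫ t : ℝ, G ((2 + δ : ℝ) + t * Complex.I)‖ ≤ _
  rw [hshift]
  have hpt (t : ℝ) : ‖G ((1 - δ : ℝ) + t * Complex.I)‖ ≤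
      Real.exp 1 * D * Real.exp ((1 - δ) * L) * ((1 + |t|) ^ b * Real.exp (-(η * t) ^ 2 / 2)) := by
    rw [hG, norm_mul, norm_cexp_gaussian]
    have h1 : Real.exp (η ^ 2 * (1 - δ) ^ 2 / 2 + (1 - δ) * L) ≤
        Real.exp 1 * Real.exp ((1 - δ) * L) := by
      rw [← Real.exp_add, Real.exp_le_exp]
      have h2 : η ^ 2 ≤ 1 := by nlinarith
      have h3 : (1 - δ) ^ 2 ≤ 1 := by nlinarith
      nlinarith [mul_le_mul h2 h3 (sq_nonneg _) zero_le_one]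
    rw [mul_pow]
    refine (mul_le_mul (mul_le_mul_of_nonneg_right h1 (Real.exp_pos _).le) (hline t)
      (norm_nonneg _) (by positivity)).trans (le_of_eq ?_)
    ring
  refine (norm_integral_le_of_norm_le (hmi.const_mul _) (ae_of_all _ hpt)).trans ?_
  rw [integral_const_mul]
  refine (mul_le_mul_of_nonneg_left hml (by positivity)).trans (le_of_eq ?_)
  rw [← hJ, show b + 1 = e - 1 by rw [hbdef]; ring]
  ring

end ContourShift

section RieszMean

open ProbabilityTheory
open scoped NNReal

/-- The first Riesz mean `∑_{m ≤ x} r m (x - m)`. -/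
noncomputable def rieszMean (r : ℕ → ℝ) (x : ℝ) : ℝ := ∑ m ∈ Finset.Icc 1 ⌊x⌋₊, r m * (x - m)

variable {r : ℕ → ℝ}

theorem rieszMean_eq_sum_max {x : ℝ} {N : ℕ} (hN : x ≤ N) :
    rieszMean r x = ∑ m ∈ Finset.Icc 1 N, r m * max (x - m) 0 := by
  have hsub : Finset.Icc 1 ⌊x⌋₊ ⊆ Finset.Icc 1 N :=
    Finset.Icc_subset_Icc_right (by simpa using Nat.floor_le_floor hN)
  rw [rieszMean, ← Finset.sum_subset hsub]
  · refine Finset.sum_congr rfl fun m hm => ?_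
    rw [Finset.mem_Icc] at hm
    have h1 := (Nat.le_floor_iff' (by lia)).1 hm.2
    rw [max_eq_left (by linarith)]
  · intro m hm hm'
    rw [Finset.mem_Icc] at hm hm'
    have h1 : x < m := (Nat.floor_lt' (by lia)).1 (by lia)
    rw [max_eq_right (by linarith), mul_zero]

theorem hasSum_rieszMean (h0 : r 0 = 0) (x : ℝ) :
    HasSum (fun m : ℕ => r m * max (x - m) 0) (rieszMean r x) := by
  obtain ⟨N, hN⟩ := exists_nat_ge x
  rw [rieszMean_eq_sum_max hN]
  refine hasSum_sum_of_ne_finset_zero fun m hm => ?_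
  rcases Nat.eq_zero_or_pos m with rfl | h
  · rw [h0, zero_mul]
  · have h1 : N < m := by
      rw [Finset.mem_Icc] at hm
      lia
    have h2 : (N : ℝ) < m := by exact_mod_cast h1
    rw [max_eq_right (by linarith), mul_zero]

theorem rieszMean_nonneg (hr : ∀ m, 0 ≤ r m) (x : ℝ) : 0 ≤ rieszMean r x := by
  obtain ⟨N, hN⟩ := exists_nat_ge x
  rw [rieszMean_eq_sum_max hN]
  exact Finset.sum_nonneg fun m _ => mul_nonneg (hr m) (le_max_right _ _)

theorem rieszMean_mono (hr : ∀ m, 0 ≤ r m) : Monotone (rieszMean r) := by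
  intro x y hxy
  obtain ⟨N, hN⟩ := exists_nat_ge y
  rw [rieszMean_eq_sum_max hN, rieszMean_eq_sum_max (hxy.trans hN)]
  gcongr with m _
  exact hr m

theorem rieszMean_of_le_one {x : ℝ} (hx : x ≤ 1) : rieszMean r x = 0 := by
  rw [rieszMean_eq_sum_max (N := 1) (by simpa using hx)]
  simp [hx]

theorem two_mul_rieszMean_le (hr : ∀ m, 0 ≤ r m) (x y : ℝ) :
    2 * rieszMean r y ≤ rieszMean r x + rieszMean r (2 * y - x) := by
  obtain ⟨N, hN⟩ := exists_nat_ge (max y (max x (2 * y - x)))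
  simp only [max_le_iff] at hN
  rw [rieszMean_eq_sum_max hN.1, rieszMean_eq_sum_max hN.2.1, rieszMean_eq_sum_max hN.2.2,
    Finset.mul_sum, ← Finset.sum_add_distrib]
  refine Finset.sum_le_sum fun m _ => ?_
  rw [← mul_add, mul_left_comm]
  refine mul_le_mul_of_nonneg_left ?_ (hr m)
  rcases max_cases (y - m) 0 with ⟨h, -⟩ | ⟨h, -⟩ <;> rw [h]
  · linarith [le_max_left (x - m) 0, le_max_left (2 * y - x - m) 0]
  · linarith [le_max_right (x - m) 0, le_max_right (2 * y - x - m) 0]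

/-- The subgradient inequality for the convex function `rieszMean r`. -/
theorem rieszMean_add_mul_le (hr : ∀ m, 0 ≤ r m) (x y : ℝ) :
    rieszMean r x + (∑ m ∈ Finset.Icc 1 ⌊x⌋₊, r m) * (y - x) ≤ rieszMean r y := by
  obtain ⟨N, hN⟩ := exists_nat_ge (max x y)
  rw [max_le_iff] at hN
  rw [rieszMean_eq_sum_max hN.2, rieszMean, Finset.sum_mul, ← Finset.sum_add_distrib]
  have hsub : Finset.Icc 1 ⌊x⌋₊ ⊆ Finset.Icc 1 N :=
    Finset.Icc_subset_Icc_right (by simpa using Nat.floor_le_floor hN.1)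
  refine (Finset.sum_le_sum fun m _ => ?_).trans
    (Finset.sum_le_sum_of_subset_of_nonneg hsub fun m _ _ => mul_nonneg (hr m) (le_max_right _ _))
  rw [← mul_add]
  exact mul_le_mul_of_nonneg_left (by linarith [le_max_left (y - m) 0]) (hr m)

theorem rieszMean_le_rpow (hr : ∀ m, 0 ≤ r m) {σ : ℝ} (hσ : 0 ≤ σ)
    (hs : Summable fun m : ℕ => r m * (m : ℝ) ^ (-σ)) {x : ℝ} (hx : 0 < x) :
    rieszMean r x ≤ (∑' m : ℕ, r m * (m : ℝ) ^ (-σ)) * x ^ (1 + σ) := by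
  have h1 : rieszMean r x ≤ ∑ m ∈ Finset.Icc 1 ⌊x⌋₊, (r m * (m : ℝ) ^ (-σ)) * x ^ (1 + σ) := by
    refine Finset.sum_le_sum fun m hm => ?_
    rw [Finset.mem_Icc] at hm
    have hm0 : (0 : ℝ) < m := by exact_mod_cast hm.1
    have hmx := (Nat.le_floor_iff' (by lia)).1 hm.2
    rw [mul_assoc]
    refine mul_le_mul_of_nonneg_left ?_ (hr m)
    have h2 : 1 ≤ (m : ℝ) ^ (-σ) * x ^ σ := by
      rw [Real.rpow_neg hm0.le, ← div_eq_inv_mul, one_le_div (by positivity)]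
      exact Real.rpow_le_rpow hm0.le hmx hσ
    rw [Real.rpow_add hx, Real.rpow_one]
    nlinarith
  refine h1.trans ?_
  rw [← Finset.sum_mul]
  exact mul_le_mul_of_nonneg_right
    (hs.sum_le_tsum _ fun m _ => mul_nonneg (hr m) (by positivity)) (by positivity)

theorem norm_exp_neg_mul (s : ℂ) (u : ℝ) : ‖Complex.exp (-(s * u))‖ = Real.exp (-(s.re * u)) := by
  rw [Complex.norm_exp, Complex.neg_re, Complex.re_mul_ofReal]

/-- Laplace transform of `u ↦ (exp u - m)₊`. -/
theorem laplace_max_exp_sub {m : ℕ} (hm : 1 ≤ m) {s : ℂ} (hs : 1 < s.re) :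
    IntegrableOn (fun u : ℝ => ((max (Real.exp u - m) 0 : ℝ) : ℂ) * Complex.exp (-(s * u)))
      (Ioi 0) ∧
    ∫ u in Ioi (0 : ℝ), ((max (Real.exp u - m) 0 : ℝ) : ℂ) * Complex.exp (-(s * u)) =
      (m : ℂ) ^ (-(s - 1)) / ((s - 1) * s) := by
  have hm0 : (0 : ℝ) < m := by exact_mod_cast hm
  have hlog : 0 ≤ Real.log m := Real.log_nonneg (by exact_mod_cast hm)
  have hsub : Ioi (Real.log m) ⊆ Ioi (0 : ℝ) := Ioi_subset_Ioi hlog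
  have hvan : ∀ u ∈ Ioi (0 : ℝ) \ Ioi (Real.log m),
      ((max (Real.exp u - m) 0 : ℝ) : ℂ) * Complex.exp (-(s * u)) = 0 := by
    rintro u ⟨-, hu⟩
    have h1 : Real.exp u ≤ m := by
      rw [← Real.exp_log hm0, Real.exp_le_exp]
      exact not_lt.1 hu
    rw [max_eq_right (by linarith), Complex.ofReal_zero, zero_mul]
  have hon : EqOn (fun u : ℝ => ((max (Real.exp u - m) 0 : ℝ) : ℂ) * Complex.exp (-(s * u)))
      (fun u : ℝ => Complex.exp ((1 - s) * u) - m * Complex.exp (-s * u)) (Ioi (Real.log m)) := by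
    intro u hu
    have h1 : (m : ℝ) ≤ Real.exp u := by
      rw [← Real.exp_log hm0, Real.exp_le_exp]
      exact (mem_Ioi.1 hu).le
    simp only
    rw [max_eq_left (by linarith), show (1 - s) * (u : ℂ) = u + -(s * u) by ring, Complex.exp_add]
    push_cast
    rw [neg_mul]
    ring
  have hr1 : (1 - s).re < 0 := by simp; linarith
  have hr2 : (-s).re < 0 := by simp; linarith
  have hi1 := integrableOn_exp_mul_complex_Ioi hr1 (Real.log m)
  have hi2 := (integrableOn_exp_mul_complex_Ioi hr2 (Real.log m)).const_mul (m : ℂ)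
  constructor
  · refine IntegrableOn.of_forall_sdiff_eq_zero ?_ measurableSet_Ioi hvan
    exact (hi1.sub hi2).congr_fun hon.symm measurableSet_Ioi
  · rw [setIntegral_eq_of_subset_of_forall_sdiff_eq_zero measurableSet_Ioi hsub hvan,
      setIntegral_congr_fun measurableSet_Ioi hon, integral_sub hi1 hi2, integral_const_mul,
      integral_exp_mul_complex_Ioi hr1, integral_exp_mul_complex_Ioi hr2]
    have hmC : (m : ℂ) ≠ 0 := by exact_mod_cast hm0.ne'
    have hlogC : ((Real.log m : ℝ) : ℂ) = Complex.log m := by rw [Complex.natCast_log]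
    have hs0 : s ≠ 0 := by rintro rfl; simp at hs; linarith
    have hs1 : s - 1 ≠ 0 := by
      intro h
      rw [sub_eq_zero] at h
      rw [h] at hs
      simp at hs
    have hs1' : 1 - s ≠ 0 := by rwa [← neg_ne_zero, neg_sub]
    rw [Complex.cpow_def_of_ne_zero hmC, hlogC,
      show (1 - s) * Complex.log m = Complex.log m * (-(s - 1)) by ring,
      show -s * Complex.log m = Complex.log m * (-(s - 1)) - Complex.log m by ring,
      Complex.exp_sub, Complex.exp_log hmC]
    field_simp
    ring

/-- Laplace transform of `u ↦ exp u - 1`. -/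
theorem laplace_exp_sub_one {s : ℂ} (hs : 1 < s.re) :
    IntegrableOn (fun u : ℝ => ((Real.exp u - 1 : ℝ) : ℂ) * Complex.exp (-(s * u))) (Ioi 0) ∧
    ∫ u in Ioi (0 : ℝ), ((Real.exp u - 1 : ℝ) : ℂ) * Complex.exp (-(s * u)) =
      1 / ((s - 1) * s) := by
  have h := laplace_max_exp_sub (le_refl 1) hs
  have hon : EqOn (fun u : ℝ => ((max (Real.exp u - (1 : ℕ)) 0 : ℝ) : ℂ) * Complex.exp (-(s * u)))
      (fun u : ℝ => ((Real.exp u - 1 : ℝ) : ℂ) * Complex.exp (-(s * u))) (Ioi 0) := by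
    intro u hu
    simp only
    rw [Nat.cast_one, max_eq_left (by linarith [Real.one_le_exp (mem_Ioi.1 hu).le])]
  rw [setIntegral_congr_fun measurableSet_Ioi hon] at h
  simpa using And.intro (h.1.congr_fun hon measurableSet_Ioi) h.2

/-- Laplace transform of `u ↦ (exp u - 1) ^ 2 / 2`. -/
theorem laplace_exp_sub_one_sq {s : ℂ} (hs : 2 < s.re) :
    IntegrableOn (fun u : ℝ => (((Real.exp u - 1) ^ 2 / 2 : ℝ) : ℂ) * Complex.exp (-(s * u)))
      (Ioi 0) ∧
    ∫ u in Ioi (0 : ℝ), (((Real.exp u - 1) ^ 2 / 2 : ℝ) : ℂ) * Complex.exp (-(s * u)) =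
      1 / ((s - 2) * (s - 1) * s) := by
  have hr0 : (2 - s).re < 0 := by simp; linarith
  have hi0 := (integrableOn_exp_mul_complex_Ioi hr0 0).const_mul (1 / 2 : ℂ)
  have hr1 : (1 - s).re < 0 := by simp; linarith
  have hr2 : (-s).re < 0 := by simp; linarith
  have hi1 := integrableOn_exp_mul_complex_Ioi hr1 0
  have hi2 := (integrableOn_exp_mul_complex_Ioi hr2 0).const_mul (1 / 2 : ℂ)
  have e (u : ℝ) : (((Real.exp u - 1) ^ 2 / 2 : ℝ) : ℂ) * Complex.exp (-(s * u)) =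
      1 / 2 * Complex.exp ((2 - s) * u) - Complex.exp ((1 - s) * u) +
        1 / 2 * Complex.exp (-s * u) := by
    rw [show (1 - s) * (u : ℂ) = u + -(s * u) by ring,
      show (2 - s) * (u : ℂ) = u + u + -(s * u) by ring, Complex.exp_add, Complex.exp_add,
      Complex.exp_add]
    push_cast
    rw [neg_mul]
    ring
  simp_rw [e]
  have hi01 : IntegrableOn (fun u : ℝ => 1 / 2 * Complex.exp ((2 - s) * u) -
    Complex.exp ((1 - s) * u)) (Ioi 0) := hi0.sub hi1
  refine ⟨hi01.add hi2, ?_⟩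
  rw [integral_add hi01 hi2, integral_sub hi0 hi1, integral_const_mul, integral_const_mul,
    integral_exp_mul_complex_Ioi hr0, integral_exp_mul_complex_Ioi hr1,
    integral_exp_mul_complex_Ioi hr2]
  have hs0 : s ≠ 0 := by rintro rfl; simp at hs; linarith
  have hs1 : s - 1 ≠ 0 := by
    intro h
    rw [sub_eq_zero] at h
    rw [h] at hs
    simp at hs
  have hs2 : s - 2 ≠ 0 := by
    intro h
    rw [sub_eq_zero] at h
    rw [h] at hs
    simp at hs
  have hs1' : 1 - s ≠ 0 := by rwa [← neg_ne_zero, neg_sub]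
  have hs2' : 2 - s ≠ 0 := by rwa [← neg_ne_zero, neg_sub]
  simp only [Complex.ofReal_zero, mul_zero, Complex.exp_zero]
  field_simp
  ring

theorem norm_laplace_max_exp_sub {m : ℕ} (hm : 1 ≤ m) {s : ℂ} (hs : 1 < s.re) :
    ∫ u in Ioi (0 : ℝ), ‖((max (Real.exp u - m) 0 : ℝ) : ℂ) * Complex.exp (-(s * u))‖ =
      (m : ℝ) ^ (-(s.re - 1)) / ((s.re - 1) * s.re) := by
  have h := (laplace_max_exp_sub hm (s := (s.re : ℂ)) (by simpa using hs)).2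
  rw [← Complex.ofReal_inj, ← integral_complex_ofReal]
  push_cast
  rw [Complex.ofReal_cpow (Nat.cast_nonneg m)]
  push_cast
  rw [← h]
  refine integral_congr_ae (ae_of_all _ fun u => ?_)
  simp only
  rw [norm_mul, norm_exp_neg_mul, Complex.norm_real, Real.norm_of_nonneg (le_max_right _ _)]
  push_cast
  rfl

theorem measurable_rieszMean (hr : ∀ m, 0 ≤ r m) : Measurable (rieszMean r) :=
  (rieszMean_mono hr).measurable

theorem integrableOn_rieszMean_exp (hr : ∀ m, 0 ≤ r m) {σ : ℝ} (hσ : 0 ≤ σ)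
    (hs : Summable fun m : ℕ => r m * (m : ℝ) ^ (-σ)) {s : ℂ} (hσs : 1 + σ < s.re) :
    IntegrableOn (fun u : ℝ => (rieszMean r (Real.exp u) : ℂ) * Complex.exp (-(s * u)))
      (Ioi 0) := by
  have hi := ((integrableOn_exp_mul_complex_Ioi (a := ((1 + σ - s.re : ℝ) : ℂ))
    (by rw [Complex.ofReal_re]; linarith) 0).norm).const_mul (∑' m : ℕ, r m * (m : ℝ) ^ (-σ))
  refine Integrable.mono' hi ?_ (ae_of_all _ fun u => ?_)
  · refine Measurable.aestronglyMeasurable ?_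
    have := (measurable_rieszMean hr).comp Real.measurable_exp
    exact (Complex.measurable_ofReal.comp this).mul (by fun_prop)
  · rw [norm_mul, norm_exp_neg_mul, Complex.norm_real, Real.norm_of_nonneg (rieszMean_nonneg hr _)]
    have h1 := rieszMean_le_rpow hr hσ hs (Real.exp_pos u)
    refine (mul_le_mul_of_nonneg_right h1 (Real.exp_pos _).le).trans (le_of_eq ?_)
    rw [← Complex.ofReal_mul, Complex.norm_exp_ofReal, mul_assoc, ← Real.exp_mul, ← Real.exp_add]
    congr 2
    ring

/-- Laplace transform of `u ↦ rieszMean r (exp u)`. -/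
theorem laplace_rieszMean_exp (hr : ∀ m, 0 ≤ r m) (h0 : r 0 = 0) {s : ℂ} (hs1 : 1 < s.re)
    (hs : Summable fun m : ℕ => r m * (m : ℝ) ^ (-(s.re - 1))) :
    ∫ u in Ioi (0 : ℝ), (rieszMean r (Real.exp u) : ℂ) * Complex.exp (-(s * u)) =
      (∑' m : ℕ, (r m : ℂ) * (m : ℂ) ^ (-(s - 1))) / ((s - 1) * s) := by
  set F : ℕ → ℝ → ℂ := fun m u =>
    (r m : ℂ) * (((max (Real.exp u - m) 0 : ℝ) : ℂ) * Complex.exp (-(s * u))) with hF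
  have hFi (m : ℕ) : IntegrableOn (F m) (Ioi 0) ∧
      (∫ u in Ioi (0 : ℝ), ‖F m u‖ = r m * (m : ℝ) ^ (-(s.re - 1)) / ((s.re - 1) * s.re)) ∧
      ∫ u in Ioi (0 : ℝ), F m u = (r m : ℂ) * (m : ℂ) ^ (-(s - 1)) / ((s - 1) * s) := by
    rcases Nat.eq_zero_or_pos m with rfl | hm
    · simp [hF, h0]
    · refine ⟨(laplace_max_exp_sub hm hs1).1.const_mul _, ?_, ?_⟩
      · simp only [hF]
        simp_rw [norm_mul (r m : ℂ)]
        rw [integral_const_mul, norm_laplace_max_exp_sub hm hs1, Complex.norm_real,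
          Real.norm_of_nonneg (hr m), mul_div_assoc]
      · simp only [hF]
        rw [integral_const_mul, (laplace_max_exp_sub hm hs1).2, mul_div_assoc]
  have h := hasSum_integral_of_summable_integral_norm (μ := volume.restrict (Ioi (0 : ℝ)))
    (F := F) (fun m => (hFi m).1) (by
      simp_rw [fun m => (hFi m).2.1]
      exact hs.div_const _)
  rw [← tsum_div_const, ← tsum_congr fun m => (hFi m).2.2, h.tsum_eq]
  refine integral_congr_ae (ae_of_all _ fun u => ?_)
  simp only [hF]
  have h1 := (Complex.hasSum_ofReal.2 (hasSum_rieszMean h0 (Real.exp u))).mul_right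
    (Complex.exp (-(s * u)))
  rw [← h1.tsum_eq]
  refine tsum_congr fun m => ?_
  push_cast
  ring

end RieszMean

section SmoothedRieszMean

open ProbabilityTheory
open scoped NNReal

variable {r : ℕ → ℝ}

theorem integrable_exp_const_mul_add_gaussianReal (v : ℝ≥0) (j L : ℝ) :
    Integrable (fun z : ℝ => Real.exp (j * (L + z))) (gaussianReal 0 v) := by
  simp_rw [mul_add, Real.exp_add]
  exact (integrable_exp_mul_gaussianReal j).const_mul _

theorem integral_exp_const_mul_add_gaussianReal (v : ℝ≥0) (j L : ℝ) :
    ∫ z, Real.exp (j * (L + z)) ∂gaussianReal 0 v = Real.exp (j * L + v * j ^ 2 / 2) := by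
  simp_rw [mul_add, Real.exp_add]
  rw [integral_const_mul]
  have h := congrFun (mgf_id_gaussianReal (μ := 0) (v := v)) j
  simp only [mgf, id, zero_mul, zero_add] at h
  rw [h]

theorem integrable_rieszMean_exp_gaussianReal (hr : ∀ m, 0 ≤ r m) {σ : ℝ} (hσ : 0 ≤ σ)
    (hs : Summable fun m : ℕ => r m * (m : ℝ) ^ (-σ)) (v : ℝ≥0) (L : ℝ) :
    Integrable (fun z : ℝ => rieszMean r (Real.exp (L + z))) (gaussianReal 0 v) := by
  refine ((integrable_exp_const_mul_add_gaussianReal v (1 + σ) L).const_mul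
    (∑' m : ℕ, r m * (m : ℝ) ^ (-σ))).mono' ?_ (ae_of_all _ fun z => ?_)
  · exact ((measurable_rieszMean hr).comp (by fun_prop)).aestronglyMeasurable
  · rw [Real.norm_of_nonneg (rieszMean_nonneg hr _)]
    refine (rieszMean_le_rpow hr hσ hs (Real.exp_pos _)).trans (le_of_eq ?_)
    rw [← Real.exp_mul, mul_comm (L + z)]

/-- Gaussian smoothing of the Riesz mean of a Dirichlet series with a simple pole at `1` and
polynomial growth `e` on a vertical line to the left of `0`. -/
theorem exists_abs_integral_rieszMean_sub_le (hr : ∀ m, 0 ≤ r m) (h0 : r 0 = 0)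
    (hs : ∀ σ : ℝ, 1 < σ → Summable fun m : ℕ => r m * (m : ℝ) ^ (-σ))
    {P : ℂ → ℂ} (hP : Differentiable ℂ P) (hPg : StripGrowth P) {κ : ℝ}
    (hPr : ∀ s : ℂ, 1 < s.re → ∑' m : ℕ, (r m : ℂ) * (m : ℂ) ^ (-s) = P s + κ / (s - 1))
    {δ e C : ℝ} (hδ : 0 < δ) (hδ' : δ ≤ 1 / 4) (he : 2 ≤ e)
    (hPb : ∀ t : ℝ, ‖P (-δ + t * Complex.I)‖ ≤ C * (1 + |t|) ^ e) :
    ∃ C₁ : ℝ, 0 ≤ C₁ ∧ ∀ η : ℝ≥0, 0 < η → η ≤ 1 → ∀ L : ℝ,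
      |∫ z, rieszMean r (Real.exp (L + z)) ∂gaussianReal 0 (η ^ 2) -
        κ / 2 * Real.exp (2 * L + 2 * η ^ 2)| ≤
      C₁ * (1 + Real.exp L) * (η : ℝ) ^ (-(e - 1)) := by
  obtain ⟨C₀, hC₀, hmain⟩ := norm_integral_gaussian_mul_dslope_le hP hPg hδ hδ' he hPb
  set A : ℝ → ℝ := fun u => rieszMean r (Real.exp u) with hA
  set k : ℝ → ℂ := fun u => (A u : ℂ) - κ * (((Real.exp u - 1) ^ 2 / 2 : ℝ) : ℂ) -
    P 0 * ((Real.exp u - 1 : ℝ) : ℂ) with hk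
  have hlap {s : ℂ} (hs2 : s.re = 2 + δ) :
      IntegrableOn (fun u : ℝ => k u * Complex.exp (-(s * u))) (Ioi 0) ∧
      ∫ u in Ioi (0 : ℝ), k u * Complex.exp (-(s * u)) = dslope P 0 (s - 1) / s := by
    have hi1 := integrableOn_rieszMean_exp hr (σ := 1 + δ / 2) (by linarith)
      (hs _ (by linarith)) (s := s) (by rw [hs2]; linarith)
    have hi2 := laplace_exp_sub_one_sq (s := s) (by rw [hs2]; linarith)
    have hi3 := laplace_exp_sub_one (s := s) (by rw [hs2]; linarith)
    have hc2 := hi2.1.const_mul (κ : ℂ)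
    have hc3 := hi3.1.const_mul (P 0)
    have h12 : IntegrableOn (fun u : ℝ => (A u : ℂ) * Complex.exp (-(s * u)) -
      κ * ((((Real.exp u - 1) ^ 2 / 2 : ℝ) : ℂ) * Complex.exp (-(s * u)))) (Ioi 0) := hi1.sub hc2
    have ek (u : ℝ) : k u * Complex.exp (-(s * u)) = (A u : ℂ) * Complex.exp (-(s * u)) -
      κ * ((((Real.exp u - 1) ^ 2 / 2 : ℝ) : ℂ) * Complex.exp (-(s * u))) -
      P 0 * (((Real.exp u - 1 : ℝ) : ℂ) * Complex.exp (-(s * u))) := by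
      simp only [hk]
      ring
    simp_rw [ek]
    refine ⟨h12.sub hc3, ?_⟩
    have hre {z : ℂ} (hz : z.re < 2) : s - z ≠ 0 := by
      intro h
      rw [sub_eq_zero] at h
      rw [h] at hs2
      linarith
    have hs0 : s ≠ 0 := by simpa using hre (z := 0) (by simp)
    have hs1 : s - 1 ≠ 0 := hre (by simp)
    have hs2' : s - 2 ≠ 0 := by
      intro h
      rw [sub_eq_zero] at h
      rw [h] at hs2
      simp at hs2
      linarith
    rw [integral_sub h12 hc3, integral_sub hi1 hc2, integral_const_mul, integral_const_mul, hi2.2,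
      hi3.2, laplace_rieszMean_exp hr h0 (by rw [hs2]; linarith)
        (hs _ (by rw [hs2]; linarith)),
      hPr (s - 1) (by rw [Complex.sub_re, hs2, Complex.one_re]; linarith),
      dslope_of_ne _ hs1, slope_def_field, show s - 1 - 1 = s - 2 by ring]
    field_simp
    ring
  refine ⟨C₀ + 2 * |κ| + 2 * ‖P 0‖, by positivity, fun η hη hη1 L => ?_⟩
  have hη0 : (0 : ℝ) < η := by exact_mod_cast hη
  have hη1' : (η : ℝ) ≤ 1 := by exact_mod_cast hη1
  have hv : η ^ 2 ≠ 0 := by positivity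
  have hvr : ((η ^ 2 : ℝ≥0) : ℝ) = (η : ℝ) ^ 2 := by push_cast; rfl
  -- the smoothed error term
  have hE : ‖∫ z, (Ioi 0).indicator k (L + z) ∂gaussianReal 0 (η ^ 2)‖ ≤
      C₀ * (1 + Real.exp L) * (η : ℝ) ^ (-(e - 1)) := by
    have hi : IntegrableOn (fun u : ℝ => k u * Complex.exp (-((2 + δ : ℝ) * u))) (Ioi 0) :=
      (hlap (s := ((2 + δ : ℝ) : ℂ)) (Complex.ofReal_re _)).1
    rw [integral_indicator_gaussianReal hv, setIntegral_mul_gaussianPDFReal hv hi]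
    have h1 (t : ℝ) : ∫ u in Ioi (0 : ℝ), k u * Complex.exp (-(((2 + δ : ℝ) + t * Complex.I) * u)) =
        dslope P 0 ((2 + δ : ℝ) + t * Complex.I - 1) / ((2 + δ : ℝ) + t * Complex.I) :=
      (hlap (by simp)).2
    simp_rw [h1]
    rw [norm_mul, hvr]
    have h2 : ‖(2 * Real.pi : ℂ)⁻¹‖ ≤ 1 := by
      rw [norm_inv, norm_mul, Complex.norm_real, Real.norm_of_nonneg Real.pi_pos.le,
        Complex.norm_ofNat]
      exact inv_le_one_of_one_le₀ (by linarith [Real.two_le_pi])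
    refine (mul_le_of_le_one_left (norm_nonneg _) h2).trans ((hmain η hη0 hη1' L).trans ?_)
    refine mul_le_mul_of_nonneg_right (mul_le_mul_of_nonneg_left ?_ hC₀) (by positivity)
    rcases le_total 0 L with h | h
    · have : Real.exp ((1 - δ) * L) ≤ Real.exp L := Real.exp_le_exp.2 (by nlinarith)
      linarith
    · have : Real.exp ((1 - δ) * L) ≤ 1 := Real.exp_le_one_iff.2 (by nlinarith)
      linarith [Real.exp_pos L]
  set μ := gaussianReal 0 (η ^ 2) with hμ
  have hAi : Integrable (fun z => A (L + z)) μ :=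
    integrable_rieszMean_exp_gaussianReal hr zero_le_two (hs 2 one_lt_two) _ L
  have hX1 := integrable_exp_const_mul_add_gaussianReal (η ^ 2) 1 L
  have hX2 := integrable_exp_const_mul_add_gaussianReal (η ^ 2) 2 L
  rw [← hμ] at hX1 hX2
  have hm1 : ∫ z, Real.exp (1 * (L + z)) ∂μ ≤ 2 * Real.exp L := by
    rw [hμ, integral_exp_const_mul_add_gaussianReal, hvr, one_mul, Real.exp_add, mul_comm]
    refine mul_le_mul_of_nonneg_right ?_ (Real.exp_pos _).le
    have : Real.exp ((η : ℝ) ^ 2 * 1 ^ 2 / 2) ≤ Real.exp (1 / 2) := Real.exp_le_exp.2 (by nlinarith)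
    refine this.trans ?_
    have h4 : Real.exp (1 / 2) ^ 2 = Real.exp 1 := by rw [← Real.exp_nat_mul]; norm_num
    nlinarith [Real.exp_one_lt_d9, Real.exp_pos (1 / 2)]
  have hm2 : ∫ z, Real.exp (2 * (L + z)) ∂μ = Real.exp (2 * L + 2 * η ^ 2) := by
    rw [hμ, integral_exp_const_mul_add_gaussianReal, hvr]
    congr 1
    ring
  -- pointwise decomposition
  have hpt (z : ℝ) : ‖((A (L + z) - κ / 2 * Real.exp (2 * (L + z)) : ℝ) : ℂ) -
      (Ioi 0).indicator k (L + z)‖ ≤ (|κ| + ‖P 0‖) * Real.exp (1 * (L + z)) := by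
    set u := L + z with hu
    have hsq : Real.exp (2 * u) = Real.exp u ^ 2 := by rw [← Real.exp_nat_mul]; norm_num
    rw [one_mul]
    set Y := Real.exp u with hY
    have hY0 : 0 < Y := Real.exp_pos u
    rcases lt_or_ge 0 u with h | h
    · have hY1 : 1 ≤ Y := Real.one_le_exp h.le
      rw [indicator_of_mem (mem_Ioi.2 h)]
      have e1 : ((A u - κ / 2 * Real.exp (2 * u) : ℝ) : ℂ) - k u =
          ((κ * (1 / 2 - Y) : ℝ) : ℂ) + P 0 * ((Y - 1 : ℝ) : ℂ) := by
        simp only [hk, hsq, ← hY]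
        push_cast
        ring
      rw [e1]
      refine (norm_add_le _ _).trans ?_
      rw [norm_mul, Complex.norm_real, Complex.norm_real, Real.norm_eq_abs, abs_mul,
        Real.norm_of_nonneg (by linarith : 0 ≤ Y - 1), abs_of_nonpos (by linarith : 1 / 2 - Y ≤ 0)]
      nlinarith [abs_nonneg κ, norm_nonneg (P 0)]
    · have hY1 : Y ≤ 1 := Real.exp_le_one_iff.2 h
      rw [indicator_of_notMem (by simpa using h), hA, sub_zero, Complex.norm_real]
      simp only [hsq, ← hY]
      rw [rieszMean_of_le_one hY1, zero_sub, norm_neg, Real.norm_eq_abs, abs_mul, abs_div, abs_two,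
        abs_of_nonneg (by positivity : (0 : ℝ) ≤ Y ^ 2)]
      nlinarith [abs_nonneg κ, norm_nonneg (P 0), mul_nonneg (norm_nonneg (P 0)) hY0.le,
        mul_nonneg (abs_nonneg κ) hY0.le, mul_le_mul_of_nonneg_left hY1 (mul_nonneg (abs_nonneg κ) hY0.le)]
  have hre : Integrable (fun z => ((A (L + z) - κ / 2 * Real.exp (2 * (L + z)) : ℝ) : ℂ)) μ :=
    (hAi.sub (hX2.const_mul (κ / 2))).ofReal
  have hki : Integrable (fun z => (Ioi 0).indicator k (L + z)) μ := by
    have hA' : Measurable A := (measurable_rieszMean hr).comp Real.measurable_exp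
    have hkm : Measurable k := by
      simp only [hk]
      fun_prop
    have hmeas : AEStronglyMeasurable (fun z => (Ioi 0).indicator k (L + z)) μ :=
      ((hkm.indicator measurableSet_Ioi).comp (by fun_prop)).aestronglyMeasurable
    have hd : Integrable (fun z => ((A (L + z) - κ / 2 * Real.exp (2 * (L + z)) : ℝ) : ℂ) -
        (Ioi 0).indicator k (L + z)) μ :=
      (hX1.const_mul (|κ| + ‖P 0‖)).mono' (hre.aestronglyMeasurable.sub hmeas) (ae_of_all _ hpt)
    exact (hre.sub hd).congr (ae_of_all _ fun z => by simp)
  have hfin : ‖((∫ z, A (L + z) ∂μ - κ / 2 * Real.exp (2 * L + 2 * η ^ 2) : ℝ) : ℂ) -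
      ∫ z, (Ioi 0).indicator k (L + z) ∂μ‖ ≤ (|κ| + ‖P 0‖) * (2 * Real.exp L) := by
    rw [← hm2, ← integral_const_mul, ← integral_sub hAi (hX2.const_mul _),
      ← integral_complex_ofReal, ← integral_sub hre hki]
    refine (norm_integral_le_of_norm_le (hX1.const_mul _) (ae_of_all _ hpt)).trans ?_
    rw [integral_const_mul]
    exact mul_le_mul_of_nonneg_left hm1 (by positivity)
  have htri := norm_le_norm_sub_add
    ((∫ z, A (L + z) ∂μ - κ / 2 * Real.exp (2 * L + 2 * η ^ 2) : ℝ) : ℂ)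
    (∫ z, (Ioi 0).indicator k (L + z) ∂μ)
  rw [Complex.norm_real, Real.norm_eq_abs] at htri
  have hpow : 1 ≤ (η : ℝ) ^ (-(e - 1)) := Real.one_le_rpow_of_pos_of_le_one_of_nonpos hη0 hη1' (by linarith)
  refine (htri.trans (add_le_add hfin hE)).trans ?_
  have h6 : 0 ≤ (|κ| + ‖P 0‖) * Real.exp L := by positivity
  have h7 : 0 ≤ |κ| + ‖P 0‖ := by positivity
  nlinarith [mul_le_mul_of_nonneg_left hpow h6, mul_le_mul_of_nonneg_left hpow h7]

end SmoothedRieszMean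

section Tauberian

open ProbabilityTheory
open scoped NNReal

variable {r : ℕ → ℝ}

theorem rieszMean_le_integral_gaussianReal (hr : ∀ m, 0 ≤ r m) {σ : ℝ} (hσ : 0 ≤ σ)
    (hs : Summable fun m : ℕ => r m * (m : ℝ) ^ (-σ)) (v : ℝ≥0) {x : ℝ} (hx : 0 < x) :
    rieszMean r x ≤ ∫ z, rieszMean r (Real.exp (Real.log x - v / 2 + z)) ∂gaussianReal 0 v := by
  set L := Real.log x - v / 2 with hL
  have hi := integrable_exp_const_mul_add_gaussianReal v 1 L
  have hE : ∫ z, Real.exp (1 * (L + z)) ∂gaussianReal 0 v = x := by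
    rw [integral_exp_const_mul_add_gaussianReal, show 1 * L + v * 1 ^ 2 / 2 = Real.log x by
      rw [hL]; ring, Real.exp_log hx]
  simp only [one_mul] at hi hE
  have hi2 : Integrable (fun z : ℝ => Real.exp (L + z) - x) (gaussianReal 0 v) :=
    hi.sub (integrable_const x)
  have h : ∫ z, (rieszMean r x + (∑ m ∈ Finset.Icc 1 ⌊x⌋₊, r m) * (Real.exp (L + z) - x))
      ∂gaussianReal 0 v = rieszMean r x := by
    rw [integral_add (integrable_const _) (hi2.const_mul _), integral_const_mul,
      integral_sub hi (integrable_const x), hE]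
    simp
  rw [← h]
  exact integral_mono ((integrable_const _).add (hi2.const_mul _))
    (integrable_rieszMean_exp_gaussianReal hr hσ hs v L) fun z => rieszMean_add_mul_le hr _ _

/-- Removing a Gaussian smoothing from a Riesz mean, using its convexity. -/
theorem exists_abs_rieszMean_sub_le (hr : ∀ m, 0 ≤ r m) {σ : ℝ} (hσ : 0 ≤ σ)
    (hs : Summable fun m : ℕ => r m * (m : ℝ) ^ (-σ)) {κ C₁ a : ℝ} (hκ : 0 ≤ κ) (hC₁ : 0 ≤ C₁)
    (hM : ∀ η : ℝ≥0, 0 < η → η ≤ 1 → ∀ L : ℝ,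
      |∫ z, rieszMean r (Real.exp (L + z)) ∂gaussianReal 0 (η ^ 2) -
        κ / 2 * Real.exp (2 * L + 2 * η ^ 2)| ≤ C₁ * (1 + Real.exp L) * (η : ℝ) ^ (-a)) :
    ∃ C₂ : ℝ, 0 ≤ C₂ ∧ ∀ η : ℝ, 0 < η → η ≤ 1 → ∀ x : ℝ, 1 ≤ x →
      |rieszMean r x - κ / 2 * x ^ 2| ≤ C₂ * (η ^ 2 * x ^ 2 + x * η ^ (-a)) := by
  refine ⟨450 * κ + 10 * C₁, by positivity, fun η' hη' hη1' x hx => ?_⟩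
  lift η' to ℝ≥0 using hη'.le with η
  have hη : 0 < η := by exact_mod_cast hη'
  have hη1 : η ≤ 1 := by exact_mod_cast hη1'
  specialize hM η hη hη1
  set v : ℝ≥0 := η ^ 2 with hv
  have hvr : (v : ℝ) = (η : ℝ) ^ 2 := by rw [hv]; push_cast; rfl
  rw [← hvr] at hM ⊢
  have hv0 : (0 : ℝ) ≤ v := v.2
  have hv1 : (v : ℝ) ≤ 1 := by rw [hvr]; nlinarith
  set E := (η : ℝ) ^ (-a) with hE
  have hE0 : 0 ≤ E := by positivity
  have hx0 : 0 < x := by linarith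
  set q := Real.exp ((v : ℝ) / 2) with hq
  have hq1 : 1 ≤ q := Real.one_le_exp (by positivity)
  have hqv : q ≤ 1 + v := by
    refine (Real.exp_bound_div_one_sub_of_interval (by positivity) (by linarith)).trans ?_
    rw [div_le_iff₀ (by linarith)]
    nlinarith
  have hqn (k : ℕ) : q ^ k = Real.exp (k * (v / 2)) := by rw [hq, ← Real.exp_nat_mul]
  have hupper_pos (y : ℝ) (hy : 0 < y) : rieszMean r y ≤
      κ / 2 * (y ^ 2 * q ^ 2) + C₁ * (1 + y) * E := by
    have h1 := rieszMean_le_integral_gaussianReal hr hσ hs v hy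
    have h2 := (abs_le.1 (hM (Real.log y - v / 2))).2
    have h3 : Real.exp (2 * (Real.log y - v / 2) + 2 * v) = y ^ 2 * q ^ 2 := by
      rw [hqn, show 2 * (Real.log y - v / 2) + 2 * v = Real.log y + Real.log y +
        ((2 : ℕ) : ℝ) * (v / 2) by push_cast; ring, Real.exp_add, Real.exp_add, Real.exp_log hy]
      ring
    have h4 : Real.exp (Real.log y - v / 2) ≤ y := by
      conv_rhs => rw [← Real.exp_log hy]
      exact Real.exp_le_exp.2 (by linarith)
    rw [h3] at h2
    have h5 : C₁ * (1 + Real.exp (Real.log y - v / 2)) * E ≤ C₁ * (1 + y) * E := by gcongr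
    linarith
  have hupper (y : ℝ) : rieszMean r y ≤ κ / 2 * (y ^ 2 * q ^ 2) + C₁ * (1 + |y|) * E := by
    rcases lt_or_ge 0 y with hy | hy
    · rw [abs_of_pos hy]
      exact hupper_pos y hy
    · rw [rieszMean_of_le_one (by linarith)]
      positivity
  set L := Real.log x with hL
  have hexpL : Real.exp L = x := Real.exp_log hx0
  have hexp2L : Real.exp (2 * L) = x ^ 2 := by rw [← hexpL, ← Real.exp_nat_mul]; norm_num
  have hM2 := (abs_le.1 (hM L)).1
  rw [hexpL, Real.exp_add, hexp2L, show 2 * (v : ℝ) = ((4 : ℕ) : ℝ) * (v / 2) by push_cast; ring,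
    ← hqn] at hM2
  have hX1 := integrable_exp_const_mul_add_gaussianReal v 1 L
  have hX2 := integrable_exp_const_mul_add_gaussianReal v 2 L
  have hm1 : ∫ z, Real.exp (1 * (L + z)) ∂gaussianReal 0 v = x * q := by
    rw [integral_exp_const_mul_add_gaussianReal, Real.exp_add, one_mul, hexpL, one_pow, mul_one]
  have hm2 : ∫ z, Real.exp (2 * (L + z)) ∂gaussianReal 0 v = x ^ 2 * q ^ 4 := by
    rw [integral_exp_const_mul_add_gaussianReal, Real.exp_add, hexp2L, hqn]
    congr 2
    push_cast
    ring
  have hAi := integrable_rieszMean_exp_gaussianReal hr hσ hs v L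
  have hpt (z : ℝ) : 2 * rieszMean r (Real.exp (L + z)) ≤
      (2 * κ * q ^ 2) * Real.exp (2 * (L + z)) +
      (2 * C₁ * E - 2 * κ * q ^ 2 * x) * Real.exp (1 * (L + z)) +
      (rieszMean r x + κ / 2 * q ^ 2 * x ^ 2 + C₁ * E * (1 + x)) := by
    have h1 := two_mul_rieszMean_le hr x (Real.exp (L + z))
    have h2 := hupper (2 * Real.exp (L + z) - x)
    have h3 : |2 * Real.exp (L + z) - x| ≤ 2 * Real.exp (L + z) + x := by
      have := Real.exp_pos (L + z)
      rw [abs_le]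
      constructor <;> linarith
    have h4 : C₁ * (1 + |2 * Real.exp (L + z) - x|) * E ≤
        C₁ * (1 + (2 * Real.exp (L + z) + x)) * E := by gcongr
    have h5 : Real.exp (2 * (L + z)) = Real.exp (L + z) ^ 2 := by
      rw [← Real.exp_nat_mul]; norm_num
    rw [h5, one_mul]
    linarith
  have hI1 := hX2.const_mul (2 * κ * q ^ 2)
  have hI2 := hX1.const_mul (2 * C₁ * E - 2 * κ * q ^ 2 * x)
  have hI12 : Integrable (fun z : ℝ => (2 * κ * q ^ 2) * Real.exp (2 * (L + z)) +
      (2 * C₁ * E - 2 * κ * q ^ 2 * x) * Real.exp (1 * (L + z))) (gaussianReal 0 v) := hI1.add hI2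
  have hint := integral_mono (hAi.const_mul 2) (hI12.add (integrable_const
    (rieszMean r x + κ / 2 * q ^ 2 * x ^ 2 + C₁ * E * (1 + x)))) hpt
  rw [integral_const_mul] at hint
  simp only [Pi.add_apply] at hint
  rw [integral_add hI12 (integrable_const _), integral_add hI1 hI2, integral_const_mul,
    integral_const_mul, hm1, hm2, integral_const, probReal_univ, one_smul] at hint
  have hq2 : q ≤ 2 := by linarith
  have hκx : 0 ≤ κ * x ^ 2 := by positivity
  have hCE : 0 ≤ C₁ * E := by positivity
  have hCEx : C₁ * E ≤ C₁ * E * x := le_mul_of_one_le_right hCE hx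
  have hqx : C₁ * E * x * q ≤ C₁ * E * x * 2 := by gcongr
  have hvE : 0 ≤ v * x ^ 2 * C₁ := by positivity
  have hκE : 0 ≤ κ * x * E := by positivity
  rw [abs_le]
  constructor
  · have hpoly : -(900 * v) ≤ 2 * q ^ 4 - 4 * q ^ 6 + 4 * q ^ 3 - q ^ 2 - 1 := by
      have h1 : 2 * q ^ 4 - 4 * q ^ 6 + 4 * q ^ 3 - q ^ 2 - 1 =
          -(q - 1) * (4 * q ^ 5 + 4 * q ^ 4 + 2 * q ^ 3 - 2 * q ^ 2 - q - 1) := by ring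
      have h2 : 4 * q ^ 5 + 4 * q ^ 4 + 2 * q ^ 3 - 2 * q ^ 2 - q - 1 ≤ 900 := by
        have h3 : q ^ 5 ≤ 2 ^ 5 := by gcongr
        have h4 : q ^ 4 ≤ 2 ^ 4 := by gcongr
        have h5 : q ^ 3 ≤ 2 ^ 3 := by gcongr
        nlinarith
      rw [h1]
      nlinarith
    have h2 := mul_le_mul_of_nonneg_left hpoly hκx
    linarith
  · have h1 := hupper_pos x hx0
    have h2 : q ^ 2 ≤ 1 + 3 * v := by nlinarith
    have h3 := mul_le_mul_of_nonneg_left h2 hκx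
    have h4 : 0 ≤ κ * x ^ 2 * v := by positivity
    linarith

end Tauberian

theorem intervalIntegral_sum_Icc_floor {r : ℕ → ℝ} (h0 : r 0 = 0) {x : ℝ} (hx : 1 ≤ x) :
    IntervalIntegrable (fun t : ℝ => ∑ m ∈ Finset.Icc 1 ⌊t⌋₊, r m) volume 1 x ∧
    ∫ t in (1 : ℝ)..x, ∑ m ∈ Finset.Icc 1 ⌊t⌋₊, r m = rieszMean r x := by
  have hIcc (N : ℕ) (f : ℕ → ℝ) (hf : f 0 = 0) :
      ∑ m ∈ Finset.Icc 0 N, f m = ∑ m ∈ Finset.Icc 1 N, f m := by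
    rw [Finset.Icc_eq_cons_Ioc N.zero_le, Finset.sum_cons, hf, zero_add,
      ← Finset.Icc_add_one_left_eq_Ioc, zero_add]
  constructor
  · rw [intervalIntegrable_iff_integrableOn_Icc_of_le hx]
    have h := integrableOn_mul_sum_Icc (𝕜 := ℝ) (c := r) (m := 1) (a := 1) (b := x) zero_le_one
      (g := fun _ => 1) (integrableOn_const (by simp))
    simpa using h
  · have h := sum_mul_eq_sub_integral_mul₀ (𝕜 := ℝ) (f := fun t => t) r h0 x
      (fun t _ => differentiableAt_id) (by simp)
    simp only [deriv_id'', one_mul] at h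
    rw [hIcc _ (fun m => (m : ℝ) * r m) (by simp), hIcc _ r h0] at h
    rw [intervalIntegral.integral_of_le hx, rieszMean]
    simp_rw [hIcc _ r h0] at h
    simp_rw [mul_sub, Finset.sum_sub_distrib, ← Finset.sum_mul]
    simp_rw [mul_comm (r _)]
    linarith

theorem summable_rK_mul_rpow (K : Type*) [Field K] [NumberField K] {σ : ℝ} (hσ : 1 < σ) :
    Summable fun m : ℕ => (rK K m : ℝ) * (m : ℝ) ^ (-σ) := by
  refine (summable_rK_mul_cpow K (s := σ) (by simpa using hσ)).norm.congr fun m => ?_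
  have h : (m : ℂ) ^ (-σ : ℂ) = (((m : ℝ) ^ (-σ) : ℝ) : ℂ) := by
    rw [Complex.ofReal_cpow (Nat.cast_nonneg m)]
    push_cast
    rfl
  rw [h, norm_mul, Complex.norm_natCast, Complex.norm_real, Real.norm_of_nonneg (by positivity)]

/-- The residue of the continued Dedekind zeta function, computed along the real axis. -/
theorem residue_eq_of_tendsto (K : Type*) [Field K] [NumberField K] {P : ℂ → ℂ} {κ' : ℂ}
    (hP : Differentiable ℂ P)
    (hPr : ∀ s : ℂ, 1 < s.re →
      ∑' m : ℕ, (rK K m : ℂ) * (m : ℂ) ^ (-s) = P s + κ' / (s - 1)) {κ : ℝ}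
    (hκ : Tendsto (fun s : ℝ => (s - 1) * ∑' m : ℕ, (rK K m : ℝ) / (m : ℝ) ^ s)
      (nhdsWithin 1 (Ioi 1)) (nhds κ)) : κ' = κ := by
  have h1 : Tendsto (fun s : ℝ => ((s : ℂ) - 1) * P s + κ') (nhdsWithin 1 (Ioi 1)) (nhds κ') := by
    have h : Continuous fun s : ℝ => ((s : ℂ) - 1) * P s + κ' := by
      have := hP.continuous
      fun_prop
    simpa using (h.tendsto 1).mono_left nhdsWithin_le_nhds
  have h2 := (Complex.continuous_ofReal.tendsto κ).comp hκ
  refine tendsto_nhds_unique (h1.congr' ?_) h2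
  filter_upwards [self_mem_nhdsWithin] with s hs
  have hs1 : (1 : ℝ) < s := hs
  have hne : (s : ℂ) - 1 ≠ 0 := by
    rw [sub_ne_zero]
    exact_mod_cast hs1.ne'
  have h3 := hPr s (by simpa using hs1)
  have h4 : ∑' m : ℕ, (rK K m : ℂ) * (m : ℂ) ^ (-s : ℂ) =
      ((∑' m : ℕ, (rK K m : ℝ) / (m : ℝ) ^ s : ℝ) : ℂ) := by
    rw [Complex.ofReal_tsum]
    refine tsum_congr fun m => ?_
    push_cast
    rw [Complex.ofReal_cpow (Nat.cast_nonneg m), Complex.cpow_neg, div_eq_mul_inv]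
    push_cast
    rfl
  rw [h4] at h3
  simp only [Function.comp_apply]
  rw [Complex.ofReal_mul, h3]
  push_cast
  field_simp

/-- Mean-value estimate for the remainder in the ideal theorem, degree `n ≥ 6`:
`(1/x) ∫₁ˣ (∑_{m ≤ t} r_K(m) - κ_K t) dt = O(x^{1-3/n+ε})` for `x ≥ d_K^{1/2}` large. -/
theorem stmt1 (K : Type*) [Field K] [NumberField K]
    (hn : 6 ≤ Module.finrank ℚ K)
    (κ : ℝ)
    (hκ : Filter.Tendsto
      (fun s : ℝ => (s - 1) * ∑' m : ℕ, (rK K m : ℝ) / (m : ℝ) ^ s)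
      (nhdsWithin 1 (Set.Ioi 1)) (nhds κ))
    (ε : ℝ) (hε : ε ∈ Set.Ioo (0 : ℝ) (1/2)) :
    ∃ C > 0, ∀ᶠ x : ℝ in atTop,
      Real.sqrt |(NumberField.discr K : ℝ)| ≤ x →
      |(1 / x) * ∫ t in (1:ℝ)..x,
          ((∑ m ∈ Finset.Icc 1 ⌊t⌋₊, (rK K m : ℝ)) - κ * t)|
        ≤ C * x ^ ((1 : ℝ) - 3 / (Module.finrank ℚ K : ℝ) + ε) := by
  obtain ⟨hε0, hε1⟩ := hε
  obtain ⟨P, κ', hP, hPg, hPr, hPb⟩ := exists_dedekindZeta_continuation K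
  obtain rfl := residue_eq_of_tendsto K hP hPr hκ
  set n : ℝ := ((Module.finrank ℚ K : ℕ) : ℝ) with hndef
  have hn6 : 6 ≤ n := by
    rw [hndef]
    exact_mod_cast hn
  have hn0 : 0 < n := by linarith
  have hκ0 : 0 ≤ κ := by
    refine ge_of_tendsto hκ ?_
    filter_upwards [self_mem_nhdsWithin] with s hs
    exact mul_nonneg (by linarith [mem_Ioi.1 hs]) (tsum_nonneg fun m => by positivity)
  set δ := ε / 2 with hδ
  obtain ⟨C, hC⟩ := hPb δ (by linarith) (by linarith)
  set r : ℕ → ℝ := fun m => if m = 0 then 0 else (rK K m : ℝ) with hrdef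
  have hr0 : r 0 = 0 := rfl
  have hrm {m : ℕ} (hm : m ≠ 0) : r m = rK K m := if_neg hm
  have hr (m : ℕ) : 0 ≤ r m := by
    by_cases hm : m = 0
    · rw [hm, hr0]
    · rw [hrm hm]
      positivity
  have hs (σ : ℝ) (hσ : 1 < σ) : Summable fun m : ℕ => r m * (m : ℝ) ^ (-σ) := by
    refine (summable_rK_mul_rpow K hσ).congr fun m => ?_
    by_cases hm : m = 0
    · rw [hm, Nat.cast_zero, Real.zero_rpow (by linarith), mul_zero, mul_zero]
    · rw [hrm hm]
  have hrP (s : ℂ) (hs : 1 < s.re) :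
      ∑' m : ℕ, (r m : ℂ) * (m : ℂ) ^ (-s) = P s + κ / (s - 1) := by
    rw [← hPr s hs]
    refine tsum_congr fun m => ?_
    by_cases hm : m = 0
    · have hs0 : -s ≠ 0 := by
        rw [neg_ne_zero]
        rintro rfl
        simp at hs
        linarith
      rw [hm, Nat.cast_zero, Complex.zero_cpow hs0, mul_zero, mul_zero]
    · rw [hrm hm, Complex.ofReal_natCast]
  obtain ⟨C₁, hC₁, hM⟩ := exists_abs_integral_rieszMean_sub_le hr hr0 hs hP hPg hrP
    (by linarith) (by linarith) (by nlinarith) hC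
  obtain ⟨C₂, hC₂, hA⟩ := exists_abs_rieszMean_sub_le hr zero_le_two (hs 2 one_lt_two) hκ0 hC₁ hM
  refine ⟨2 * C₂ + κ + 1, by positivity, ?_⟩
  filter_upwards [eventually_ge_atTop 1] with x hx _
  have hx0 : 0 < x := by linarith
  set η := x ^ (-(3 / (2 * n))) with hη
  have hη0 : 0 < η := by positivity
  have hη1 : η ≤ 1 := Real.rpow_le_one_of_one_le_of_nonpos hx (neg_nonpos.2 (by positivity))
  have h3n : 3 / n ≤ 1 / 2 := by rw [div_le_div_iff₀ hn0 two_pos]; linarith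
  set p := 1 - 3 / n + ε with hp
  have hp0 : 0 ≤ p := by linarith
  have hpow1 : η ^ 2 * x ^ 2 ≤ x * x ^ p := by
    rw [hη, ← Real.rpow_natCast (x ^ _) 2, ← Real.rpow_mul hx0.le, ← Real.rpow_natCast x 2,
      ← Real.rpow_add hx0, ← Real.rpow_one_add' hx0.le (by positivity)]
    refine Real.rpow_le_rpow_of_exponent_le hx ?_
    have : -(3 / (2 * n)) * ((2 : ℕ) : ℝ) = -(3 / n) := by push_cast; field_simp
    rw [this, hp]
    push_cast
    linarith
  have hpow2 : x * η ^ (-(n / 2 + n * δ - 1)) ≤ x * x ^ p := by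
    refine mul_le_mul_of_nonneg_left ?_ hx0.le
    rw [hη, ← Real.rpow_mul hx0.le]
    refine Real.rpow_le_rpow_of_exponent_le hx ?_
    have : -(3 / (2 * n)) * -(n / 2 + n * δ - 1) = 3 / 4 + 3 * δ / 2 - 3 / n / 2 := by
      field_simp
      ring
    rw [this, hp, hδ]
    linarith
  have hxp : 1 ≤ x ^ p := Real.one_le_rpow hx hp0
  have hmain := hA η hη0 hη1 x hx
  have hmain2 : |rieszMean r x - κ / 2 * x ^ 2| ≤ C₂ * (2 * (x * x ^ p)) :=
    hmain.trans (mul_le_mul_of_nonneg_left (by linarith) hC₂)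
  obtain ⟨hi, hI⟩ := intervalIntegral_sum_Icc_floor hr0 hx
  have hsum (t : ℝ) : ∑ m ∈ Finset.Icc 1 ⌊t⌋₊, (rK K m : ℝ) = ∑ m ∈ Finset.Icc 1 ⌊t⌋₊, r m := by
    refine Finset.sum_congr rfl fun m hm => (hrm ?_).symm
    rw [Finset.mem_Icc] at hm
    lia
  simp_rw [hsum]
  rw [intervalIntegral.integral_sub hi (Continuous.intervalIntegrable (by fun_prop) _ _), hI,
    intervalIntegral.integral_const_mul, integral_id, abs_mul, abs_of_pos (by positivity : 0 < 1 / x),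
    one_div_mul_eq_div, div_le_iff₀ hx0]
  have htri : |rieszMean r x - κ * ((x ^ 2 - 1 ^ 2) / 2)| ≤
      |rieszMean r x - κ / 2 * x ^ 2| + κ / 2 := by
    rw [show rieszMean r x - κ * ((x ^ 2 - 1 ^ 2) / 2) =
      rieszMean r x - κ / 2 * x ^ 2 + κ / 2 by ring]
    exact (abs_add_le _ _).trans_eq (by rw [abs_of_nonneg (by positivity : 0 ≤ κ / 2)])
  have hxx : 1 ≤ x * x ^ p := by nlinarith
  nlinarith [mul_le_mul_of_nonneg_left hxx hκ0]
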